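/- arXiv:2601.02266 — 2 statements merged into one kernel-verified Lean document; each statement's English description precedes it below -/
import Mathlib

section
/- For every n ≥ 3 and every m ≥ 3 there exist a constant C ≥ 1, a continuum X ⊆ Sⁿ, and pairwise disjoint nonempty open connected sets M_1, …, M_m ⊆ Sⁿ such that Sⁿ \ X = M_1 ∪ ⋯ ∪ M_m, the frontier of M_i in Sⁿ equals X for every i (so X is a Wada continuum whose complement has exactly the m components M_1, …, M_m), every M_i is homeomorphic (as a topological subspace) to the open unit ball of ℝⁿ, and every M_i is a C-John domain in Sⁿ. -/
open Set Metric

/-- A set `D` in a metric space `E` is a `C`-John domain if it is open, connected,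
not all of `E`, and any two points of `D` can be joined by a rectifiable curve in `D`
satisfying the John length-distance condition. -/
def IsJohnDomain {E : Type*} [MetricSpace E] (C : ℝ) (D : Set E) : Prop :=
  IsOpen D ∧ IsConnected D ∧ D ≠ univ ∧
    ∀ a ∈ D, ∀ b ∈ D, ∃ γ : ℝ → E,
      ContinuousOn γ (Icc 0 1) ∧ γ 0 = a ∧ γ 1 = b ∧
      MapsTo γ (Icc 0 1) D ∧
      eVariationOn γ (Icc 0 1) ≠ ⊤ ∧
      ∀ t ∈ Icc (0 : ℝ) 1,
        min (eVariationOn γ (Icc 0 t)) (eVariationOn γ (Icc t 1)) ≤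
          ENNReal.ofReal (C * infDist (γ t) Dᶜ)

namespace Wada

section Topology

open Topology Filter

variable {X : Type*} [TopologicalSpace X]

/-- `V` is homeomorphic to `U` by homeomorphisms fixing any prescribed compact subset of `U`. -/
def Expands (U V : Set X) : Prop :=
  ∀ K : Set X, IsCompact K → K ⊆ U → ∃ e : U ≃ₜ V, ∀ x : U, (x : X) ∈ K → (e x : X) = x

theorem Expands.refl (U : Set X) : Expands U U :=
  fun _ _ _ => ⟨Homeomorph.refl _, fun _ _ => rfl⟩

theorem Expands.subset {U V : Set X} (h : Expands U V) : U ⊆ V := by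
  intro x hx
  obtain ⟨e, he⟩ := h {x} isCompact_singleton (by simpa using hx)
  have := he ⟨x, hx⟩ rfl
  rw [← show (e ⟨x, hx⟩ : X) = x from this]
  exact (e ⟨x, hx⟩).2

theorem Expands.trans {U V W : Set X} (h₁ : Expands U V) (h₂ : Expands V W) : Expands U W := by
  intro K hK hKU
  obtain ⟨e₁, he₁⟩ := h₁ K hK hKU
  obtain ⟨e₂, he₂⟩ := h₂ K hK (hKU.trans h₁.subset)
  refine ⟨e₁.trans e₂, fun x hx => ?_⟩
  have h := he₁ x hx
  rw [Homeomorph.trans_apply, he₂ _ (by rwa [h]), h]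

theorem Expands.nonempty_homeomorph_iUnion [LocallyCompactSpace X] [SecondCountableTopology X]
    {U : ℕ → Set X} (hU : ∀ k, IsOpen (U k)) (h : ∀ k, Expands (U k) (U (k + 1))) :
    Nonempty (U 0 ≃ₜ (⋃ k, U k : Set X)) := by
  have hmono : Monotone U := monotone_nat_of_le_succ fun k => (h k).subset
  have : ∀ k, LocallyCompactSpace (U k) := fun k => (hU k).locallyCompactSpace
  let P : ∀ k, CompactExhaustion (U k) := fun k => CompactExhaustion.choice (U k)
  let S : ℕ → Type _ := fun k => {p : (U 0 ≃ₜ U k) × Set X // IsCompact p.2 ∧ p.2 ⊆ U k}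
  let enl : ∀ k, (U 0 ≃ₜ U k) → Set X → Set X := fun k F K =>
    K ∪ (⋃ i : Fin (k + 1), (fun x : U i => (x : X)) '' P i k) ∪ (fun x => (F x : X)) '' P 0 k
  have henl : ∀ k F K, IsCompact K → K ⊆ U k →
      IsCompact (enl k F K) ∧ enl k F K ⊆ U k := by
    intro k F K hK hKU
    have h1 : IsCompact (⋃ i : Fin (k + 1), (fun x : U i => (x : X)) '' P i k) :=
      isCompact_iUnion fun i : Fin (k + 1) => ((P i).isCompact k).image continuous_subtype_val
    have h2 : IsCompact ((fun x => (F x : X)) '' P 0 k) :=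
      ((P 0).isCompact k).image (continuous_subtype_val.comp F.continuous)
    refine ⟨(hK.union h1).union h2, ?_⟩
    refine union_subset (union_subset hKU (iUnion_subset fun i => ?_)) ?_
    · rintro _ ⟨x, -, rfl⟩
      exact hmono (Nat.lt_succ_iff.1 i.2) x.2
    · rintro _ ⟨x, -, rfl⟩
      exact (F x).2
  let step : ∀ k, S k → S (k + 1) := fun k p =>
    ⟨(p.1.1.trans (h k p.1.2 p.2.1 p.2.2).choose,
      enl (k + 1) (p.1.1.trans (h k p.1.2 p.2.1 p.2.2).choose) p.1.2),
      henl _ _ _ p.2.1 (p.2.2.trans (hmono k.le_succ))⟩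
  let q : ∀ k, S k := fun k => Nat.rec (motive := S)
    ⟨(Homeomorph.refl _, enl 0 (Homeomorph.refl _) ∅), henl _ _ _ isCompact_empty (by simp)⟩ step k
  let F : ∀ k, U 0 ≃ₜ U k := fun k => (q k).1.1
  let K : ℕ → Set X := fun k => (q k).1.2
  have hKU : ∀ k, K k ⊆ U k := fun k => (q k).2.2
  have hF : ∀ k x, (F k x : X) ∈ K k → (F (k + 1) x : X) = F k x := fun k x hx =>
    (h k (K k) (q k).2.1 (q k).2.2).choose_spec (F k x) hx
  have hKm : Monotone K := monotone_nat_of_le_succ fun k x hx => Or.inl (Or.inl hx)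
  have hKenl : ∀ k, ∃ K₀, K k = enl k (F k) K₀ := by
    rintro (_ | k)
    · exact ⟨_, rfl⟩
    · exact ⟨_, rfl⟩
  have hP : ∀ i k, i ≤ k → ∀ x : U i, x ∈ P i k → (x : X) ∈ K k := by
    intro i k hik x hx
    obtain ⟨K₀, hK₀⟩ := hKenl k
    rw [hK₀]
    exact Or.inl (Or.inr (mem_iUnion.2 ⟨⟨i, Nat.lt_succ_iff.2 hik⟩, x, hx, rfl⟩))
  have hR : ∀ k, ∀ x ∈ P 0 k, (F k x : X) ∈ K k := by
    intro k x hx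
    obtain ⟨K₀, hK₀⟩ := hKenl k
    rw [hK₀]
    exact Or.inr ⟨x, hx, rfl⟩
  have hFj : ∀ k j, k ≤ j → ∀ x, (F k x : X) ∈ K k → (F j x : X) = F k x := by
    intro k j hkj x hx
    induction j, hkj using Nat.le_induction with
    | base => rfl
    | succ j hkj ih => rw [hF j x (by rw [ih]; exact hKm hkj hx), ih]
  have hex : ∀ x, ∃ k, (F k x : X) ∈ K k := fun x => by
    obtain ⟨k, hk⟩ := (P 0).exists_mem x
    exact ⟨k, hR k x hk⟩
  choose κ hκ using hex
  let G : U 0 → X := fun x => F (κ x) x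
  have hG : ∀ k x, (F k x : X) ∈ K k → G x = F k x := by
    intro k x hx
    rcases le_total k (κ x) with hle | hle
    · exact hFj _ _ hle x hx
    · exact (hFj _ _ hle x (hκ x)).symm
  have hGK : ∀ k x, (F k x : X) ∈ K k → ∀ j, k ≤ j → G x = F j x ∧ (F j x : X) ∈ K j := by
    intro k x hx j hkj
    have := hFj k j hkj x hx
    exact ⟨by rw [hG k x hx, this], by rw [this]; exact hKm hkj hx⟩
  have hinj : Function.Injective G := by
    intro x y hxy
    have hx := (hGK _ x (hκ x) _ (le_max_left (κ x) (κ y))).1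
    have hy := (hGK _ y (hκ y) _ (le_max_right (κ x) (κ y))).1
    rw [hx, hy] at hxy
    exact (F _).injective (Subtype.ext hxy)
  have hmap : ∀ x, map G (𝓝 x) = 𝓝 (G x) := by
    intro x
    obtain ⟨k, hk⟩ := (P 0).exists_mem_nhds x
    have hev : G =ᶠ[𝓝 x] fun x => (F k x : X) := by
      filter_upwards [hk] with y hy using hG k y (hR k y hy)
    rw [map_congr hev, hev.eq_of_nhds]
    exact (((hU k).isOpenEmbedding_subtypeVal).comp (F k).isOpenEmbedding).map_nhds_eq x
  have hcont : Continuous G := continuous_iff_continuousAt.2 fun x => (hmap x).le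
  have hopen : IsOpenMap G := isOpenMap_iff_nhds_le.2 fun x => (hmap x).ge
  have hemb := IsOpenEmbedding.of_continuous_injective_isOpenMap hcont hinj hopen
  have hrange : range G = ⋃ k, U k := by
    apply subset_antisymm
    · rintro _ ⟨x, rfl⟩
      exact mem_iUnion.2 ⟨_, (F (κ x) x).2⟩
    · intro y hy
      obtain ⟨i, hi⟩ := mem_iUnion.1 hy
      obtain ⟨j, hj⟩ := (P i).exists_mem ⟨y, hi⟩
      have hjK : y ∈ K (max i j) :=
        hP i _ (le_max_left _ _) ⟨y, hi⟩ ((P i).subset (le_max_right i j) hj)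
      refine ⟨(F (max i j)).symm ⟨y, hKU _ hjK⟩, ?_⟩
      rw [hG (max i j)] <;> simp [hjK]
  exact ⟨hemb.isEmbedding.toHomeomorph.trans (Homeomorph.setCongr hrange)⟩

theorem isPreconnected_iInter_of_antitone [CompactSpace X] [T2Space X] {G : ℕ → Set X}
    (hG : Antitone G) (hc : ∀ k, IsClosed (G k)) (hp : ∀ k, IsPreconnected (G k)) :
    IsPreconnected (⋂ k, G k) := by
  rw [isPreconnected_closed_iff]
  intro A B hA hB hAB hneA hneB
  by_contra hne
  have hcl : IsClosed (⋂ k, G k) := isClosed_iInter hc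
  have hdisj : Disjoint ((⋂ k, G k) ∩ A) ((⋂ k, G k) ∩ B) := by
    rw [Set.disjoint_left]
    exact fun x hx hx' => hne ⟨x, hx.1, hx.2, hx'.2⟩
  obtain ⟨O, O', hO, hO', hAO, hBO, hOO⟩ := SeparatedNhds.of_isCompact_isCompact
    (hcl.inter hA).isCompact (hcl.inter hB).isCompact hdisj
  obtain ⟨k, hk⟩ := exists_subset_nhds_of_isCompact' (V := G) hG.directed_ge
    (fun k => (hc k).isCompact) hc (U := O ∪ O') (fun x hx => by
      apply (hO.union hO').mem_nhds
      rcases hAB hx with h | h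
      · exact Or.inl (hAO ⟨hx, h⟩)
      · exact Or.inr (hBO ⟨hx, h⟩))
  obtain ⟨x, hx, hxO⟩ := hp k O O' hO hO' hk
    (hneA.mono fun x hx => ⟨mem_iInter.1 hx.1 k, hAO hx⟩)
    (hneB.mono fun x hx => ⟨mem_iInter.1 hx.1 k, hBO hx⟩)
  exact Set.disjoint_left.1 hOO hxO.1 hxO.2

theorem isPreconnected_diff_of_collar {G O H : Set X} (hGc : IsClosed G) (hG : IsPreconnected G)
    (hO : IsOpen O) (hH : IsClosed H) (hHG : H ⊆ G) (hGO : G ∩ O ⊆ H)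
    (hJ : IsPreconnected (H \ O)) (hJne : (H \ O).Nonempty) : IsPreconnected (G \ O) := by
  have hJG : H \ O ⊆ G \ O := sdiff_subset_sdiff_left hHG
  rw [isPreconnected_closed_iff]
  have key : ∀ A B : Set X, IsClosed A → IsClosed B → G \ O ⊆ A ∪ B → ((H \ O) ∩ A).Nonempty →
      ((G \ O) ∩ B).Nonempty → ((G \ O) ∩ (A ∩ B)).Nonempty := by
    intro A B hA hB hAB hJA hneB
    by_contra hne
    have hno : ∀ x ∈ G, x ∉ O → x ∈ A → x ∉ B := fun x h1 h2 h3 h4 => hne ⟨x, ⟨h1, h2⟩, h3, h4⟩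
    have hJA' : H \ O ⊆ A := by
      intro x hx
      by_contra hxA
      have hxB : x ∈ B := (hAB (hJG hx)).resolve_left hxA
      obtain ⟨z, hz, hzA, hzB⟩ := isPreconnected_closed_iff.1 hJ A B hA hB (hJG.trans hAB) hJA
        ⟨x, hx, hxB⟩
      exact hno z (hJG hz).1 (hJG hz).2 hzA hzB
    obtain ⟨x, hx, hxB⟩ := hneB
    obtain ⟨y, hy, hyA⟩ := hJA
    have hGcl : IsClosed (G \ O) := hGc.sdiff hO
    obtain ⟨z, hz, hzA, hzB⟩ := isPreconnected_closed_iff.1 hG (((G \ O) ∩ A) ∪ H)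
      ((G \ O) ∩ B) ((hGcl.inter hA).union hH) (hGcl.inter hB)
      (by
        intro z hz
        by_cases hzO : z ∈ O
        · exact Or.inl (Or.inr (hGO ⟨hz, hzO⟩))
        · rcases hAB ⟨hz, hzO⟩ with h | h
          · exact Or.inl (Or.inl ⟨⟨hz, hzO⟩, h⟩)
          · exact Or.inr ⟨⟨hz, hzO⟩, h⟩)
      ⟨y, (hJG hy).1, Or.inl ⟨hJG hy, hyA⟩⟩ ⟨x, hx.1, hx, hxB⟩
    rcases hzA with h | h
    · exact hno z hz h.1.2 h.2 hzB.2
    · exact hno z hz hzB.1.2 (hJA' ⟨h, hzB.1.2⟩) hzB.2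
  intro A B hA hB hAB hneA hneB
  obtain ⟨y, hy⟩ := hJne
  rcases hAB (hJG hy) with h | h
  · exact key A B hA hB hAB ⟨y, hy, h⟩ hneB
  · rw [inter_comm A B]
    exact key B A hB hA (by rwa [union_comm]) ⟨y, hy, h⟩ hneA

end Topology

section Finger

open Topology Filter

variable {X : Type*} {Y : Type*}

/-- Push the part `τ - δ < t` of a fibre upwards, so that `τ` is moved to `β`. -/
noncomputable def stretch (τ β : ℝ) (δ : Y → ℝ) (w : ℝ × Y) : ℝ × Y :=
  (w.1 + max 0 (w.1 - (τ - δ w.2)) * ((β - τ) / δ w.2), w.2)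

/-- The inverse of `stretch`. -/
noncomputable def shrink (τ β : ℝ) (δ : Y → ℝ) (w : ℝ × Y) : ℝ × Y :=
  (w.1 - max 0 (w.1 - (τ - δ w.2)) * ((β - τ) / (β - τ + δ w.2)), w.2)

theorem stretch_of_le {τ β : ℝ} {δ : Y → ℝ} {w : ℝ × Y} (h : w.1 ≤ τ - δ w.2) :
    stretch τ β δ w = w := by
  simp [stretch, max_eq_left (sub_nonpos.2 h)]

theorem shrink_of_le {τ β : ℝ} {δ : Y → ℝ} {w : ℝ × Y} (h : w.1 ≤ τ - δ w.2) :
    shrink τ β δ w = w := by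
  simp [shrink, max_eq_left (sub_nonpos.2 h)]

theorem stretch_bounds {τ β : ℝ} {δ : Y → ℝ} {w : ℝ × Y} (hβ : τ < β) (hδ : 0 < δ w.2)
    (hw : w.1 < τ) : w.1 ≤ (stretch τ β δ w).1 ∧ (stretch τ β δ w).1 < β := by
  have h1 : 0 < (β - τ) / δ w.2 := div_pos (sub_pos.2 hβ) hδ
  have h2 : (β - τ) / δ w.2 * δ w.2 = β - τ := div_mul_cancel₀ _ hδ.ne'
  simp only [stretch]
  refine ⟨by nlinarith [le_max_left 0 (w.1 - (τ - δ w.2))], ?_⟩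
  rcases max_cases 0 (w.1 - (τ - δ w.2)) with ⟨h, -⟩ | ⟨h, -⟩ <;> rw [h] <;> nlinarith

theorem shrink_bounds {τ β : ℝ} {δ : Y → ℝ} {w : ℝ × Y} (hβ : τ < β) (hδ : 0 < δ w.2)
    (hw : w.1 < β) : min w.1 (τ - δ w.2) ≤ (shrink τ β δ w).1 ∧ (shrink τ β δ w).1 < τ := by
  have h0 : 0 < β - τ + δ w.2 := by linarith
  have h1 : 0 < (β - τ) / (β - τ + δ w.2) := div_pos (sub_pos.2 hβ) h0
  have h3 : (β - τ) / (β - τ + δ w.2) < 1 := (div_lt_one h0).2 (by linarith)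
  have h2 : (β - τ) / (β - τ + δ w.2) * (β - τ + δ w.2) = β - τ := div_mul_cancel₀ _ h0.ne'
  simp only [shrink]
  set c := (β - τ) / (β - τ + δ w.2)
  rcases max_cases 0 (w.1 - (τ - δ w.2)) with ⟨h, h'⟩ | ⟨h, h'⟩ <;> rw [h]
  · exact ⟨by simp, by linarith⟩
  · refine ⟨(min_le_right _ _).trans ?_, ?_⟩
    · nlinarith
    · nlinarith

theorem shrink_stretch {τ β : ℝ} {δ : Y → ℝ} {w : ℝ × Y} (hβ : τ < β) (hδ : 0 < δ w.2) :
    shrink τ β δ (stretch τ β δ w) = w := by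
  rcases le_total w.1 (τ - δ w.2) with h | h
  · rw [stretch_of_le h, shrink_of_le h]
  · have h0 : 0 < β - τ + δ w.2 := by linarith
    have h1 : 0 < (β - τ) / δ w.2 := div_pos (sub_pos.2 hβ) hδ
    have h2 : 0 ≤ (w.1 - (τ - δ w.2)) * ((β - τ) / δ w.2) := mul_nonneg (sub_nonneg.2 h) h1.le
    refine Prod.ext ?_ rfl
    simp only [stretch, shrink, max_eq_right (sub_nonneg.2 h)]
    rw [max_eq_right (by linarith)]
    field_simp
    ring

theorem stretch_shrink {τ β : ℝ} {δ : Y → ℝ} {w : ℝ × Y} (hβ : τ < β) (hδ : 0 < δ w.2) :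
    stretch τ β δ (shrink τ β δ w) = w := by
  rcases le_total w.1 (τ - δ w.2) with h | h
  · rw [shrink_of_le h, stretch_of_le h]
  · have h0 : 0 < β - τ + δ w.2 := by linarith
    have h3 : (β - τ) / (β - τ + δ w.2) ≤ 1 := (div_le_one h0).2 (by linarith)
    have h2 : (w.1 - (τ - δ w.2)) * ((β - τ) / (β - τ + δ w.2)) ≤ (w.1 - (τ - δ w.2)) * 1 :=
      mul_le_mul_of_nonneg_left h3 (sub_nonneg.2 h)
    refine Prod.ext ?_ rfl
    simp only [stretch, shrink, max_eq_right (sub_nonneg.2 h)]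
    rw [max_eq_right (by linarith)]
    field_simp
    ring

open Classical in
/-- Transport a self-map of the parameter space along `ψ` on the image of `b`, extended by the
identity. -/
noncomputable def transport {W : Type*} (ψ : W → X) (b : Set W) (φ : W → W) (p : X) : X :=
  if h : p ∈ ψ '' b then ψ (φ h.choose) else p

theorem transport_apply {W : Type*} {ψ : W → X} (hψ : Function.Injective ψ) {b : Set W}
    {φ : W → W} {w : W} (hw : w ∈ b) : transport ψ b φ (ψ w) = ψ (φ w) := by
  have h : ψ w ∈ ψ '' b := mem_image_of_mem _ hw
  rw [transport, dif_pos h, hψ h.choose_spec.2]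

theorem transport_of_notMem {W : Type*} {ψ : W → X} {b : Set W} {φ : W → W} {p : X}
    (hp : p ∉ ψ '' b) : transport ψ b φ p = p := by
  rw [transport, dif_neg hp]

variable [TopologicalSpace X] [PseudoMetricSpace Y]

theorem continuousOn_stretch {τ β : ℝ} {δ : Y → ℝ} (hδ : Continuous δ) {s : Set (ℝ × Y)}
    (hs : ∀ w ∈ s, 0 < δ w.2) : ContinuousOn (stretch τ β δ) s := by
  unfold stretch
  have : ∀ w ∈ s, δ w.2 ≠ 0 := fun w hw => (hs w hw).ne'
  fun_prop (disch := assumption)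

theorem continuousOn_shrink {τ β : ℝ} {δ : Y → ℝ} (hδ : Continuous δ) (hβ : τ < β)
    {s : Set (ℝ × Y)} (hs : ∀ w ∈ s, 0 < δ w.2) : ContinuousOn (shrink τ β δ) s := by
  unfold shrink
  have : ∀ w ∈ s, β - τ + δ w.2 ≠ 0 := fun w hw => by linarith [hs w hw]
  fun_prop (disch := assumption)

theorem continuousOn_transport {W : Type*} [TopologicalSpace W] {ψ : W → X}
    (hψ : IsOpenEmbedding ψ) {b b' S : Set W} {V : Set X} {φ : W → W} (hb' : IsOpen b')
    (hbb' : b' ⊆ b) (hφ : ContinuousOn φ b') (hid : ∀ w ∈ b, w ∉ S → φ w = w)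
    (hV : V ∩ ψ '' b ⊆ ψ '' b') (hS : ∀ p ∈ V, p ∉ ψ '' b → p ∉ closure (ψ '' S)) :
    ContinuousOn (transport ψ b φ) V := by
  intro p hp
  apply ContinuousAt.continuousWithinAt
  by_cases hpb : p ∈ ψ '' b
  · obtain ⟨w, hw, rfl⟩ := hV ⟨hp, hpb⟩
    rw [← hψ.continuousAt_iff]
    have : transport ψ b φ ∘ ψ =ᶠ[𝓝 w] ψ ∘ φ := by
      filter_upwards [hb'.mem_nhds hw] with v hv using transport_apply hψ.injective (hbb' hv)
    rw [continuousAt_congr this]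
    exact hψ.continuous.continuousAt.comp (hφ.continuousAt (hb'.mem_nhds hw))
  · have : transport ψ b φ =ᶠ[𝓝 p] id := by
      filter_upwards [isClosed_closure.isOpen_compl.mem_nhds (hS p hp hpb)] with x hx
      by_cases hxb : x ∈ ψ '' b
      · obtain ⟨w, hw, rfl⟩ := hxb
        rw [transport_apply hψ.injective hw, hid w hw fun h => hx (subset_closure ⟨w, h, rfl⟩), id]
      · exact transport_of_notMem hxb
    rw [continuousAt_congr this]
    exact continuousAt_id

theorem expands_union_box [T2Space X] {ψ : ℝ × Y → X} (hψ : IsOpenEmbedding ψ) {D : Set Y}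
    (hD : IsOpen D) (hDc : IsCompact (closure D)) {α τ β : ℝ} (hατ : α < τ) (hτβ : τ < β)
    {U : Set X} (hU : IsOpen U) (hUb : ∀ t ∈ Ioo α β, ∀ y ∈ D, ψ (t, y) ∈ U ↔ t < τ) :
    Expands U (U ∪ ψ '' (Ioo α β ×ˢ D)) := by
  intro K hK hKU
  set b : Set (ℝ × Y) := Ioo α β ×ˢ D with hb
  have hbo : IsOpen b := isOpen_Ioo.prod hD
  set F : Set (ℝ × Y) := ψ ⁻¹' K ∪ bᶜ with hFdef
  have hFc : IsClosed F := (hK.isClosed.preimage hψ.continuous).union hbo.isClosed_compl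
  set δ : Y → ℝ := fun y => infDist (τ, y) F / 2 with hδdef
  have hδcont : Continuous δ :=
    ((continuous_infDist_pt F).comp (by fun_prop : Continuous fun y : Y => (τ, y))).div_const 2
  have hδ0 : ∀ y, 0 ≤ δ y := fun y => div_nonneg infDist_nonneg two_pos.le
  have hFle : ∀ t y, (t, y) ∈ F → 2 * δ y ≤ |τ - t| := by
    intro t y h
    have := infDist_le_dist_of_mem (x := ((τ, y) : ℝ × Y)) h
    rw [Prod.dist_eq, dist_self, max_eq_left dist_nonneg, Real.dist_eq] at this
    simp only [hδdef]
    linarith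
  have hδα : ∀ y, 2 * δ y ≤ τ - α := by
    intro y
    have := hFle α y (Or.inr fun h => lt_irrefl _ h.1.1)
    rwa [abs_of_pos (sub_pos.2 hατ)] at this
  have hδpos : ∀ y ∈ D, 0 < δ y := by
    intro y hy
    have hne : F.Nonempty := ⟨(α, y), Or.inr fun h => lt_irrefl _ h.1.1⟩
    refine div_pos ((hFc.notMem_iff_infDist_pos hne).1 ?_) two_pos
    rintro (h | h)
    · exact lt_irrefl τ ((hUb τ ⟨hατ, hτβ⟩ y hy).1 (hKU h))
    · exact h ⟨⟨hατ, hτβ⟩, hy⟩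
  have hδD : ∀ y, y ∉ D → δ y ≤ 0 := by
    intro y hy
    have := hFle τ y (Or.inr fun h => hy h.2)
    simp only [sub_self, abs_zero] at this
    linarith
  clear_value δ
  have hδK : ∀ t y, (t, y) ∈ b → ψ (t, y) ∈ K → t ≤ τ - δ y := by
    intro t y hty h
    have h1 := hFle t y (Or.inl h)
    have h2 := (hUb t hty.1 y hty.2).1 (hKU h)
    rw [abs_of_pos (sub_pos.2 h2)] at h1
    linarith [hδ0 y]
  set S : Set (ℝ × Y) := {w ∈ b | τ - δ w.2 < w.1} with hS
  have hSid : ∀ w ∈ b, w ∉ S → w.1 ≤ τ - δ w.2 := fun w hw h => not_lt.1 fun h' => h ⟨hw, h'⟩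
  have hkey : ∀ p ∈ U, p ∉ ψ '' b → p ∉ closure (ψ '' S) := by
    intro p hpU hpb hpS
    have hcomp : IsCompact (closure b) := by
      rw [hb, closure_prod_eq, closure_Ioo (hατ.trans hτβ).ne]
      exact isCompact_Icc.prod hDc
    have hScomp : IsCompact (closure S) :=
      hcomp.of_isClosed_subset isClosed_closure (closure_mono (sep_subset _ _))
    have : closure (ψ '' S) ⊆ ψ '' closure S :=
      closure_minimal (image_mono subset_closure) (hScomp.image hψ.continuous).isClosed
    obtain ⟨⟨t, y⟩, hw, rfl⟩ := this hpS
    have hwb : (t, y) ∈ Icc α β ×ˢ closure D := by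
      have := closure_mono (sep_subset _ _) hw
      rwa [hb, closure_prod_eq, closure_Ioo (hατ.trans hτβ).ne] at this
    have hnb : (t, y) ∉ b := fun h => hpb ⟨_, h, rfl⟩
    have htδ : τ - δ y ≤ t := by
      have hcl : IsClosed {w : ℝ × Y | τ - δ w.2 ≤ w.1} :=
        isClosed_le (by fun_prop) (by fun_prop)
      have hsub : S ⊆ {w : ℝ × Y | τ - δ w.2 ≤ w.1} := fun w hw => hw.2.le
      have := closure_minimal hsub hcl hw
      exact this
    have hτt : τ ≤ t := by
      by_cases hy : y ∈ D
      · by_contra! hlt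
        exact hnb ⟨⟨by linarith [hδα y, hδ0 y], hlt.trans hτβ⟩, hy⟩
      · linarith [hδD y hy]
    have hyU : ψ ⁻¹' U ∈ 𝓝 (t, y) := (hU.preimage hψ.continuous).mem_nhds hpU
    rw [nhds_prod_eq, mem_prod_iff] at hyU
    obtain ⟨T, hT, N, hN, hTN⟩ := hyU
    obtain ⟨y', hy'N, hy'D⟩ := mem_closure_iff_nhds.1 hwb.2 N hN
    have htcl : t ∈ closure (Ico τ β) := by
      rw [closure_Ico hτβ.ne]
      exact ⟨hτt, hwb.1.2⟩
    obtain ⟨t', ht'T, ht'⟩ := mem_closure_iff_nhds.1 htcl T hT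
    exact absurd ((hUb t' ⟨hατ.trans_le ht'.1, ht'.2⟩ y' hy'D).1 (hTN ⟨ht'T, hy'N⟩))
      (not_lt.2 ht'.1)
  set b' : Set (ℝ × Y) := Ioo α τ ×ˢ D with hb'
  have hb'b : b' ⊆ b := prod_mono (Ioo_subset_Ioo le_rfl hτβ.le) le_rfl
  have hUb' : U ∩ ψ '' b ⊆ ψ '' b' := by
    rintro _ ⟨h, ⟨t, y⟩, hw, rfl⟩
    exact ⟨_, ⟨⟨hw.1.1, (hUb t hw.1 y hw.2).1 h⟩, hw.2⟩, rfl⟩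
  have hmaps_f : MapsTo (stretch τ β δ) b' b := by
    rintro ⟨t, y⟩ ⟨ht, hy⟩
    have := stretch_bounds (w := (t, y)) hτβ (hδpos y hy) ht.2
    exact ⟨⟨ht.1.trans_le this.1, this.2⟩, hy⟩
  have hmaps_g : MapsTo (shrink τ β δ) b b' := by
    rintro ⟨t, y⟩ ⟨ht, hy⟩
    have := shrink_bounds (w := (t, y)) hτβ (hδpos y hy) ht.2
    refine ⟨⟨lt_of_lt_of_le (lt_min ht.1 ?_) this.1, this.2⟩, hy⟩
    linarith [hδα y, hδpos y hy]
  set f := transport ψ b (stretch τ β δ)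
  set g := transport ψ b (shrink τ β δ)
  have hb'U : ψ '' b' ⊆ U := by
    rintro _ ⟨⟨t, y⟩, ⟨ht, hy⟩, rfl⟩
    exact (hUb t ⟨ht.1, ht.2.trans hτβ⟩ y hy).2 ht.2
  have hfc : ContinuousOn f U := continuousOn_transport hψ (isOpen_Ioo.prod hD) hb'b
    (continuousOn_stretch hδcont fun w hw => hδpos _ hw.2)
    (fun w hw h => stretch_of_le (hSid w hw h)) hUb' hkey
  have hgc : ContinuousOn g (U ∪ ψ '' b) := continuousOn_transport hψ hbo subset_rfl
    (continuousOn_shrink hδcont hτβ fun w hw => hδpos _ hw.2)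
    (fun w hw h => shrink_of_le (hSid w hw h)) inter_subset_right
    (fun p hp hpb => hkey p (hp.resolve_right hpb) hpb)
  have hf : MapsTo f U (U ∪ ψ '' b) := by
    intro p hp
    by_cases hpb : p ∈ ψ '' b
    · obtain ⟨w, hw, rfl⟩ := hUb' ⟨hp, hpb⟩
      simp only [f]
      rw [transport_apply hψ.injective (hb'b hw)]
      exact Or.inr (mem_image_of_mem _ (hmaps_f hw))
    · simp only [f]
      rw [transport_of_notMem hpb]
      exact Or.inl hp
  have hg : MapsTo g (U ∪ ψ '' b) U := by
    intro p hp
    by_cases hpb : p ∈ ψ '' b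
    · obtain ⟨w, hw, rfl⟩ := hpb
      simp only [g]
      rw [transport_apply hψ.injective hw]
      exact hb'U (mem_image_of_mem _ (hmaps_g hw))
    · simp only [g]
      rw [transport_of_notMem hpb]
      exact hp.resolve_right hpb
  have hgf : ∀ p ∈ U, g (f p) = p := by
    intro p hp
    by_cases hpb : p ∈ ψ '' b
    · obtain ⟨w, hw, rfl⟩ := hUb' ⟨hp, hpb⟩
      simp only [f, g]
      rw [transport_apply hψ.injective (hb'b hw), transport_apply hψ.injective (hmaps_f hw),
        shrink_stretch hτβ (hδpos _ hw.2)]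
    · simp only [f, g]
      rw [transport_of_notMem hpb, transport_of_notMem hpb]
  have hfg : ∀ p ∈ U ∪ ψ '' b, f (g p) = p := by
    intro p hp
    by_cases hpb : p ∈ ψ '' b
    · obtain ⟨w, hw, rfl⟩ := hpb
      simp only [f, g]
      rw [transport_apply hψ.injective hw, transport_apply hψ.injective (hb'b (hmaps_g hw)),
        stretch_shrink hτβ (hδpos _ hw.2)]
    · simp only [f, g]
      rw [transport_of_notMem hpb, transport_of_notMem hpb]
  refine ⟨⟨⟨fun p => ⟨f p, hf p.2⟩, fun p => ⟨g p, hg p.2⟩, fun p => Subtype.ext (hgf p p.2),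
    fun p => Subtype.ext (hfg p p.2)⟩, ?_, ?_⟩, ?_⟩
  · exact (hfc.domRestrict).subtype_mk _
  · exact (hgc.domRestrict).subtype_mk _
  · rintro ⟨p, hp⟩ hpK
    by_cases hpb : p ∈ ψ '' b
    · obtain ⟨⟨t, y⟩, hw, rfl⟩ := hpb
      change transport ψ b (stretch τ β δ) (ψ (t, y)) = _
      rw [transport_apply hψ.injective hw, stretch_of_le (hδK t y hw hpK)]
    · exact transport_of_notMem hpb

theorem isPreconnected_diff_box [T2Space X] {ψ : ℝ × Y → X} (hψ : IsOpenEmbedding ψ) {D : Set Y}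
    (hD : IsOpen D) (hDc : IsCompact (closure D)) (hDp : IsPreconnected D) (hDne : D.Nonempty)
    {α τ β : ℝ} (hατ : α < τ) (hτβ : τ < β) {G : Set X} (hGc : IsClosed G)
    (hG : IsPreconnected G) (hGb : ∀ t ∈ Ioo α β, ∀ y ∈ D, ψ (t, y) ∈ G ↔ τ ≤ t) :
    IsPreconnected (G \ ψ '' (Ioo α β ×ˢ D)) := by
  have hαβ := hατ.trans hτβ
  have hbo : IsOpen (ψ '' (Ioo α β ×ˢ D)) := hψ.isOpenMap _ (isOpen_Ioo.prod hD)
  set H : Set (ℝ × Y) := Icc τ β ×ˢ closure D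
  have hHG : ψ '' H ⊆ G := by
    have h1 : H = closure (Ico τ β ×ˢ D) := by rw [closure_prod_eq, closure_Ico hτβ.ne]
    rw [h1]
    refine (image_closure_subset_closure_image hψ.continuous).trans (closure_minimal ?_ hGc)
    rintro _ ⟨⟨t, y⟩, ⟨ht, hy⟩, rfl⟩
    exact (hGb t ⟨hατ.trans_le ht.1, ht.2⟩ y hy).2 ht.1
  obtain ⟨y₀, hy₀⟩ := hDne
  have hdiff : ψ '' H \ ψ '' (Ioo α β ×ˢ D) = ψ '' (H \ (Ioo α β ×ˢ D)) :=
    (image_sdiff hψ.injective _ _).symm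
  apply isPreconnected_diff_of_collar (H := ψ '' H) hGc hG hbo
    ((isCompact_Icc.prod hDc).image hψ.continuous).isClosed hHG
  · rintro _ ⟨hx, ⟨t, y⟩, hty, rfl⟩
    exact ⟨_, ⟨⟨(hGb t hty.1 y hty.2).1 hx, hty.1.2.le⟩, subset_closure hty.2⟩, rfl⟩
  · rw [hdiff]
    refine IsPreconnected.image ?_ _ hψ.continuous.continuousOn
    apply isPreconnected_of_forall (β, y₀)
    rintro ⟨t, y⟩ ⟨hty, hnb⟩
    refine ⟨Icc t β ×ˢ {y} ∪ {β} ×ˢ closure D, ?_, Or.inr ⟨rfl, subset_closure hy₀⟩,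
      Or.inl ⟨⟨le_rfl, hty.1.2⟩, rfl⟩, ?_⟩
    · rintro ⟨t', y'⟩ (⟨ht', rfl⟩ | ⟨rfl, hy'⟩)
      · refine ⟨⟨⟨hty.1.1.trans ht'.1, ht'.2⟩, hty.2⟩, fun h => ?_⟩
        exact hnb ⟨⟨hατ.trans_le hty.1.1, ht'.1.trans_lt h.1.2⟩, h.2⟩
      · exact ⟨⟨⟨hτβ.le, le_rfl⟩, hy'⟩, fun h => lt_irrefl _ h.1.2⟩
    · exact IsPreconnected.union (β, y) ⟨⟨hty.1.2, le_rfl⟩, rfl⟩ ⟨rfl, hty.2⟩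
        (isPreconnected_Icc.prod isPreconnected_singleton)
        (isPreconnected_singleton.prod hDp.closure)
  · rw [hdiff]
    exact ⟨_, (β, y₀), ⟨⟨⟨hτβ.le, le_rfl⟩, subset_closure hy₀⟩, fun h => lt_irrefl _ h.1.2⟩, rfl⟩

end Finger

section Grid

variable {n m : ℕ}

/-- Subdivision factor of the grids. -/
def base (m : ℕ) : ℤ := 2 * m + 1

/-- Position of the vertex cell of a colour inside a cell of the coarser grid. -/
def res (i : Fin m) : ℤ := 2 * (i : ℕ) + 1

theorem base_pos : 0 < base m := by unfold base; positivity

theorem res_pos (i : Fin m) : 0 < res i := by unfold res; positivity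

theorem res_lt (i : Fin m) : res i < base m := by
  have := i.2
  unfold res base
  omega

theorem odd_res (i : Fin m) : Odd (res i) := ⟨_, rfl⟩

theorem res_injective : Function.Injective (res : Fin m → ℤ) := by
  intro i j h
  unfold res at h
  exact Fin.ext (by omega)

/-- The cell of the coarser grid containing a given cell. -/
def up (m : ℕ) (z : Fin n → ℤ) : Fin n → ℤ := fun q => z q / base m

/-- The vertex cell of colour `i` inside `Z`. -/
def vtx (i : Fin m) (Z : Fin n → ℤ) : Fin n → ℤ := fun q => base m * Z q + res i

theorem up_apply_eq {z : Fin n → ℤ} {q : Fin n} {c : ℤ} (h₁ : base m * c ≤ z q)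
    (h₂ : z q < base m * c + base m) : up m z q = c := by
  have hb := base_pos (m := m)
  apply le_antisymm
  · apply Int.le_of_lt_add_one
    rw [up, Int.ediv_lt_iff_lt_mul hb]
    linarith [mul_comm (base m) c]
  · rw [up, Int.le_ediv_iff_mul_le hb]
    linarith [mul_comm (base m) c]

theorem up_le (z : Fin n → ℤ) (q : Fin n) : base m * up m z q ≤ z q :=
  Int.mul_ediv_self_le base_pos.ne'

theorem lt_up (z : Fin n → ℤ) (q : Fin n) : z q < base m * up m z q + base m :=
  Int.lt_mul_ediv_self_add base_pos

theorem up_vtx (i : Fin m) (Z : Fin n → ℤ) : up m (vtx i Z) = Z := by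
  ext q
  apply up_apply_eq <;> simp only [vtx] <;> linarith [res_pos i, res_lt i]

theorem exists_ne_ne (hn : 3 ≤ n) (r r' : Fin n) : ∃ q, q ≠ r ∧ q ≠ r' := by
  by_contra! h
  have : Fintype.card (Fin n) ≤ ({r, r'} : Finset (Fin n)).card := by
    apply Finset.card_le_card
    intro q _
    by_cases hq : q = r
    · simp [hq]
    · simp [h q hq]
  rw [Fintype.card_fin] at this
  have h2 := Finset.card_le_two (a := r) (b := r')
  omega

/-- Number of steps from `Z` to the vertex cell of colour `i` in the same coarser cell. -/
def dep (i : Fin m) (Z : Fin n → ℤ) : ℕ :=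
  ∑ q, (Z q - base m * up m Z q - res i).natAbs

theorem dep_le (i : Fin m) (Z : Fin n → ℤ) : dep i Z ≤ n * (2 * m + 1) := by
  unfold dep
  refine (Finset.sum_le_card_nsmul _ _ (2 * m + 1) fun q _ => ?_).trans (by simp)
  have h1 := up_le (m := m) Z q
  have h2 := lt_up (m := m) Z q
  have h3 := res_pos i
  have h4 := res_lt i
  have h5 : base m = 2 * m + 1 := rfl
  omega

open Classical in
/-- The coordinate direction in which the cell `Z` is joined to the next cell of colour `i`. -/
noncomputable def dirn [NeZero n] (i : Fin m) (Z : Fin n → ℤ) : Fin n :=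
  if h : ∃ r, Odd (Z r - base m * up m Z r) ∧ Z r - base m * up m Z r ≠ res i then h.choose
  else if h : ∃ r, Z r - base m * up m Z r ≠ res i then h.choose else 0

/-- The orientation in which the cell `Z` of level `k` is joined to the next cell of
colour `i`. -/
noncomputable def sgn [NeZero n] (k : ℕ) (i : Fin m) (Z : Fin n → ℤ) : ℤ :=
  if k = 0 then (if (i : ℕ) = 0 then 1 else 0)
  else Int.sign (res i - (Z (dirn i Z) - base m * up m Z (dirn i Z)))

/-- The cell to which `Z` is joined in colour `i`. -/
noncomputable def par [NeZero n] (k : ℕ) (i : Fin m) (Z : Fin n → ℤ) : Fin n → ℤ :=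
  Function.update Z (dirn i Z) (Z (dirn i Z) + sgn k i Z)

/-- The cells of level `k + 1` between the vertex cells of `Z` and of `par k i Z`. -/
noncomputable def chain [NeZero n] (k : ℕ) (i : Fin m) (Z : Fin n → ℤ) : Set (Fin n → ℤ) :=
  uIcc (vtx i Z) (vtx i (par k i Z))

/-- The cells of level `k` that have not been coloured. -/
def gap [NeZero n] (m : ℕ) : ℕ → Set (Fin n → ℤ)
  | 0 => {0}
  | k + 1 => {z | up m z ∈ gap m k ∧ ∀ i : Fin m, ∀ Z ∈ gap m k, z ∉ chain k i Z}

/-- The cells of level `k` of colour `i`. -/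
def col [NeZero n] (i : Fin m) : ℕ → Set (Fin n → ℤ)
  | 0 => {z | (i : ℕ) = 0 ∧ z ≠ 0}
  | k + 1 => {z | up m z ∈ col i k ∨ ∃ Z ∈ gap m k, z ∈ chain k i Z}

variable [NeZero n] {k : ℕ} {i j : Fin m} {Z Z' z : Fin n → ℤ}

theorem sgn_cases (k : ℕ) (i : Fin m) (Z : Fin n → ℤ) :
    sgn k i Z = 0 ∨ sgn k i Z = 1 ∨ sgn k i Z = -1 := by
  unfold sgn
  split_ifs
  · simp
  · simp
  · rcases Int.sign_trichotomy (res i - (Z (dirn i Z) - base m * up m Z (dirn i Z)))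
      with h | h | h <;> simp [h]

theorem par_dirn (k : ℕ) (i : Fin m) (Z : Fin n → ℤ) :
    par k i Z (dirn i Z) = Z (dirn i Z) + sgn k i Z := by simp [par]

theorem par_of_ne {q : Fin n} (h : q ≠ dirn i Z) : par k i Z q = Z q := by simp [par, h]

theorem mem_chain : z ∈ chain k i Z ↔ (∀ q, q ≠ dirn i Z → z q = base m * Z q + res i) ∧
    (sgn k i Z = 0 ∧ z (dirn i Z) = base m * Z (dirn i Z) + res i ∨
      sgn k i Z = 1 ∧ base m * Z (dirn i Z) + res i ≤ z (dirn i Z) ∧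
        z (dirn i Z) ≤ base m * Z (dirn i Z) + res i + base m ∨
      sgn k i Z = -1 ∧ base m * Z (dirn i Z) + res i - base m ≤ z (dirn i Z) ∧
        z (dirn i Z) ≤ base m * Z (dirn i Z) + res i) := by
  have hb := base_pos (m := m)
  have h1 : z ∈ chain k i Z ↔ ∀ q, z q ∈ uIcc (vtx i Z q) (vtx i (par k i Z) q) := by
    simp only [chain, uIcc, mem_Icc, Pi.le_def, Pi.inf_apply, Pi.sup_apply, forall_and]
  have h2 : (∀ q, z q ∈ uIcc (vtx i Z q) (vtx i (par k i Z) q)) ↔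
      (∀ q, q ≠ dirn i Z → z q = base m * Z q + res i) ∧
      z (dirn i Z) ∈ uIcc (vtx i Z (dirn i Z)) (vtx i (par k i Z) (dirn i Z)) := by
    constructor
    · intro h
      refine ⟨fun q hq => ?_, h _⟩
      have := h q
      rwa [vtx, vtx, par_of_ne hq, uIcc_self, mem_singleton_iff] at this
    · rintro ⟨h, h'⟩ q
      by_cases hq : q = dirn i Z
      · rw [hq]; exact h'
      · rw [vtx, vtx, par_of_ne hq, uIcc_self, mem_singleton_iff]
        exact h q hq
  rw [h1, h2]
  refine and_congr_right fun _ => ?_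
  rw [vtx, vtx, par_dirn, mem_uIcc]
  rcases sgn_cases k i Z with h | h | h <;> rw [h] <;> rw [mul_add] <;> omega

theorem up_of_mem_chain (h : z ∈ chain k i Z) : up m z = Z ∨ up m z = par k i Z := by
  obtain ⟨h1, h2⟩ := mem_chain.1 h
  have hq : ∀ q, q ≠ dirn i Z → up m z q = Z q := fun q hq => by
    apply up_apply_eq <;> rw [h1 q hq] <;> linarith [res_pos i, res_lt i]
  have ha := res_pos i
  have hb := res_lt i
  by_cases hZ : up m z (dirn i Z) = Z (dirn i Z)
  · left
    ext q
    by_cases h : q = dirn i Z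
    · rw [h, hZ]
    · exact hq q h
  · right
    ext q
    by_cases h : q = dirn i Z
    · rw [h, par_dirn]
      have h3 : ¬ (base m * Z (dirn i Z) ≤ z (dirn i Z) ∧
          z (dirn i Z) < base m * Z (dirn i Z) + base m) := fun h => hZ (up_apply_eq h.1 h.2)
      apply up_apply_eq <;> rw [mul_add] <;>
      rcases h2 with h2 | h2 | h2 <;> rw [h2.1] <;> omega
    · rw [hq q h, par_of_ne h]

theorem vtx_mem_chain (k : ℕ) (i : Fin m) (Z : Fin n → ℤ) : vtx i Z ∈ chain k i Z :=
  left_mem_uIcc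

theorem vtx_par_mem_chain (k : ℕ) (i : Fin m) (Z : Fin n → ℤ) :
    vtx i (par k i Z) ∈ chain k i Z :=
  right_mem_uIcc

theorem exists_of_mem_gap_succ (hZ : Z ∈ gap m (k + 1)) (i : Fin m) :
    ∃ r, Z r - base m * up m Z r ≠ res i := by
  by_contra! h
  apply hZ.2 i _ hZ.1
  convert vtx_mem_chain k i (up m Z)
  ext q
  rw [vtx]
  linarith [h q]

theorem dirn_spec (hZ : Z ∈ gap m (k + 1)) (i : Fin m) :
    Z (dirn i Z) - base m * up m Z (dirn i Z) ≠ res i ∧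
      (Odd (Z (dirn i Z) - base m * up m Z (dirn i Z)) ∨
        ∀ q, Odd (Z q - base m * up m Z q) → Z q - base m * up m Z q = res i) := by
  unfold dirn
  split_ifs with h h'
  · exact ⟨h.choose_spec.2, Or.inl h.choose_spec.1⟩
  · refine ⟨h'.choose_spec, Or.inr fun q hq => ?_⟩
    by_contra hne
    exact h ⟨q, hq, hne⟩
  · exact absurd (exists_of_mem_gap_succ hZ i) h'

theorem sgn_of_mem_gap_succ (hZ : Z ∈ gap m (k + 1)) (i : Fin m) :
    (sgn (k + 1) i Z = 1 ∧ Z (dirn i Z) - base m * up m Z (dirn i Z) < res i) ∨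
    (sgn (k + 1) i Z = -1 ∧ res i < Z (dirn i Z) - base m * up m Z (dirn i Z)) := by
  have h := (dirn_spec hZ i).1
  simp only [sgn, Nat.add_eq_zero_iff, one_ne_zero, and_false, if_false]
  rcases lt_or_gt_of_ne h with h | h
  · exact Or.inl ⟨Int.sign_eq_one_of_pos (by linarith), h⟩
  · exact Or.inr ⟨Int.sign_eq_neg_one_of_neg (by linarith), h⟩

theorem up_par (hZ : Z ∈ gap m (k + 1)) (i : Fin m) : up m (par (k + 1) i Z) = up m Z := by
  ext q
  have h1 := up_le (m := m) Z q
  have h2 := lt_up (m := m) Z q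
  have ha := res_pos i
  have hb := res_lt i
  by_cases h : q = dirn i Z
  · subst h
    rcases sgn_of_mem_gap_succ hZ i with ⟨hs, h⟩ | ⟨hs, h⟩ <;>
    apply up_apply_eq <;> rw [par_dirn, hs] <;> omega
  · apply up_apply_eq <;> rw [par_of_ne h] <;> omega

theorem not_mem_chain_of_ne (hn : 3 ≤ n) (hij : i ≠ j) (hi : z ∈ chain k i Z) :
    z ∉ chain k j Z' := by
  intro hj
  obtain ⟨q, hq, hq'⟩ := exists_ne_ne hn (dirn i Z) (dirn j Z')
  have h1 := (mem_chain.1 hi).1 q hq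
  have h2 := (mem_chain.1 hj).1 q hq'
  have e1 : up m z q = Z q := up_apply_eq (by linarith [res_pos i]) (by linarith [res_lt i])
  have e2 : up m z q = Z' q := up_apply_eq (by linarith [res_pos j]) (by linarith [res_lt j])
  rw [← e1] at h1
  rw [← e2] at h2
  exact hij (res_injective (by linarith))

theorem par_mem_gap_or_col (hn : 3 ≤ n) (hZ : Z ∈ gap m k) (i : Fin m) :
    par k i Z ∈ gap m k ∨ par k i Z ∈ col i k := by
  rcases k with _ | k
  · by_cases hi : (i : ℕ) = 0
    · right
      refine ⟨hi, fun h => ?_⟩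
      have h1 := congr_fun h (dirn i Z)
      rw [par_dirn, show Z = 0 from hZ] at h1
      simp [sgn, hi] at h1
    · left
      rw [par, show sgn 0 i Z = 0 by simp [sgn, hi], add_zero, Function.update_eq_self]
      exact hZ
  by_contra! hcon
  obtain ⟨hgap, hcol⟩ := hcon
  have hup := up_par hZ i
  have : ∃ j : Fin m, ∃ Y ∈ gap m k, par (k + 1) i Z ∈ chain k j Y := by
    by_contra! h
    exact hgap ⟨hup ▸ hZ.1, h⟩
  obtain ⟨j, Y, hY, hmem⟩ := this
  have hij : j ≠ i := by
    rintro rfl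
    exact hcol (Or.inr ⟨Y, hY, hmem⟩)
  obtain ⟨h1, h2⟩ := mem_chain.1 hmem
  have hsj := res_pos j
  have hsj' := res_lt j
  rcases (dirn_spec hZ i).2 with hodd | heven
  · obtain ⟨r, hr⟩ : ∃ r, r = dirn i Z := ⟨_, rfl⟩
    rw [← hr] at hodd
    have hP := par_dirn (k + 1) i Z
    rw [← hr] at hP
    have hpar : Odd (base m) := ⟨m, rfl⟩
    have hPeven : ∀ c, par (k + 1) i Z r ≠ base m * c + res j := by
      intro c hc
      have hup' : up m (par (k + 1) i Z) r = c := up_apply_eq (by linarith) (by linarith)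
      rw [hup] at hup'
      rw [hP, ← hup'] at hc
      have h3 : Odd (res j - sgn (k + 1) i Z) := by
        convert hodd using 1
        linarith
      rcases sgn_of_mem_gap_succ hZ i with ⟨hs, -⟩ | ⟨hs, -⟩ <;> rw [hs] at h3 <;>
      · have := odd_res j
        grind
    have hrr : r = dirn j Y := by
      by_contra hne
      exact hPeven _ (h1 r hne)
    refine hZ.2 j Y hY (mem_chain.2 ⟨fun q hq => ?_, ?_⟩)
    · rw [← h1 q hq, par_of_ne (by rwa [← hr, hrr])]
    · rw [← hrr] at h2 ⊢
      have e0 := hPeven (Y r)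
      have e1 := hPeven (Y r + 1)
      have e2 := hPeven (Y r - 1)
      rw [mul_add] at e1
      rw [mul_sub] at e2
      rcases sgn_cases (k + 1) i Z with h | h | h <;> rw [h] at hP <;> omega
  · obtain ⟨q, hq, hq'⟩ := exists_ne_ne hn (dirn i Z) (dirn j Y)
    have h3 := h1 q hq'
    have e1 : up m (par (k + 1) i Z) q = Y q := up_apply_eq (by linarith) (by linarith)
    rw [hup] at e1
    rw [par_of_ne hq, ← e1] at h3
    have h4 : Z q - base m * up m Z q = res j := by linarith
    have := heven q (h4 ▸ odd_res j)
    exact hij (res_injective (h4.symm.trans this))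

theorem not_mem_col_of_mem_gap (hz : z ∈ gap m k) (i : Fin m) : z ∉ col i k := by
  induction k generalizing z with
  | zero => exact fun h => h.2 hz
  | succ k ih =>
    rintro (h | ⟨Z, hZ, h⟩)
    · exact ih hz.1 h
    · exact hz.2 i Z hZ h

theorem not_mem_col_of_mem_col (hn : 3 ≤ n) (hij : i ≠ j) (hz : z ∈ col i k) : z ∉ col j k := by
  induction k generalizing z i j with
  | zero => exact fun h => hij (Fin.ext (hz.1.trans h.1.symm))
  | succ k ih =>
    have key : ∀ i j : Fin m, i ≠ j → ∀ Z ∈ gap m k, z ∈ chain k j Z → up m z ∉ col i k := by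
      intro i j hij Z hZ hzZ h
      rcases up_of_mem_chain hzZ with h' | h' <;> rw [h'] at h
      · exact not_mem_col_of_mem_gap hZ i h
      · rcases par_mem_gap_or_col hn hZ j with h'' | h''
        · exact not_mem_col_of_mem_gap h'' i h
        · exact ih hij h h''
    rintro (h' | ⟨Z', hZ', h'⟩) <;> rcases hz with hz | ⟨Z, hZ, hz⟩
    · exact ih hij hz h'
    · exact key j i hij.symm Z hZ hz h'
    · exact key i j hij Z' hZ' h' hz
    · exact not_mem_chain_of_ne hn hij hz h'

theorem gap_bounds (hZ : Z ∈ gap m k) (q : Fin n) : 0 ≤ Z q ∧ Z q < base m ^ k := by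
  induction k generalizing Z with
  | zero => simp [show Z = 0 from hZ]
  | succ k ih =>
    obtain ⟨h1, h2⟩ := ih hZ.1
    have hb := base_pos (m := m)
    have h3 := up_le (m := m) Z q
    have h4 := lt_up (m := m) Z q
    refine ⟨by nlinarith, ?_⟩
    rw [pow_succ']
    nlinarith

theorem finite_gap (m k : ℕ) : (gap m k : Set (Fin n → ℤ)).Finite :=
  (Set.finite_Icc (0 : Fin n → ℤ) (fun _ => base m ^ k)).subset fun _ hZ =>
    ⟨fun q => (gap_bounds hZ q).1, fun q => (gap_bounds hZ q).2.le⟩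

theorem dep_par (hZ : Z ∈ gap m (k + 1)) (i : Fin m) :
    dep i (par (k + 1) i Z) + 1 = dep i Z := by
  unfold dep
  rw [up_par hZ i, ← Finset.sum_erase_add _ _ (Finset.mem_univ (dirn i Z)),
    ← Finset.sum_erase_add (a := dirn i Z) _ _ (Finset.mem_univ (dirn i Z)), add_assoc]
  congr 1
  · exact Finset.sum_congr rfl fun q hq => by rw [par_of_ne (Finset.ne_of_mem_erase hq)]
  · rw [par_dirn]
    rcases sgn_of_mem_gap_succ hZ i with ⟨hs, h⟩ | ⟨hs, h⟩ <;> rw [hs] <;> omega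

theorem dep_par_lt (hki : k ≠ 0 ∨ (i : ℕ) = 0) (hZ : Z ∈ gap m k) (hP : par k i Z ∈ gap m k) :
    dep i (par k i Z) < dep i Z := by
  rcases k with _ | k
  · have h1 := congr_fun (show par 0 i Z = 0 from hP) (dirn i Z)
    rw [par_dirn, show Z = 0 from hZ] at h1
    simp [sgn, hki.resolve_left (by simp)] at h1
  · have := dep_par hZ i
    omega

theorem sgn_ne_zero (hki : k ≠ 0 ∨ (i : ℕ) = 0) (hZ : Z ∈ gap m k) :
    sgn k i Z = 1 ∨ sgn k i Z = -1 := by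
  rcases k with _ | k
  · simp [sgn, hki.resolve_left (by simp)]
  · rcases sgn_of_mem_gap_succ hZ i with h | h <;> simp [h.1]

end Grid

section GridMoves

variable {n m : ℕ} [NeZero n] {k : ℕ} {i j : Fin m} {Z Z' z : Fin n → ℤ}

open Classical in
/-- The coordinate at which the box joining `Z` to `par k i Z` enters a larger domain. -/
noncomputable def thr (k : ℕ) (i : Fin m) (Z : Fin n → ℤ) : ℤ :=
  base m * par k i Z (dirn i Z) +
    if sgn k i Z = 1 then (if par k i Z ∈ gap m k then res i else 0)
    else (if par k i Z ∈ gap m k then res i + 1 else base m)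

theorem up_eq_of_near (hs : sgn k i Z = 1 ∨ sgn k i Z = -1)
    (hz : z ∈ chain k i Z)
    (hnear : sgn k i Z = 1 ∧ z (dirn i Z) < thr k i Z ∨
      sgn k i Z = -1 ∧ thr k i Z ≤ z (dirn i Z)) :
    up m z = Z ∨ up m z = par k i Z ∧ par k i Z ∈ gap m k := by
  rcases up_of_mem_chain hz with h | h
  · exact Or.inl h
  · right
    refine ⟨h, ?_⟩
    by_contra hP
    have h1 := up_le (m := m) z (dirn i Z)
    have h2 := lt_up (m := m) z (dirn i Z)
    rw [h] at h1 h2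
    simp only [thr, hP, if_false] at hnear
    rcases hs with hs | hs <;> simp only [hs] at hnear <;> norm_num at hnear <;> omega

theorem up_not_mem_col_of_near (hki : k ≠ 0 ∨ (i : ℕ) = 0) (hZ : Z ∈ gap m k)
    (hz : z ∈ chain k i Z)
    (hnear : sgn k i Z = 1 ∧ z (dirn i Z) < thr k i Z ∨
      sgn k i Z = -1 ∧ thr k i Z ≤ z (dirn i Z)) : up m z ∉ col i k := by
  rcases up_eq_of_near (sgn_ne_zero hki hZ) hz hnear with h | ⟨h, hP⟩
  · rw [h]
    exact not_mem_col_of_mem_gap hZ i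
  · rw [h]
    exact not_mem_col_of_mem_gap hP i

theorem not_mem_chain_of_near (hki : k ≠ 0 ∨ (i : ℕ) = 0) (hZ : Z ∈ gap m k)
    {T : Set (Fin n → ℤ)} (hZT : Z ∉ T)
    (hT : ∀ Y ∈ T, par k i Y ∈ gap m k → par k i Y ∈ T)
    (hz : z ∈ chain k i Z)
    (hnear : sgn k i Z = 1 ∧ z (dirn i Z) < thr k i Z ∨
      sgn k i Z = -1 ∧ thr k i Z ≤ z (dirn i Z)) (hZ' : Z' ∈ T) : z ∉ chain k i Z' := by
  intro hz'
  have hne : Z' ≠ Z := fun h => hZT (h ▸ hZ')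
  have hpar : par k i Z' ≠ Z := fun h => hZT (h ▸ hT _ hZ' (h.symm ▸ hZ))
  rcases up_eq_of_near (sgn_ne_zero hki hZ) hz hnear with h | ⟨h, hP⟩
  · rcases up_of_mem_chain hz' with h' | h'
    · exact hne (h'.symm.trans h)
    · exact hpar (h'.symm.trans h)
  obtain ⟨r, hr⟩ : ∃ r, r = dirn i Z := ⟨_, rfl⟩
  have hPr := par_dirn k i Z
  have h1 := up_le (m := m) z r
  have h2 := lt_up (m := m) z r
  have ha := res_pos i
  have hb := res_lt i
  obtain ⟨c1, c2⟩ := mem_chain.1 hz'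
  simp only [thr, hP, if_true] at hnear
  rw [← hr] at hnear hPr
  rw [h] at h1 h2
  have hzne : z r ≠ base m * par k i Z r + res i := by
    rcases sgn_ne_zero hki hZ with hs | hs <;> simp only [hs] at hnear <;> norm_num at hnear <;>
      omega
  rcases up_of_mem_chain hz' with h' | h'
  · have hZ'P : Z' = par k i Z := h'.symm.trans h
    have hrr : r = dirn i Z' := by
      by_contra hne'
      exact hzne (hZ'P ▸ c1 r hne')
    apply hpar
    ext q
    by_cases hq : q = r
    · have hP' := par_dirn k i Z'
      rw [← hrr] at c2 hP'
      rw [hq, hP', hZ'P, hPr]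
      rw [hZ'P] at c2
      rcases sgn_ne_zero hki hZ with hs | hs <;> simp only [hs] at hnear <;>
        norm_num at hnear <;> rw [hs] <;> rw [← hZ'P] at c2 ⊢ <;>
        rw [← hZ'P] at hnear <;>
        rcases c2 with c2 | c2 | c2 <;> rw [c2.1] <;> omega
    · rw [par_of_ne (hrr ▸ hq), hZ'P, par_of_ne (hr ▸ hq)]
  · have hPP : par k i Z' = par k i Z := h'.symm.trans h
    have hrr : r = dirn i Z' := by
      by_contra hne'
      have h3 := c1 r hne'
      rw [← par_of_ne (k := k) hne', hPP] at h3
      exact hzne h3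
    apply hne
    ext q
    have hq' := congr_fun hPP q
    by_cases hq : q = r
    · have hP' := par_dirn k i Z'
      rw [← hrr] at c2 hP'
      rw [hq, hP', hPr] at hq'
      rw [hq]
      have h3 : Z' r = par k i Z r - sgn k i Z' := by rw [hPr]; linarith
      rw [h3, mul_sub] at c2
      rcases sgn_ne_zero hki hZ with hs | hs <;> simp only [hs] at hnear <;>
        norm_num at hnear <;> rw [hs] at hq' <;>
        rcases c2 with c2 | c2 | c2 <;> rw [c2.1] at hq' c2 <;> omega
    · rwa [par_of_ne (hrr ▸ hq), par_of_ne (hr ▸ hq)] at hq'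

end GridMoves

section CoordinateBox

open Topology Filter

variable {X : Type*} [TopologicalSpace X] {n : ℕ}

/-- Split off one coordinate, with a choice of orientation. -/
noncomputable def coordSplit (r : Fin n) (ε : ℝ) (hε : ε ≠ 0) :
    ℝ × ({q // q ≠ r} → ℝ) ≃ₜ (Fin n → ℝ) :=
  ((Homeomorph.mulLeft₀ ε hε).prodCongr (Homeomorph.refl _)).trans
    (Homeomorph.funSplitAt ℝ r).symm

theorem coordSplit_same (r : Fin n) {ε : ℝ} (hε : ε ≠ 0) (w : ℝ × ({q // q ≠ r} → ℝ)) :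
    coordSplit r ε hε w r = ε * w.1 := by
  simp [coordSplit, Homeomorph.funSplitAt, Homeomorph.piSplitAt, Equiv.piSplitAt]

theorem coordSplit_of_ne {r : Fin n} {ε : ℝ} (hε : ε ≠ 0) (w : ℝ × ({q // q ≠ r} → ℝ)) {q : Fin n}
    (hq : q ≠ r) : coordSplit r ε hε w q = w.2 ⟨q, hq⟩ := by
  simp [coordSplit, Homeomorph.funSplitAt, Homeomorph.piSplitAt, Equiv.piSplitAt, hq]

theorem box_move [T2Space X] {ψ : (Fin n → ℝ) → X} (hψ : IsOpenEmbedding ψ) {l u : Fin n → ℝ}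
    (hlu : ∀ q, l q < u q) {r : Fin n} {ε τ : ℝ} (hε : ε = 1 ∨ ε = -1) (hl : l r < τ) (hu : τ < u r)
    {U : Set X} (hU : IsOpen U)
    (hmem : ∀ x ∈ univ.pi fun q => Ioo (l q) (u q), ε * x r < ε * τ → ψ x ∈ U)
    (hnot : ∀ x ∈ univ.pi fun q => Ioo (l q) (u q), ε * τ < ε * x r → ψ x ∉ U) :
    Expands U (U ∪ ψ '' univ.pi fun q => Ioo (l q) (u q)) ∧
    ∀ G : Set X, IsClosed G → IsPreconnected G →
      (∀ x ∈ univ.pi fun q => Ioo (l q) (u q), ψ x ∈ G ↔ ψ x ∉ U) →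
      IsPreconnected (G \ ψ '' univ.pi fun q => Ioo (l q) (u q)) := by
  have hε0 : ε ≠ 0 := by rcases hε with rfl | rfl <;> norm_num
  have hεε : ε * ε = 1 := by rcases hε with rfl | rfl <;> norm_num
  obtain ⟨α, β, hαβ, hα, hβ⟩ : ∃ α β : ℝ, (∀ t, ε * t ∈ Ioo (l r) (u r) ↔ t ∈ Ioo α β) ∧
      α < ε * τ ∧ ε * τ < β := by
    rcases hε with rfl | rfl
    · exact ⟨l r, u r, fun t => by simp, by linarith, by linarith⟩
    · refine ⟨-u r, -l r, fun t => ?_, by linarith, by linarith⟩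
      simp only [mem_Ioo]
      constructor <;> rintro ⟨h1, h2⟩ <;> constructor <;> linarith
  set D : Set ({q // q ≠ r} → ℝ) := univ.pi fun q => Ioo (l q) (u q) with hD
  have hDo : IsOpen D := isOpen_set_pi finite_univ fun _ _ => isOpen_Ioo
  have hDcl : closure D = univ.pi fun q : {q // q ≠ r} => Icc (l q) (u q) := by
    rw [hD, closure_pi_set]
    simp only [closure_Ioo (hlu _).ne]
  have hDc : IsCompact (closure D) := by
    rw [hDcl]
    exact isCompact_univ_pi fun _ => isCompact_Icc
  have hDp : IsPreconnected D := isPreconnected_univ_pi fun _ => isPreconnected_Ioo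
  have hDne : D.Nonempty := univ_pi_nonempty_iff.2 fun q => nonempty_Ioo.2 (hlu q)
  have hB : ∀ w : ℝ × ({q // q ≠ r} → ℝ), coordSplit r ε hε0 w ∈
      (univ.pi fun q => Ioo (l q) (u q)) ↔ w ∈ Ioo α β ×ˢ D := by
    rintro ⟨t, y⟩
    rw [mem_prod, ← hαβ, hD]
    simp only [mem_univ_pi]
    constructor
    · intro h
      refine ⟨by simpa only [coordSplit_same] using h r, fun q => ?_⟩
      simpa only [coordSplit_of_ne hε0 _ q.2] using h q
    · rintro ⟨h1, h2⟩ q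
      by_cases hq : q = r
      · subst hq
        simpa only [coordSplit_same] using h1
      · simpa only [coordSplit_of_ne hε0 _ hq] using h2 ⟨q, hq⟩
  have himg : (ψ ∘ coordSplit r ε hε0) '' (Ioo α β ×ˢ D) =
      ψ '' univ.pi fun q => Ioo (l q) (u q) := by
    rw [image_comp]
    congr 1
    ext x
    constructor
    · rintro ⟨w, hw, rfl⟩
      exact (hB w).2 hw
    · intro hx
      exact ⟨(coordSplit r ε hε0).symm x, (hB _).1 (by simpa using hx), by simp⟩
  have hΨ : IsOpenEmbedding (ψ ∘ coordSplit r ε hε0) :=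
    hψ.comp (coordSplit r ε hε0).isOpenEmbedding
  have hiff : ∀ t ∈ Ioo α β, ∀ y ∈ D, (ψ ∘ coordSplit r ε hε0) (t, y) ∈ U ↔ t < ε * τ := by
    have hm : ∀ t ∈ Ioo α β, ∀ y ∈ D, t < ε * τ → (ψ ∘ coordSplit r ε hε0) (t, y) ∈ U := by
      intro t ht y hy h
      refine hmem _ ((hB _).2 ⟨ht, hy⟩) ?_
      rwa [coordSplit_same, ← mul_assoc, hεε, one_mul]
    have hn : ∀ t ∈ Ioo α β, ∀ y ∈ D, ε * τ < t → (ψ ∘ coordSplit r ε hε0) (t, y) ∉ U := by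
      intro t ht y hy h
      refine hnot _ ((hB _).2 ⟨ht, hy⟩) ?_
      rwa [coordSplit_same, ← mul_assoc, hεε, one_mul]
    intro t ht y hy
    refine ⟨fun h => ?_, hm t ht y hy⟩
    by_contra! hle
    have hev : ∀ᶠ t' in 𝓝[>] t, (ψ ∘ coordSplit r ε hε0) (t', y) ∈ U := by
      apply nhdsWithin_le_nhds
      have hcont : Continuous fun t' : ℝ => (t', y) := by fun_prop
      exact (hU.preimage (hΨ.continuous.comp hcont)).mem_nhds h
    have hev2 : ∀ᶠ t' in 𝓝[>] t, t' ∈ Ioo t β := Ioo_mem_nhdsGT ht.2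
    obtain ⟨t', h1, h2⟩ := (hev.and hev2).exists
    exact hn t' ⟨ht.1.trans h2.1, h2.2⟩ y hy (hle.trans_lt h2.1) h1
  rw [← himg]
  refine ⟨expands_union_box hΨ hDo hDc hα hβ hU hiff, fun G hGc hG hGU => ?_⟩
  refine isPreconnected_diff_box hΨ hDo hDc hDp hDne hα hβ hGc hG fun t ht y hy => ?_
  rw [Function.comp_apply, hGU _ ((hB _).2 ⟨ht, hy⟩), ← not_lt, ← hiff t ht y hy,
    Function.comp_apply]

end CoordinateBox

section Lakes

open Topology Filter

variable {n m : ℕ}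

/-- The side length of the cells of level `k`, inverted. -/
noncomputable def scale (m k : ℕ) : ℝ := (base m : ℝ) ^ k

theorem one_lt_base [NeZero m] : (1 : ℝ) < base m := by
  have : 0 < m := Nat.pos_of_ne_zero (NeZero.ne m)
  have : (1 : ℤ) < base m := by unfold base; omega
  exact_mod_cast this

theorem scale_pos (m k : ℕ) : 0 < scale m k :=
  pow_pos (by exact_mod_cast base_pos) k

theorem scale_zero (m : ℕ) : scale m 0 = 1 := pow_zero _

theorem scale_succ (m k : ℕ) : scale m (k + 1) = base m * scale m k := pow_succ' _ _

/-- The half-open cell of level `k` containing a point. -/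
noncomputable def cellOf (m k : ℕ) (x : Fin n → ℝ) : Fin n → ℤ := fun q => ⌊scale m k * x q⌋

/-- The open cell `z` of level `k`. -/
def openCell (m k : ℕ) (z : Fin n → ℤ) : Set (Fin n → ℝ) :=
  {x | ∀ q, z q < scale m k * x q ∧ scale m k * x q < z q + 1}

/-- The closed cell `z` of level `k`. -/
def closedCell (m k : ℕ) (z : Fin n → ℤ) : Set (Fin n → ℝ) :=
  {x | ∀ q, z q ≤ scale m k * x q ∧ scale m k * x q ≤ z q + 1}

theorem up_cellOf (k : ℕ) (x : Fin n → ℝ) : up m (cellOf m (k + 1) x) = cellOf m k x := by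
  have hb := base_pos (m := m)
  have hb' : (0 : ℝ) < base m := by exact_mod_cast hb
  ext q
  have h1 := Int.floor_le (scale m k * x q)
  have h2 := Int.lt_floor_add_one (scale m k * x q)
  apply up_apply_eq
  · apply Int.le_floor.2
    rw [scale_succ, mul_assoc]
    push_cast
    exact mul_le_mul_of_nonneg_left h1 hb'.le
  · apply Int.floor_lt.2
    rw [scale_succ, mul_assoc, cellOf]
    push_cast
    nlinarith

theorem openCell_subset_up (k : ℕ) (z : Fin n → ℤ) :
    openCell m (k + 1) z ⊆ openCell m k (up m z) := by
  intro x hx q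
  have hb : (0 : ℝ) < base m := by exact_mod_cast base_pos
  obtain ⟨h1, h2⟩ := hx q
  have h3 : (base m * up m z q : ℝ) ≤ z q := by exact_mod_cast up_le z q
  have h4 : (z q + 1 : ℝ) ≤ base m * up m z q + base m := by exact_mod_cast lt_up z q
  rw [scale_succ, mul_assoc] at h1 h2
  constructor
  · exact lt_of_mul_lt_mul_left (by linarith) hb.le
  · exact lt_of_mul_lt_mul_left (by linarith) hb.le

theorem isCompact_closedCell (k : ℕ) (z : Fin n → ℤ) : IsCompact (closedCell m k z) := by
  have : closedCell m k z =
      univ.pi fun q => Icc (z q / scale m k : ℝ) ((z q + 1) / scale m k) := by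
    ext x
    simp only [closedCell, mem_ofPred_eq, mem_univ_pi, mem_Icc, div_le_iff₀' (scale_pos m k),
      le_div_iff₀' (scale_pos m k)]
  rw [this]
  exact isCompact_univ_pi fun _ => isCompact_Icc

theorem openCell_subset_closedCell (k : ℕ) (z : Fin n → ℤ) :
    openCell m k z ⊆ closedCell m k z := fun _ hx q => ⟨(hx q).1.le, (hx q).2.le⟩

theorem cellOf_zero_eq_zero {x : Fin n → ℝ} (hx : cellOf m 0 x = 0) : x ∈ closedCell m 0 0 := by
  intro q
  have h := congr_fun hx q
  have h1 := Int.floor_le (scale m 0 * x q)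
  have h2 := Int.lt_floor_add_one (scale m 0 * x q)
  rw [cellOf, Pi.zero_apply] at h
  rw [h] at h1 h2
  exact ⟨h1, h2.le⟩

variable [NeZero n] {k : ℕ} {i j : Fin m} {Z z : Fin n → ℤ} {x : Fin n → ℝ}

/-- Lower corner of the chain of cells from `Z` to `par k i Z`. -/
noncomputable def lo (k : ℕ) (i : Fin m) (Z : Fin n → ℤ) : Fin n → ℤ :=
  vtx i Z ⊓ vtx i (par k i Z)

/-- Upper corner of the chain of cells from `Z` to `par k i Z`. -/
noncomputable def hi (k : ℕ) (i : Fin m) (Z : Fin n → ℤ) : Fin n → ℤ :=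
  vtx i Z ⊔ vtx i (par k i Z)

/-- The open box formed by the cells of the chain from `Z` to `par k i Z`. -/
def box (k : ℕ) (i : Fin m) (Z : Fin n → ℤ) : Set (Fin n → ℝ) :=
  univ.pi fun q => Ioo (lo k i Z q / scale m (k + 1)) ((hi k i Z q + 1) / scale m (k + 1))

theorem mem_box : x ∈ box k i Z ↔
    ∀ q, lo k i Z q < scale m (k + 1) * x q ∧ scale m (k + 1) * x q < hi k i Z q + 1 := by
  simp only [box, mem_univ_pi, mem_Ioo, div_lt_iff₀' (scale_pos m (k + 1)),
    lt_div_iff₀' (scale_pos m (k + 1))]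

theorem isOpen_box (k : ℕ) (i : Fin m) (Z : Fin n → ℤ) : IsOpen (box k i Z) :=
  isOpen_set_pi finite_univ fun _ _ => isOpen_Ioo

theorem convex_box (k : ℕ) (i : Fin m) (Z : Fin n → ℤ) : Convex ℝ (box k i Z) :=
  convex_pi fun _ _ => convex_Ioo _ _

theorem cellOf_mem_chain (hx : x ∈ box k i Z) : cellOf m (k + 1) x ∈ chain k i Z := by
  rw [mem_box] at hx
  refine ⟨fun q => Int.le_floor.2 (hx q).1.le, fun q => ?_⟩
  exact Int.lt_add_one_iff.1 (Int.floor_lt.2 (by exact_mod_cast (hx q).2))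

theorem openCell_subset_box (hz : z ∈ chain k i Z) : openCell m (k + 1) z ⊆ box k i Z := by
  intro x hx
  rw [mem_box]
  intro q
  have h1 : (lo k i Z q : ℝ) ≤ z q := by exact_mod_cast hz.1 q
  have h2 : (z q : ℝ) ≤ hi k i Z q := by exact_mod_cast hz.2 q
  exact ⟨h1.trans_lt (hx q).1, (hx q).2.trans_le (by linarith)⟩

/-- A closed gap cell is covered by the boxes and the closed gap cells of the next level. -/
theorem closedCell_cover (hZ : Z ∈ gap m k) (hx : x ∈ closedCell m k Z)
    (hb : ∀ i : Fin m, ∀ Z ∈ gap m k, x ∉ box k i Z) :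
    ∃ z ∈ gap m (k + 1), x ∈ closedCell m (k + 1) z := by
  have hbpos : (0 : ℝ) < base m := by exact_mod_cast base_pos
  have hodd : ∀ c : ℤ, Odd c ∨ Even c := fun c => (Int.even_or_odd c).symm
  have key : ∀ q, ∃ c : ℤ, base m * Z q ≤ c ∧ c < base m * Z q + base m ∧
      (c : ℝ) ≤ scale m (k + 1) * x q ∧ scale m (k + 1) * x q ≤ c + 1 ∧
      ((c : ℝ) < scale m (k + 1) * x q ∧ scale m (k + 1) * x q < c + 1 ∨
        Even (c - base m * Z q)) := by
    intro q
    have h1 : (base m * Z q : ℝ) ≤ scale m (k + 1) * x q := by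
      rw [scale_succ, mul_assoc]
      exact mul_le_mul_of_nonneg_left (hx q).1 hbpos.le
    have h2 : scale m (k + 1) * x q ≤ base m * Z q + base m := by
      rw [scale_succ, mul_assoc]
      have := mul_le_mul_of_nonneg_left (hx q).2 hbpos.le
      linarith
    set t := scale m (k + 1) * x q
    have h3 := Int.floor_le t
    have h4 := Int.lt_floor_add_one t
    have h1' : base m * Z q ≤ ⌊t⌋ := Int.le_floor.2 (by exact_mod_cast h1)
    have h2' : ⌊t⌋ ≤ base m * Z q + base m := by
      have : (⌊t⌋ : ℝ) ≤ (base m * Z q + base m : ℤ) := by push_cast; linarith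
      exact_mod_cast this
    have hbodd : Odd (base m) := ⟨m, rfl⟩
    rcases h3.lt_or_eq with h | h
    · refine ⟨⌊t⌋, h1', ?_, h3, h4.le, Or.inl ⟨h, h4⟩⟩
      have : (⌊t⌋ : ℝ) < (base m * Z q + base m : ℤ) := by push_cast; linarith
      exact_mod_cast this
    · rcases hodd (⌊t⌋ - base m * Z q) with ho | he
      · refine ⟨⌊t⌋ - 1, ?_, ?_, ?_, ?_, Or.inr ?_⟩
        · obtain ⟨c, hc⟩ := ho
          omega
        · omega
        · push_cast
          linarith
        · push_cast
          linarith
        · rw [sub_right_comm]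
          exact ho.sub_odd odd_one
      · refine ⟨⌊t⌋, h1', ?_, h3, h4.le, Or.inr he⟩
        rcases h2'.lt_or_eq with h' | h'
        · exact h'
        · rw [h', add_sub_cancel_left] at he
          exact absurd hbodd (Int.not_odd_iff_even.2 he)
  choose c hc1 hc2 hc3 hc4 hc5 using key
  have hup : up m c = Z := by
    ext q
    exact up_apply_eq (hc1 q) (hc2 q)
  refine ⟨c, ⟨hup ▸ hZ, fun i Z' hZ' hmem => hb i Z' hZ' ?_⟩, fun q => ⟨hc3 q, hc4 q⟩⟩
  have hev : ∀ q, Even (c q - base m * Z q) → ¬ ∃ Y : ℤ, c q = base m * Y + res i := by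
    rintro q he ⟨Y, hY⟩
    have : up m c q = Y := up_apply_eq (by linarith [res_pos i]) (by linarith [res_lt i])
    rw [hup] at this
    rw [hY, this, add_sub_cancel_left] at he
    exact Int.not_odd_iff_even.2 he (odd_res i)
  have hlo : ∀ q, ∃ Y, lo k i Z' q = base m * Y + res i := by
    intro q
    rcases min_choice (vtx i Z' q) (vtx i (par k i Z') q) with h | h <;>
    exact ⟨_, h⟩
  have hhi : ∀ q, ∃ Y, hi k i Z' q = base m * Y + res i := by
    intro q
    rcases max_choice (vtx i Z' q) (vtx i (par k i Z') q) with h | h <;>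
    exact ⟨_, h⟩
  rw [mem_box]
  intro q
  rcases hc5 q with h | h
  · have h1 : (lo k i Z' q : ℝ) ≤ c q := by exact_mod_cast hmem.1 q
    have h2 : (c q : ℝ) ≤ hi k i Z' q := by exact_mod_cast hmem.2 q
    exact ⟨h1.trans_lt h.1, h.2.trans_le (by linarith)⟩
  · have h1 : lo k i Z' q < c q :=
      lt_of_le_of_ne (hmem.1 q) fun e => hev q h (e ▸ hlo q)
    have h2 : c q < hi k i Z' q :=
      lt_of_le_of_ne (hmem.2 q) fun e => hev q h (e ▸ hhi q)
    have h1' : (lo k i Z' q : ℝ) + 1 ≤ c q := by exact_mod_cast h1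
    have h2' : (c q : ℝ) + 1 ≤ hi k i Z' q := by exact_mod_cast h2
    exact ⟨by linarith [hc3 q], by linarith [hc4 q]⟩

end Lakes

section Lakes

open Topology Filter

variable {n m : ℕ} [NeZero n] {X : Type*}

/-- The `k`-th approximation of the `i`-th lake. -/
def lake (ψ : (Fin n → ℝ) → X) (i : Fin m) : ℕ → Set X
  | 0 => {p | (i : ℕ) = 0 ∧ p ∉ ψ '' closedCell m 0 0}
  | k + 1 => lake ψ i k ∪ ⋃ Z ∈ gap m k, ψ '' box k i Z

/-- The `k`-th approximation of the `i`-th lake together with some boxes of the next level. -/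
def partLake (ψ : (Fin n → ℝ) → X) (k : ℕ) (i : Fin m) (T : Set (Fin n → ℤ)) : Set X :=
  lake ψ i k ∪ ⋃ Z ∈ T, ψ '' box k i Z

variable {ψ : (Fin n → ℝ) → X} {k : ℕ} {i j : Fin m} {Z z : Fin n → ℤ} {x : Fin n → ℝ}
  {T : Set (Fin n → ℤ)}

theorem lake_mono (ψ : (Fin n → ℝ) → X) (i : Fin m) : Monotone (lake ψ i) :=
  monotone_nat_of_le_succ fun _ => subset_union_left

theorem image_box_subset_lake (hZ : Z ∈ gap m k) : ψ '' box k i Z ⊆ lake ψ i (k + 1) :=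
  (subset_biUnion_of_mem (u := fun Z => ψ '' box k i Z) hZ).trans subset_union_right

theorem isOpen_lake [TopologicalSpace X] [T2Space X] (hψ : IsOpenEmbedding ψ) (i : Fin m) (k : ℕ) :
    IsOpen (lake ψ i k) := by
  induction k with
  | zero =>
    by_cases hi : (i : ℕ) = 0
    · simp only [lake, hi, true_and]
      exact ((isCompact_closedCell 0 0).image hψ.continuous).isClosed.isOpen_compl
    · simp [lake, hi]
  | succ k ih =>
    exact ih.union (isOpen_biUnion fun _ _ => hψ.isOpenMap _ (isOpen_box _ _ _))

theorem isOpen_partLake [TopologicalSpace X] [T2Space X] (hψ : IsOpenEmbedding ψ) (i : Fin m)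
    (k : ℕ) (T : Set (Fin n → ℤ)) : IsOpen (partLake ψ k i T) :=
  (isOpen_lake hψ i k).union (isOpen_biUnion fun _ _ => hψ.isOpenMap _ (isOpen_box _ _ _))

theorem cellOf_mem_col (hψ : Function.Injective ψ) (hx : ψ x ∈ lake ψ i k) :
    cellOf m k x ∈ col i k := by
  induction k with
  | zero =>
    exact ⟨hx.1, fun h => hx.2 ⟨x, cellOf_zero_eq_zero h, rfl⟩⟩
  | succ k ih =>
    rcases hx with hx | hx
    · left
      rw [up_cellOf]
      exact ih hx
    · right
      simp only [mem_iUnion] at hx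
      obtain ⟨Z, hZ, x', hx', h⟩ := hx
      exact ⟨Z, hZ, cellOf_mem_chain (hψ h ▸ hx')⟩

theorem image_openCell_subset_lake (hψ : Function.Injective ψ) (hz : z ∈ col i k) :
    ψ '' openCell m k z ⊆ lake ψ i k := by
  induction k generalizing z with
  | zero =>
    rintro _ ⟨x, hx, rfl⟩
    refine ⟨hz.1, fun ⟨x', hx', h⟩ => hz.2 ?_⟩
    rw [hψ h] at hx'
    ext q
    obtain ⟨h1, h2⟩ := hx q
    obtain ⟨h3, h4⟩ := hx' q
    simp only [Pi.zero_apply, Int.cast_zero] at h3 h4 ⊢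
    have h5 : (z q : ℝ) < 1 := by linarith
    have h6 : (-1 : ℝ) < z q := by linarith
    have h5' : z q < 1 := by exact_mod_cast h5
    have h6' : -1 < z q := by exact_mod_cast h6
    omega
  | succ k ih =>
    rcases hz with hz | ⟨Z, hZ, hz⟩
    · exact ((image_mono (openCell_subset_up k z)).trans (ih hz)).trans
        (lake_mono ψ i k.le_succ)
    · exact (image_mono (openCell_subset_box hz)).trans (image_box_subset_lake hZ)

theorem lake_subset_range (hi : (i : ℕ) ≠ 0) : lake ψ i k ⊆ range ψ := by
  induction k with
  | zero => exact fun p hp => absurd hp.1 hi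
  | succ k ih =>
    refine union_subset ih (iUnion₂_subset fun Z _ => image_subset_range _ _)

theorem disjoint_lake (hn : 3 ≤ n) (hψ : Function.Injective ψ) (hij : i ≠ j) :
    Disjoint (lake ψ i k) (lake ψ j k) := by
  rw [Set.disjoint_left]
  intro p hi hj
  have : p ∈ range ψ := by
    by_cases h : (i : ℕ) = 0
    · exact lake_subset_range (fun h' => hij (Fin.ext (h.trans h'.symm))) hj
    · exact lake_subset_range h hi
  obtain ⟨x, rfl⟩ := this
  exact not_mem_col_of_mem_col hn hij (cellOf_mem_col hψ hi) (cellOf_mem_col hψ hj)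

theorem exists_closedCell (k : ℕ) {p : X} (hm : 0 < m) (hp : ∀ i : Fin m, p ∉ lake ψ i k) :
    ∃ Z ∈ gap m k, p ∈ ψ '' closedCell m k Z := by
  induction k with
  | zero =>
    by_contra h
    exact hp ⟨0, hm⟩ ⟨rfl, fun h' => h ⟨0, rfl, h'⟩⟩
  | succ k ih =>
    obtain ⟨Z, hZ, x, hx, rfl⟩ := ih fun i h => hp i (lake_mono ψ i k.le_succ h)
    obtain ⟨z, hz, hxz⟩ := closedCell_cover hZ hx fun i Z' hZ' h =>
      hp i (image_box_subset_lake hZ' ⟨x, h, rfl⟩)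
    exact ⟨z, hz, x, hxz, rfl⟩

theorem thr_bounds (hs : sgn k i Z = 1 ∨ sgn k i Z = -1) :
    lo k i Z (dirn i Z) < thr k i Z ∧ thr k i Z < hi k i Z (dirn i Z) + 1 := by
  have ha := res_pos i
  have hb := res_lt i
  have h1 : lo k i Z (dirn i Z) =
      min (base m * Z (dirn i Z) + res i) (base m * par k i Z (dirn i Z) + res i) := rfl
  have h2 : hi k i Z (dirn i Z) =
      max (base m * Z (dirn i Z) + res i) (base m * par k i Z (dirn i Z) + res i) := rfl
  rw [h1, h2]
  have hP : base m * par k i Z (dirn i Z) =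
      base m * Z (dirn i Z) + base m * sgn k i Z := by rw [par_dirn, mul_add]
  simp only [thr]
  split_ifs with h3 h4 h4
  · simp only [h3, mul_one] at hP
    omega
  · simp only [h3, mul_one] at hP
    omega
  all_goals
    simp only [hs.resolve_left h3, mul_neg, mul_one] at hP
    omega

theorem mem_partLake_of_beyond (hn : 3 ≤ n) (hψ : Function.Injective ψ) (hZ : Z ∈ gap m k)
    (hP : par k i Z ∈ gap m k → par k i Z ∈ T) (hx : x ∈ box k i Z)
    (hb : sgn k i Z = 1 ∧ thr k i Z < scale m (k + 1) * x (dirn i Z) ∨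
      sgn k i Z = -1 ∧ scale m (k + 1) * x (dirn i Z) < thr k i Z) : ψ x ∈ partLake ψ k i T := by
  have ha := res_pos i
  have hb' := res_lt i
  rw [mem_box] at hx
  have hlo : ∀ q, q ≠ dirn i Z → lo k i Z q = base m * par k i Z q + res i := by
    intro q hq
    simp [lo, vtx, par_of_ne hq]
  have hhi : ∀ q, q ≠ dirn i Z → hi k i Z q = base m * par k i Z q + res i := by
    intro q hq
    simp [hi, vtx, par_of_ne hq]
  have h1 : sgn k i Z = -1 → lo k i Z (dirn i Z) = base m * par k i Z (dirn i Z) + res i := by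
    intro h
    simp only [lo, vtx, par_dirn, h, Pi.inf_apply, inf_eq_right, mul_add]
    omega
  have h2 : sgn k i Z = 1 → hi k i Z (dirn i Z) = base m * par k i Z (dirn i Z) + res i := by
    intro h
    simp only [hi, vtx, par_dirn, h, Pi.sup_apply, sup_eq_right, mul_add]
    omega
  by_cases hPg : par k i Z ∈ gap m k
  · right
    simp only [mem_iUnion]
    refine ⟨_, hP hPg, mem_image_of_mem _ (openCell_subset_box (vtx_mem_chain k i _) fun q => ?_)⟩
    by_cases hq : q = dirn i Z
    · subst hq
      have hxq := hx (dirn i Z)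
      rcases hb with ⟨hs, hb⟩ | ⟨hs, hb⟩ <;> simp only [thr, hs, hPg] at hb <;> norm_num at hb <;>
        simp only [vtx]
      · rw [h2 hs] at hxq
        push_cast at hxq ⊢
        exact ⟨hb, hxq.2⟩
      · rw [h1 hs] at hxq
        push_cast at hxq ⊢
        exact ⟨hxq.1, by linarith⟩
    · have hxq := hx q
      rwa [hlo q hq, hhi q hq] at hxq
  · left
    apply image_openCell_subset_lake hψ ((par_mem_gap_or_col hn hZ i).resolve_left hPg)
    refine mem_image_of_mem _ fun q => ?_
    have hbpos : (0 : ℝ) < base m := by exact_mod_cast base_pos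
    have ha' : (0 : ℝ) < res i := by exact_mod_cast ha
    have hb'' : (res i + 1 : ℝ) ≤ base m := by exact_mod_cast hb'
    have key : (base m * par k i Z q : ℝ) < scale m (k + 1) * x q ∧
        scale m (k + 1) * x q < base m * par k i Z q + base m := by
      by_cases hq : q = dirn i Z
      · subst hq
        have hxq := hx (dirn i Z)
        rcases hb with ⟨hs, hb⟩ | ⟨hs, hb⟩ <;> simp only [thr, hs, hPg] at hb <;>
          norm_num at hb
        · rw [h2 hs] at hxq
          push_cast at hxq ⊢
          exact ⟨hb, by linarith⟩
        · rw [h1 hs] at hxq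
          push_cast at hxq ⊢
          exact ⟨by linarith, hb⟩
      · have hxq := hx q
        rw [hlo q hq, hhi q hq] at hxq
        push_cast at hxq
        constructor <;> linarith
    rw [scale_succ, mul_assoc] at key
    constructor
    · exact lt_of_mul_lt_mul_left key.1 hbpos.le
    · exact lt_of_mul_lt_mul_left (by linarith [key.2]) hbpos.le

theorem not_mem_partLake_of_near (hψ : Function.Injective ψ)
    (hki : k ≠ 0 ∨ (i : ℕ) = 0) (hZ : Z ∈ gap m k) (hZT : Z ∉ T)
    (hT : ∀ Y ∈ T, par k i Y ∈ gap m k → par k i Y ∈ T) (hx : x ∈ box k i Z)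
    (hb : sgn k i Z = 1 ∧ scale m (k + 1) * x (dirn i Z) < thr k i Z ∨
      sgn k i Z = -1 ∧ thr k i Z < scale m (k + 1) * x (dirn i Z)) : ψ x ∉ partLake ψ k i T := by
  have hnear : sgn k i Z = 1 ∧ cellOf m (k + 1) x (dirn i Z) < thr k i Z ∨
      sgn k i Z = -1 ∧ thr k i Z ≤ cellOf m (k + 1) x (dirn i Z) := by
    rcases hb with hb | hb
    · exact Or.inl ⟨hb.1, Int.floor_lt.2 hb.2⟩
    · exact Or.inr ⟨hb.1, Int.le_floor.2 hb.2.le⟩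
  rintro (h | h)
  · have := cellOf_mem_col hψ h
    rw [← up_cellOf] at this
    exact up_not_mem_col_of_near hki hZ (cellOf_mem_chain hx) hnear this
  · simp only [mem_iUnion] at h
    obtain ⟨Y, hY, x', hx', h⟩ := h
    exact not_mem_chain_of_near hki hZ hZT hT (cellOf_mem_chain hx) hnear hY
      (cellOf_mem_chain (hψ h ▸ hx'))

theorem partLake_move [TopologicalSpace X] [T2Space X] (hn : 3 ≤ n) (hψ : IsOpenEmbedding ψ)
    (hki : k ≠ 0 ∨ (i : ℕ) = 0) (hZ : Z ∈ gap m k) (hZT : Z ∉ T)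
    (hT : ∀ Y ∈ T, par k i Y ∈ gap m k → par k i Y ∈ T)
    (hP : par k i Z ∈ gap m k → par k i Z ∈ T) :
    Expands (partLake ψ k i T) (partLake ψ k i T ∪ ψ '' box k i Z) ∧
    ∀ G : Set X, IsClosed G → IsPreconnected G →
      (∀ x ∈ box k i Z, ψ x ∈ G ↔ ψ x ∉ partLake ψ k i T) →
        IsPreconnected (G \ ψ '' box k i Z) := by
  have hsc := scale_pos m (k + 1)
  have hs := sgn_ne_zero hki hZ
  obtain ⟨h1, h2⟩ := thr_bounds hs
  have h1' : (lo k i Z (dirn i Z) : ℝ) < thr k i Z := by exact_mod_cast h1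
  have h2' : (thr k i Z : ℝ) < hi k i Z (dirn i Z) + 1 := by exact_mod_cast h2
  refine box_move hψ (r := dirn i Z) (ε := -sgn k i Z) (τ := thr k i Z / scale m (k + 1)) ?_ ?_ ?_
    ?_ (isOpen_partLake hψ i k T) ?_ ?_
  · intro q
    gcongr
    have : lo k i Z q ≤ hi k i Z q := inf_le_sup
    exact_mod_cast Int.lt_add_one_iff.2 this
  · rcases hs with hs | hs <;> simp [hs]
  · gcongr
  · gcongr
  · intro x hx hlt
    refine mem_partLake_of_beyond hn hψ.injective hZ hP hx ?_
    rcases hs with hs | hs <;> simp only [hs] at hlt ⊢ <;> norm_num at hlt ⊢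
    · exact (div_lt_iff₀' hsc).1 hlt
    · exact (lt_div_iff₀' hsc).1 hlt
  · intro x hx hlt
    refine not_mem_partLake_of_near hψ.injective hki hZ hZT hT hx ?_
    rcases hs with hs | hs <;> simp only [hs] at hlt ⊢ <;> norm_num at hlt ⊢
    · exact (lt_div_iff₀' hsc).1 hlt
    · exact (div_lt_iff₀' hsc).1 hlt

theorem partLake_induction [TopologicalSpace X] [T2Space X] (hn : 3 ≤ n) (hψ : IsOpenEmbedding ψ)
    (hki : k ≠ 0 ∨ (i : ℕ) = 0) (T : Finset (Fin n → ℤ)) : (∀ Z ∈ T, Z ∈ gap m k) →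
    (∀ Y ∈ T, par k i Y ∈ gap m k → par k i Y ∈ T) →
    Expands (lake ψ i k) (partLake ψ k i T) ∧
    ∀ G : Set X, IsClosed G → IsPreconnected G →
      (∀ Z ∈ gap m k, ∀ x ∈ box k i Z, ψ x ∈ G ↔ ψ x ∉ lake ψ i k) →
      IsPreconnected (G \ ⋃ Z ∈ T, ψ '' box k i Z) := by
  classical
  induction T using Finset.induction_on_max_value (dep i) with
  | empty =>
    intro _ _
    refine ⟨?_, fun G _ hG _ => by simpa using hG⟩
    simp only [partLake, Finset.coe_empty, biUnion_empty, union_empty]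
    exact Expands.refl _
  | insert Z T hZT hmax ih =>
    intro hg hc
    have hZ := hg Z (Finset.mem_insert_self _ _)
    have hT : ∀ Y ∈ T, par k i Y ∈ gap m k → par k i Y ∈ T := by
      intro Y hY hPY
      have hYg := hg Y (Finset.mem_insert_of_mem hY)
      refine (Finset.mem_insert.1 (hc Y (Finset.mem_insert_of_mem hY) hPY)).resolve_left fun h => ?_
      have := dep_par_lt hki hYg hPY
      rw [h] at this
      exact absurd (hmax Y hY) (not_le.2 this)
    have hP : par k i Z ∈ gap m k → par k i Z ∈ T := by
      intro hPZ
      refine (Finset.mem_insert.1 (hc Z (Finset.mem_insert_self _ _) hPZ)).resolve_left fun h => ?_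
      have := dep_par_lt hki hZ hPZ
      rw [h] at this
      exact lt_irrefl _ this
    obtain ⟨ih1, ih2⟩ := ih (fun Y hY => hg Y (Finset.mem_insert_of_mem hY)) hT
    obtain ⟨h1, h2⟩ := partLake_move (T := T) hn hψ hki hZ hZT hT hP
    constructor
    · have : partLake ψ k i ((insert Z T : Finset (Fin n → ℤ)) : Set (Fin n → ℤ)) =
          partLake ψ k i T ∪ ψ '' box k i Z := by
        rw [partLake, partLake, Finset.coe_insert, biUnion_insert, union_comm (ψ '' box k i Z),
          union_assoc]
      rw [this]
      exact ih1.trans h1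
    · intro G hGc hG hGb
      rw [Finset.set_biUnion_insert, union_comm, ← Set.sdiff_sdiff]
      refine h2 _ (hGc.sdiff (isOpen_biUnion fun _ _ => hψ.isOpenMap _ (isOpen_box _ _ _)))
        (ih2 G hGc hG hGb) fun x hx => ?_
      rw [Set.mem_sdiff, hGb Z hZ x hx, partLake, mem_union, not_or]
      rfl

theorem lake_expands [TopologicalSpace X] [T2Space X] (hn : 3 ≤ n) (hψ : IsOpenEmbedding ψ)
    (hki : k ≠ 0 ∨ (i : ℕ) = 0) : Expands (lake ψ i k) (lake ψ i (k + 1)) := by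
  have := (partLake_induction (T := (finite_gap m k).toFinset) hn hψ hki (by simp)
    (by simp)).1
  rwa [Set.Finite.coe_toFinset] at this

theorem isPreconnected_diff_boxes [TopologicalSpace X] [T2Space X] (hn : 3 ≤ n)
    (hψ : IsOpenEmbedding ψ) (hki : k ≠ 0 ∨ (i : ℕ) = 0) {G : Set X} (hGc : IsClosed G)
    (hG : IsPreconnected G)
    (hGb : ∀ Z ∈ gap m k, ∀ x ∈ box k i Z, ψ x ∈ G ↔ ψ x ∉ lake ψ i k) :
    IsPreconnected (G \ ⋃ Z ∈ gap m k, ψ '' box k i Z) := by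
  have := (partLake_induction (T := (finite_gap m k).toFinset) hn hψ hki (by simp)
    (by simp)).2 G hGc hG hGb
  simpa using this

end Lakes

section Lakes

open Topology Filter

variable {n m : ℕ}

/-- The centre of the cell `z` of level `k`. -/
noncomputable def center (m k : ℕ) (z : Fin n → ℤ) : Fin n → ℝ :=
  fun q => (z q + 1 / 2) / scale m k

theorem openCell_eq_ball (k : ℕ) (z : Fin n → ℤ) :
    openCell m k z = ball (center m k z) (1 / 2 / scale m k) := by
  have hsc := scale_pos m k
  rw [ball_pi _ (by positivity)]
  ext x
  simp only [openCell, mem_ofPred_eq, mem_univ_pi, mem_ball, Real.dist_eq, center, abs_sub_lt_iff]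
  refine forall_congr' fun q => ?_
  have e : x q = scale m k * x q / scale m k := by field_simp
  rw [and_comm]
  nth_rw 3 4 [e]
  rw [← sub_div, ← sub_div, div_lt_div_iff_of_pos_right hsc, div_lt_div_iff_of_pos_right hsc]
  constructor <;> rintro ⟨h1, h2⟩ <;> constructor <;> linarith

theorem center_mem_openCell (k : ℕ) (z : Fin n → ℤ) : center m k z ∈ openCell m k z := by
  rw [openCell_eq_ball]
  have := scale_pos m k
  exact mem_ball_self (by positivity)

theorem tendsto_one_div_scale [NeZero m] : Tendsto (fun k => 1 / scale m k) atTop (𝓝 0) := by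
  simp only [scale, one_div]
  exact (tendsto_pow_atTop_atTop_of_one_lt one_lt_base).inv_tendsto_atTop

theorem dist_le_of_mem_closedCell {x y : Fin n → ℝ} {Z : Fin n → ℤ} (hx : x ∈ closedCell m k Z)
    (hy : y ∈ closedCell m k Z) : dist x y ≤ 1 / scale m k := by
  have hsc := scale_pos m k
  rw [dist_pi_le_iff (by positivity)]
  intro q
  rw [Real.dist_eq, abs_sub_le_iff, le_div_iff₀ hsc, le_div_iff₀ hsc]
  obtain ⟨h1, h2⟩ := hx q
  obtain ⟨h3, h4⟩ := hy q
  constructor <;> nlinarith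

theorem closedCell_zero_eq_Icc : closedCell m 0 0 = Icc (0 : Fin n → ℝ) 1 := by
  ext x
  simp [closedCell, scale_zero, Pi.le_def, forall_and]

variable [NeZero n] {X : Type*} {ψ : (Fin n → ℝ) → X} {k : ℕ} {i j : Fin m}

theorem sgn_zero (hi : (i : ℕ) ≠ 0) (Z : Fin n → ℤ) : sgn 0 i Z = 0 := by simp [sgn, hi]

theorem par_zero (hi : (i : ℕ) ≠ 0) (Z : Fin n → ℤ) : par 0 i Z = Z := by
  rw [par, sgn_zero hi, add_zero, Function.update_eq_self]

theorem box_zero (hi : (i : ℕ) ≠ 0) (Z : Fin n → ℤ) : box 0 i Z = openCell m 1 (vtx i Z) := by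
  ext x
  rw [mem_box, lo, Wada.hi, par_zero hi, inf_idem, sup_idem]
  rfl

variable (ψ) in
theorem mem_compl_lakes_iff (hn : 3 ≤ n) (hψ : Function.Injective ψ) {J : Set (Fin m)}
    (hi : i ∉ J) {Z : Fin n → ℤ} (hZ : Z ∈ gap m k) {x : Fin n → ℝ} (hx : x ∈ box k i Z) :
    ψ x ∈ (⋃ j : Fin m, lake ψ j k)ᶜ \ ⋃ j ∈ J, ⋃ Z ∈ gap m k, ψ '' box k j Z ↔
      ψ x ∉ lake ψ i k := by
  constructor
  · exact fun h h' => h.1 (mem_iUnion.2 ⟨i, h'⟩)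
  · intro h
    have hmem : ψ x ∈ lake ψ i (k + 1) := image_box_subset_lake hZ ⟨x, hx, rfl⟩
    have hdisj : ∀ j, j ≠ i → ψ x ∉ lake ψ j (k + 1) := fun j hj =>
      Set.disjoint_left.1 (disjoint_lake hn hψ hj.symm) hmem
    refine ⟨fun h' => ?_, fun h' => ?_⟩
    · obtain ⟨j, hj⟩ := mem_iUnion.1 h'
      by_cases hji : j = i
      · exact h (hji ▸ hj)
      · exact hdisj j hji (lake_mono ψ j k.le_succ hj)
    · simp only [mem_iUnion] at h'
      obtain ⟨j, hj, hj'⟩ := h'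
      refine hdisj j (fun e => hi (e ▸ hj)) (Or.inr ?_)
      simpa only [mem_iUnion] using hj'

theorem isPreconnected_diff_cube [TopologicalSpace X] [T2Space X] (hn : 3 ≤ n)
    (hψ : IsOpenEmbedding ψ) {G : Set X} (hGc : IsClosed G) (hG : IsPreconnected G)
    {c : Fin n → ℝ} {ρ : ℝ} (hρ : 0 < ρ) (hb : ψ '' ball c ρ ⊆ G) :
    IsPreconnected (G \ ψ '' ball c ρ) := by
  have hcl : ψ '' closedBall c ρ ⊆ G := by
    rw [← closure_ball c hρ.ne']
    exact (image_closure_subset_closure_image hψ.continuous).trans (closure_minimal hb hGc)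
  have hdiff : ψ '' closedBall c ρ \ ψ '' ball c ρ = ψ '' sphere c ρ := by
    rw [← image_sdiff hψ.injective, closedBall_sdiff_ball]
  have : Nontrivial (Fin n → ℝ) := Function.nontrivial
  apply isPreconnected_diff_of_collar (H := ψ '' closedBall c ρ) hGc hG
    (hψ.isOpenMap _ isOpen_ball) ((isCompact_closedBall c ρ).image hψ.continuous).isClosed hcl
  · exact inter_subset_right.trans (image_mono ball_subset_closedBall)
  · rw [hdiff]
    refine (isPreconnected_sphere ?_ c ρ).image _ hψ.continuous.continuousOn
    rw [rank_fin_fun]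
    exact_mod_cast (by omega : 1 < n)
  · rw [hdiff]
    exact (NormedSpace.sphere_nonempty.2 hρ.le).image ψ

theorem isClosed_compl_lakes [TopologicalSpace X] [T2Space X] (hψ : IsOpenEmbedding ψ) :
    IsClosed (⋃ j : Fin m, lake ψ j k)ᶜ :=
  (isOpen_iUnion fun j => isOpen_lake hψ j k).isClosed_compl

theorem compl_lakes_zero (hm : 0 < m) :
    (⋃ j : Fin m, lake ψ j 0)ᶜ = ψ '' closedCell m 0 0 := by
  apply subset_antisymm
  · intro p hp
    by_contra h
    exact hp (mem_iUnion.2 ⟨⟨0, hm⟩, rfl, h⟩)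
  · intro p hp h
    obtain ⟨j, hj⟩ := mem_iUnion.1 h
    exact hj.2 hp

theorem isPreconnected_compl_lakes [TopologicalSpace X] [T2Space X] (hn : 3 ≤ n) (hm : 0 < m)
    (hψ : IsOpenEmbedding ψ) (k : ℕ) : IsPreconnected (⋃ j : Fin m, lake ψ j k)ᶜ := by
  classical
  induction k with
  | zero =>
    rw [compl_lakes_zero hm]
    refine IsPreconnected.image (Convex.isPreconnected ?_) _ hψ.continuous.continuousOn
    rw [closedCell_zero_eq_Icc]
    exact convex_Icc _ _
  | succ k ih =>
    have key : ∀ J : Finset (Fin m), IsPreconnected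
        ((⋃ j : Fin m, lake ψ j k)ᶜ \ ⋃ j ∈ (J : Set (Fin m)), ⋃ Z ∈ gap m k, ψ '' box k j Z) := by
      intro J
      induction J using Finset.induction_on with
      | empty => simpa using ih
      | insert i J hi ihJ =>
        have hi' : i ∉ (J : Set (Fin m)) := hi
        rw [Finset.coe_insert, biUnion_insert, union_comm, ← Set.sdiff_sdiff]
        have hcl : IsClosed ((⋃ j : Fin m, lake ψ j k)ᶜ \
            ⋃ j ∈ (J : Set (Fin m)), ⋃ Z ∈ gap m k, ψ '' box k j Z) :=
          (isClosed_compl_lakes hψ).sdiff (isOpen_biUnion fun j _ => isOpen_biUnion fun Z _ =>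
            hψ.isOpenMap _ (isOpen_box _ _ _))
        by_cases hki : k ≠ 0 ∨ (i : ℕ) = 0
        · exact isPreconnected_diff_boxes hn hψ hki hcl ihJ fun Z hZ x hx =>
            mem_compl_lakes_iff ψ hn hψ.injective hi' hZ hx
        · push Not at hki
          obtain ⟨rfl, hi0⟩ := hki
          have hb : ⋃ Z ∈ gap m 0, ψ '' box 0 i Z = ψ '' openCell m 1 (vtx i 0) := by
            rw [← box_zero hi0]
            simp [gap]
          rw [hb, openCell_eq_ball]
          have := scale_pos m 1
          refine isPreconnected_diff_cube hn hψ hcl ihJ (by positivity) ?_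
          rw [← openCell_eq_ball, ← box_zero hi0]
          rintro _ ⟨x, hx, rfl⟩
          rw [mem_compl_lakes_iff ψ hn hψ.injective hi' rfl hx]
          exact fun h => hi0 h.1
    have h := key Finset.univ
    convert h using 1
    rw [sdiff_eq, ← compl_union]
    congr 1
    simp [lake, iUnion_union_distrib]

end Lakes

section Lakes

open Topology Filter

variable {n m : ℕ} [NeZero n] {X : Type*} {ψ : (Fin n → ℝ) → X} {k : ℕ} {i j : Fin m}

/-- The `i`-th lake. -/
def wadaLake (ψ : (Fin n → ℝ) → X) (i : Fin m) : Set X := ⋃ k, lake ψ i k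

theorem disjoint_wadaLake (hn : 3 ≤ n) (hψ : Function.Injective ψ) (hij : i ≠ j) :
    Disjoint (wadaLake ψ i) (wadaLake ψ j) := by
  rw [Set.disjoint_left]
  intro p hi hj
  obtain ⟨k, hk⟩ := mem_iUnion.1 hi
  obtain ⟨l, hl⟩ := mem_iUnion.1 hj
  exact Set.disjoint_left.1 (disjoint_lake (k := max k l) hn hψ hij)
    (lake_mono ψ i (le_max_left _ _) hk) (lake_mono ψ j (le_max_right _ _) hl)

theorem wadaLake_nonempty (i : Fin m) : (wadaLake ψ i).Nonempty := by
  refine ⟨ψ (center m 1 (vtx i 0)),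
    mem_iUnion.2 ⟨1, image_box_subset_lake (k := 0) (Z := 0) rfl ?_⟩⟩
  exact mem_image_of_mem _ (openCell_subset_box (vtx_mem_chain _ _ _) (center_mem_openCell _ _))

theorem isOpen_wadaLake [TopologicalSpace X] [T2Space X] (hψ : IsOpenEmbedding ψ) (i : Fin m) :
    IsOpen (wadaLake ψ i) := isOpen_iUnion fun _ => isOpen_lake hψ _ _

theorem compl_wadaLakes :
    (⋃ i : Fin m, wadaLake ψ i)ᶜ = ⋂ k, (⋃ i : Fin m, lake ψ i k)ᶜ := by
  simp only [wadaLake]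
  rw [iUnion_comm, compl_iUnion]

theorem isPreconnected_compl_wadaLakes [TopologicalSpace X] [CompactSpace X] [T2Space X]
    (hn : 3 ≤ n) (hm : 0 < m) (hψ : IsOpenEmbedding ψ) :
    IsPreconnected (⋃ i : Fin m, wadaLake ψ i)ᶜ := by
  rw [compl_wadaLakes]
  refine isPreconnected_iInter_of_antitone (fun k l h => ?_) (fun k => isClosed_compl_lakes hψ)
    (isPreconnected_compl_lakes hn hm hψ)
  exact compl_subset_compl.2 (iUnion_mono fun i => lake_mono ψ i h)

theorem compl_wadaLakes_subset_closure [TopologicalSpace X] [NeZero m]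
    (hψ : IsOpenEmbedding ψ) (j : Fin m) :
    (⋃ i : Fin m, wadaLake ψ i)ᶜ ⊆ closure (wadaLake ψ j) := by
  intro p hp
  have hp' : ∀ k, ∃ Z ∈ gap m k, p ∈ ψ '' closedCell m k Z := fun k =>
    exists_closedCell k (Nat.pos_of_ne_zero (NeZero.ne m)) fun i h =>
      hp (mem_iUnion.2 ⟨i, mem_iUnion.2 ⟨k, h⟩⟩)
  obtain ⟨_, _, x, -, rfl⟩ := hp' 0
  choose Z hZ h using hp'
  have hx : ∀ k, x ∈ closedCell m k (Z k) := fun k => by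
    obtain ⟨y, hy, e⟩ := h k
    exact hψ.injective e ▸ hy
  have hlim : Tendsto (fun k => center m (k + 1) (vtx j (Z k))) atTop (𝓝 x) := by
    refine tendsto_iff_dist_tendsto_zero.2 (squeeze_zero (fun _ => dist_nonneg) (fun k => ?_)
      (tendsto_one_div_scale (m := m)))
    refine dist_le_of_mem_closedCell (Z := Z k) (openCell_subset_closedCell _ _ ?_) (hx k)
    have := openCell_subset_up k _ (center_mem_openCell (m := m) (k + 1) (vtx j (Z k)))
    rwa [up_vtx] at this
  refine mem_closure_of_tendsto ((hψ.continuous.tendsto x).comp hlim) (Eventually.of_forall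
    fun k => mem_iUnion.2 ⟨k + 1, image_box_subset_lake (hZ k) (mem_image_of_mem _ ?_)⟩)
  exact openCell_subset_box (vtx_mem_chain _ _ _) (center_mem_openCell _ _)

theorem frontier_wadaLake [TopologicalSpace X] [T2Space X] [NeZero m] (hn : 3 ≤ n)
    (hψ : IsOpenEmbedding ψ) (j : Fin m) :
    frontier (wadaLake ψ j) = (⋃ i : Fin m, wadaLake ψ i)ᶜ := by
  rw [(isOpen_wadaLake hψ j).frontier_eq]
  apply subset_antisymm
  · rintro p ⟨hp, hpj⟩ h
    obtain ⟨i, hi⟩ := mem_iUnion.1 h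
    have hij : i ≠ j := fun e => hpj (e ▸ hi)
    have := (disjoint_wadaLake hn hψ.injective hij).closure_right (isOpen_wadaLake hψ i)
    exact Set.disjoint_left.1 this hi hp
  · exact fun p hp => ⟨compl_wadaLakes_subset_closure hψ j hp,
      fun h => hp (mem_iUnion.2 ⟨j, h⟩)⟩

theorem compl_wadaLakes_nonempty [TopologicalSpace X] [T2Space X] [PreconnectedSpace X]
    (hn : 3 ≤ n) (hm : 1 < m) (hψ : IsOpenEmbedding ψ) :
    (⋃ i : Fin m, wadaLake ψ i)ᶜ.Nonempty := by
  have : NeZero m := ⟨by omega⟩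
  rw [nonempty_iff_ne_empty]
  intro h
  have hij : (⟨0, by omega⟩ : Fin m) ≠ ⟨1, hm⟩ := by simp
  have hf := frontier_wadaLake hn hψ (⟨0, by omega⟩ : Fin m)
  rw [h, ← isClopen_iff_frontier_eq_empty, isClopen_iff] at hf
  rcases hf with hf | hf
  · exact (wadaLake_nonempty _).ne_empty hf
  · obtain ⟨p, hp⟩ := wadaLake_nonempty (ψ := ψ) (⟨1, hm⟩ : Fin m)
    exact Set.disjoint_left.1 (disjoint_wadaLake hn hψ.injective hij) (hf ▸ mem_univ p) hp

theorem wadaLake_zero_homeomorph [TopologicalSpace X] [T2Space X] [LocallyCompactSpace X]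
    [SecondCountableTopology X] (hn : 3 ≤ n) (hψ : IsOpenEmbedding ψ) (hi : (i : ℕ) = 0) :
    Nonempty (wadaLake ψ i ≃ₜ ((ψ '' closedCell m 0 0)ᶜ : Set X)) := by
  obtain ⟨e⟩ := Expands.nonempty_homeomorph_iUnion (fun k => isOpen_lake hψ i k)
    fun k => lake_expands hn hψ (Or.inr hi)
  refine ⟨e.symm.trans (Homeomorph.setCongr ?_)⟩
  ext p
  simp [lake, hi]

theorem wadaLake_homeomorph_ball [TopologicalSpace X] [T2Space X] [LocallyCompactSpace X]
    [SecondCountableTopology X] (hn : 3 ≤ n) (hψ : IsOpenEmbedding ψ) (hi : (i : ℕ) ≠ 0) :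
    Nonempty (wadaLake ψ i ≃ₜ (Fin n → ℝ)) := by
  obtain ⟨e⟩ := Expands.nonempty_homeomorph_iUnion (fun k => isOpen_lake hψ i (k + 1))
    fun k => lake_expands (i := i) hn hψ (Or.inl k.succ_ne_zero)
  have h1 : ⋃ k, lake ψ i (k + 1) = wadaLake ψ i :=
    (lake_mono ψ i).iSup_nat_add 1
  have h2 : lake ψ i (0 + 1) = ψ '' ball (center m 1 (vtx i 0)) (1 / 2 / scale m 1) := by
    rw [← openCell_eq_ball, ← box_zero hi]
    simp [lake, hi, gap]
  have hsc := scale_pos m 1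
  have hball : Nonempty (ball (center (n := n) m 1 (vtx i 0)) (1 / 2 / scale m 1) ≃ₜ
      (Fin n → ℝ)) := by
    let g := OpenPartialHomeomorph.univBall (center (n := n) m 1 (vtx i 0)) (1 / 2 / scale m 1)
    have hg : g.target = ball (center (n := n) m 1 (vtx i 0)) (1 / 2 / scale m 1) :=
      OpenPartialHomeomorph.univBall_target _ (by positivity)
    have hg' : g.source = univ := OpenPartialHomeomorph.univBall_source _ _
    exact ⟨(Homeomorph.setCongr hg.symm).trans <| g.toHomeomorphSourceTarget.symm.trans <|
      (Homeomorph.setCongr hg').trans (Homeomorph.Set.univ _)⟩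
  obtain ⟨f⟩ := hball
  exact ⟨(Homeomorph.setCongr h1.symm).trans <| e.symm.trans <| (Homeomorph.setCongr h2).trans <|
    (hψ.isEmbedding.homeomorphImage _).symm.trans f⟩

end Lakes

section Carrot

open NNReal ENNReal

variable {E : Type*} [MetricSpace E] {C C' κ κ' : ℝ} {M M' : Set E} {o p q : E}

/-- A point `p` can be joined to the centre `o` inside `M` by a curve along which the distance to
the complement of `M` grows at least linearly, starting from the length `κ`. -/
def Carrot (C κ : ℝ) (M : Set E) (o p : E) : Prop :=
  ∃ T : ℝ, 0 ≤ T ∧ ∃ γ : ℝ → E, (∀ s ∈ Icc 0 T, ∀ t ∈ Icc s T, dist (γ s) (γ t) ≤ t - s) ∧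
    γ 0 = p ∧ γ T = o ∧ ∀ t ∈ Icc 0 T, γ t ∈ M ∧ κ + t ≤ C * infDist (γ t) Mᶜ

theorem Carrot.mono (h : Carrot C κ M o p) (hC : C ≤ C') (hκ : κ' ≤ κ) :
    Carrot C' κ' M o p := by
  obtain ⟨T, hT, γ, h1, h2, h3, h4⟩ := h
  refine ⟨T, hT, γ, h1, h2, h3, fun t ht => ⟨(h4 t ht).1, ?_⟩⟩
  have := mul_le_mul_of_nonneg_right hC (infDist_nonneg (x := γ t) (s := Mᶜ))
  linarith [(h4 t ht).2]

theorem Carrot.mono_set (h : Carrot C κ M o p) (hC : 0 ≤ C) (hM : M ⊆ M') (hM' : M' ≠ univ) :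
    Carrot C κ M' o p := by
  obtain ⟨T, hT, γ, h1, h2, h3, h4⟩ := h
  refine ⟨T, hT, γ, h1, h2, h3, fun t ht => ⟨hM (h4 t ht).1, ?_⟩⟩
  have := mul_le_mul_of_nonneg_left (infDist_le_infDist_of_subset (x := γ t)
    (compl_subset_compl.2 hM) (nonempty_compl.2 hM')) hC
  linarith [(h4 t ht).2]

theorem dist_concat_le {f g : ℝ → E} {a T : ℝ} (ha : a ≤ T)
    (hf : ∀ s ∈ Icc 0 a, ∀ t ∈ Icc s a, dist (f s) (f t) ≤ t - s)
    (hg : ∀ s ∈ Icc a T, ∀ t ∈ Icc s T, dist (g s) (g t) ≤ t - s) (hfg : f a = g a) :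
    ∀ s ∈ Icc 0 T, ∀ t ∈ Icc s T,
      dist (if s ≤ a then f s else g s) (if t ≤ a then f t else g t) ≤ t - s := by
  intro s hs t ht
  by_cases h1 : t ≤ a
  · rw [if_pos h1, if_pos (ht.1.trans h1)]
    exact hf s ⟨hs.1, ht.1.trans h1⟩ t ⟨ht.1, h1⟩
  · rw [if_neg h1]
    push Not at h1
    split_ifs with h2
    · have e1 := hf s ⟨hs.1, h2⟩ a ⟨h2, le_rfl⟩
      have e2 := hg a ⟨le_rfl, ha⟩ t ⟨h1.le, ht.2⟩
      rw [← hfg] at e2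
      linarith [dist_triangle (f s) (f a) (g t)]
    · exact hg s ⟨(not_le.1 h2).le, hs.2⟩ t ht

theorem Carrot.prepend (h : Carrot C κ' M o q) {a : ℝ} (ha : 0 ≤ a) (hκ : κ + a ≤ κ')
    {σ : ℝ → E} (hσ : ∀ s ∈ Icc 0 a, ∀ t ∈ Icc s a, dist (σ s) (σ t) ≤ t - s)
    (h0 : σ 0 = p) (h1 : σ a = q)
    (hM : ∀ t ∈ Icc 0 a, σ t ∈ M ∧ κ + t ≤ C * infDist (σ t) Mᶜ) : Carrot C κ M o p := by
  obtain ⟨T, hT, γ, g1, g2, g3, g4⟩ := h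
  refine ⟨a + T, by positivity, fun t => if t ≤ a then σ t else γ (t - a),
    dist_concat_le (g := fun t => γ (t - a)) (by linarith) hσ ?_ (by simp [h1, g2]),
    by simp [ha, h0], ?_, ?_⟩
  · intro s hs t ht
    have := g1 (s - a) ⟨by linarith [hs.1], by linarith [hs.2]⟩ (t - a)
      ⟨by linarith [ht.1], by linarith [ht.2]⟩
    linarith
  · simp only
    split_ifs with h
    · have : T = 0 := by linarith
      rw [this, add_zero, h1, ← g2, ← g3, this]
    · simpa using g3
  · intro t ht
    simp only
    split_ifs with h
    · exact hM t ⟨ht.1, h⟩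
    · obtain ⟨e1, e2⟩ := g4 (t - a) ⟨by linarith, by linarith [ht.2]⟩
      exact ⟨e1, by linarith⟩

theorem eVariationOn_Icc_le {f : ℝ → E} {K a b : ℝ} (hab : a ≤ b) (hK : 0 ≤ K)
    (hf : ∀ s ∈ Icc a b, ∀ t ∈ Icc s b, dist (f s) (f t) ≤ K * (t - s)) :
    eVariationOn f (Icc a b) ≤ ENNReal.ofReal (K * (b - a)) := by
  have hL : LipschitzOnWith K.toNNReal f (Icc a b) := by
    refine LipschitzOnWith.of_dist_le_mul fun s hs t ht => ?_
    rw [Real.coe_toNNReal K hK, Real.dist_eq]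
    rcases le_total s t with h | h
    · rw [abs_sub_comm, abs_of_nonneg (sub_nonneg.2 h)]
      exact hf s hs t ⟨h, ht.2⟩
    · rw [dist_comm, abs_of_nonneg (sub_nonneg.2 h)]
      exact hf t ht s ⟨h, hs.2⟩
  have h1 := hL.comp_eVariationOn_le (g := id) (mapsTo_id (Icc a b))
  have h2 := (monotone_id.monotoneOn (Icc a b)).eVariationOn_eq (left_mem_Icc.2 hab)
    (right_mem_Icc.2 hab)
  rw [inter_self] at h2
  refine h1.trans ((mul_le_mul_right h2.le _).trans ?_)
  rw [ENNReal.ofReal_mul hK]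
  rfl

theorem isJohnDomain_of_carrot (hM : IsOpen M) (hM' : IsConnected M) (hu : M ≠ univ)
    (h : ∀ p ∈ M, Carrot C 0 M o p) : IsJohnDomain C M := by
  refine ⟨hM, hM', hu, fun a ha b hb => ?_⟩
  obtain ⟨A, hA, f, f1, f2, f3, f4⟩ := h a ha
  obtain ⟨B, hB, g, g1, g2, g3, g4⟩ := h b hb
  have hG := dist_concat_le (f := f) (g := fun t => g (A + B - t)) (a := A) (T := A + B)
    (by linarith) f1 (fun s hs t ht => by
      have := g1 (A + B - t) ⟨by linarith [ht.2], by linarith [ht.1, hs.1]⟩ (A + B - s)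
        ⟨by linarith [ht.1], by linarith [hs.1]⟩
      rw [dist_comm] at this
      linarith) (by simp [f3, g3])
  set G : ℝ → E := fun s => if s ≤ A then f s else g (A + B - s) with hGdef
  have hT : 0 ≤ A + B := by positivity
  have hmem : ∀ t ∈ Icc (0 : ℝ) 1, (A + B) * t ∈ Icc 0 (A + B) := fun t ht =>
    ⟨mul_nonneg hT ht.1, mul_le_of_le_one_right hT ht.2⟩
  have hΓ : ∀ s ∈ Icc (0 : ℝ) 1, ∀ t ∈ Icc s 1,
      dist (G ((A + B) * s)) (G ((A + B) * t)) ≤ (A + B) * (t - s) := by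
    intro s hs t ht
    rw [mul_sub]
    exact hG _ (hmem s hs) _ ⟨mul_le_mul_of_nonneg_left ht.1 hT,
      (hmem t ⟨hs.1.trans ht.1, ht.2⟩).2⟩
  have hvar : ∀ s ∈ Icc (0 : ℝ) 1, ∀ t ∈ Icc s 1,
      eVariationOn (fun t => G ((A + B) * t)) (Icc s t) ≤ ENNReal.ofReal ((A + B) * (t - s)) :=
    fun s hs t ht => eVariationOn_Icc_le ht.1 hT fun x hx y hy =>
      hΓ x ⟨hs.1.trans hx.1, hx.2.trans ht.2⟩ y ⟨hy.1, hy.2.trans ht.2⟩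
  have hin : ∀ t ∈ Icc (0 : ℝ) 1, G ((A + B) * t) ∈ M := by
    intro t ht
    obtain ⟨h1, h2⟩ := hmem t ht
    simp only [hGdef]
    split_ifs with h
    · exact (f4 _ ⟨h1, h⟩).1
    · exact (g4 _ ⟨by linarith, by linarith⟩).1
  refine ⟨fun t => G ((A + B) * t), ?_, ?_, ?_, hin, ?_, ?_⟩
  · have : LipschitzOnWith (A + B).toNNReal (fun t => G ((A + B) * t)) (Icc 0 1) := by
      refine LipschitzOnWith.of_dist_le_mul fun s hs t ht => ?_
      rw [Real.coe_toNNReal _ hT, Real.dist_eq]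
      rcases le_total s t with h | h
      · rw [abs_sub_comm, abs_of_nonneg (sub_nonneg.2 h)]
        exact hΓ s hs t ⟨h, ht.2⟩
      · rw [dist_comm, abs_of_nonneg (sub_nonneg.2 h)]
        exact hΓ t ht s ⟨h, hs.2⟩
    exact this.continuousOn
  · simp [hGdef, hA, f2]
  · simp only [hGdef, mul_one]
    split_ifs with h
    · have : B = 0 := by linarith
      rw [this, add_zero, f3, ← g3, this, g2]
    · simpa using g2
  · exact ne_top_of_le_ne_top ENNReal.ofReal_ne_top
      (hvar 0 (left_mem_Icc.2 zero_le_one) 1 (right_mem_Icc.2 zero_le_one))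
  · intro t ht
    obtain ⟨h1, h2⟩ := hmem t ht
    by_cases h : (A + B) * t ≤ A
    · refine (min_le_left _ _).trans ((hvar 0 (left_mem_Icc.2 zero_le_one) t ht).trans
        (ENNReal.ofReal_le_ofReal ?_))
      have := (f4 _ ⟨h1, h⟩).2
      simp only [hGdef, if_pos h]
      linarith
    · refine (min_le_right _ _).trans ((hvar t ht 1 (right_mem_Icc.2 ht.2)).trans
        (ENNReal.ofReal_le_ofReal ?_))
      have := (g4 (A + B - (A + B) * t) ⟨by linarith, by linarith⟩).2
      simp only [hGdef, if_neg h]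
      linarith

/-- A point joined to the centre inside an open set has a curve of any starting length. -/
theorem Carrot.exists_of_isOpen (h : Carrot C κ M o p) (hM : IsOpen M) (hu : M ≠ univ) (κ' : ℝ) :
    ∃ C', Carrot C' κ' M o p := by
  obtain ⟨T, hT, γ, h1, h2, h3, h4⟩ := h
  have hc : ContinuousOn γ (Icc 0 T) := by
    have : LipschitzOnWith 1 γ (Icc 0 T) := by
      refine LipschitzOnWith.of_dist_le_mul fun s hs t ht => ?_
      rw [NNReal.coe_one, one_mul, Real.dist_eq]
      rcases le_total s t with h | h
      · rw [abs_sub_comm, abs_of_nonneg (sub_nonneg.2 h)]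
        exact h1 s hs t ⟨h, ht.2⟩
      · rw [dist_comm, abs_of_nonneg (sub_nonneg.2 h)]
        exact h1 t ht s ⟨h, hs.2⟩
    exact this.continuousOn
  obtain ⟨t₀, ht₀, hmin⟩ := isCompact_Icc.exists_isMinOn (nonempty_Icc.2 hT)
    ((continuous_infDist_pt Mᶜ).comp_continuousOn hc)
  have hpos : 0 < infDist (γ t₀) Mᶜ :=
    (hM.isClosed_compl.notMem_iff_infDist_pos (nonempty_compl.2 hu)).1
      fun h => h (h4 t₀ ht₀).1
  refine ⟨(|κ'| + T) / infDist (γ t₀) Mᶜ, T, hT, γ, h1, h2, h3,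
    fun t ht => ⟨(h4 t ht).1, ?_⟩⟩
  have h5 : infDist (γ t₀) Mᶜ ≤ infDist (γ t) Mᶜ := hmin ht
  calc κ' + t ≤ |κ'| + T := add_le_add (le_abs_self _) ht.2
    _ = (|κ'| + T) / infDist (γ t₀) Mᶜ * infDist (γ t₀) Mᶜ := by field_simp
    _ ≤ _ := by gcongr

end Carrot

section LakeCarrot

open Topology

variable {n m : ℕ} {E : Type*} [MetricSpace E]

/-- A chart which is Lipschitz and quantitatively open near the unit cube. -/
structure IsChart (L c : ℝ) (ψ : (Fin n → ℝ) → E) : Prop where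
  isOpenEmbedding : IsOpenEmbedding ψ
  lipschitz_pos : 0 < L
  open_pos : 0 < c
  dist_le : ∀ u v, dist (ψ u) (ψ v) ≤ L * dist u v
  ball_subset : ∀ u : Fin n → ℝ, (∀ q, u q ∈ Icc (-1 : ℝ) 2) → ∀ r : ℝ, 0 < r → r ≤ 1 →
    ball (ψ u) (c * r) ⊆ ψ '' ball u r

variable {L c C κ κ' : ℝ} {ψ : (Fin n → ℝ) → E} {M : Set E} {o p : E} {u v : Fin n → ℝ}

theorem IsChart.le_infDist (hψ : IsChart L c ψ) (hu : ∀ q, u q ∈ Icc (-1 : ℝ) 2) {r : ℝ}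
    (hr : r ≤ 1) (hM : M ≠ univ) (h : ψ '' ball u r ⊆ M) : c * r ≤ infDist (ψ u) Mᶜ := by
  rcases le_or_gt r 0 with h0 | h0
  · exact (mul_nonpos_of_nonneg_of_nonpos hψ.open_pos.le h0).trans infDist_nonneg
  · refine (Metric.le_infDist (nonempty_compl.2 hM)).2 fun y hy => ?_
    by_contra! hlt
    exact hy (h (hψ.ball_subset u hu r h0 hr (mem_ball'.2 hlt)))

theorem ball_lineMap_subset {F : Type*} [NormedAddCommGroup F] [NormedSpace ℝ F] {B : Set F}
    (hB : Convex ℝ B) {u v : F} {a b τ : ℝ} (hu : u ∈ B) (hv : v ∈ B) (ha : 0 ≤ a) (hb : 0 ≤ b)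
    (hua : ball u a ⊆ B) (hvb : ball v b ⊆ B) (hτ : τ ∈ Icc (0 : ℝ) 1) :
    ball (AffineMap.lineMap u v τ) ((1 - τ) * a + τ * b) ⊆ B := by
  intro z hz
  obtain ⟨r, hr⟩ : ∃ r, r = (1 - τ) * a + τ * b := ⟨_, rfl⟩
  rw [← hr, mem_ball, dist_eq_norm] at hz
  set e := z - AffineMap.lineMap u v τ with he
  have hr0 : 0 < r := (norm_nonneg _).trans_lt hz
  have key : ∀ w ∈ B, ∀ a, 0 ≤ a → ball w a ⊆ B → w + (a / r) • e ∈ B := by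
    intro w hw a ha hwa
    rcases ha.eq_or_lt with rfl | ha
    · simpa using hw
    · apply hwa
      rw [mem_ball, dist_eq_norm, add_sub_cancel_left, norm_smul,
        Real.norm_of_nonneg (by positivity)]
      calc a / r * ‖e‖ < a / r * r := by gcongr
        _ = a := by field_simp
  have h := hB (key u hu a ha hua) (key v hv b hb hvb) (sub_nonneg.2 hτ.2) hτ.1 (by ring)
  have e1 : (1 - τ) • (u + (a / r) • e) + τ • (v + (b / r) • e) = z := by
    have : (1 - τ) * (a / r) + τ * (b / r) = 1 := by
      field_simp
      exact hr.symm
    have h2 : (1 - τ) • (u + (a / r) • e) + τ • (v + (b / r) • e) =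
        ((1 - τ) • u + τ • v) + ((1 - τ) * (a / r) + τ * (b / r)) • e := by
      module
    rw [h2, this, one_smul, ← AffineMap.lineMap_apply_module, he]
    abel
  rwa [e1] at h

theorem IsChart.carrot_of_convex (hψ : IsChart L c ψ) {B : Set (Fin n → ℝ)} (hB : Convex ℝ B)
    (hBI : ∀ x ∈ B, ∀ q, x q ∈ Icc (-1 : ℝ) 2) (hBM : ψ '' B ⊆ M) (hM : M ≠ univ)
    {ρ₀ ρ a : ℝ} (hu : u ∈ B) (hv : v ∈ B) (hu₀ : ball u ρ₀ ⊆ B) (hvρ : ball v ρ ⊆ B)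
    (hρ₀ : 0 ≤ ρ₀) (hρ₀' : ρ₀ ≤ 1) (hρ : 0 ≤ ρ) (hρ' : ρ ≤ 1) (ha : 0 < a)
    (hdist : L * dist u v ≤ a) (hC : 0 ≤ C) (h₀ : κ ≤ C * (c * ρ₀)) (h₁ : κ + a ≤ C * (c * ρ))
    (hκ : κ + a ≤ κ') (h : Carrot C κ' M o (ψ v)) : Carrot C κ M o (ψ u) := by
  have hmem : ∀ t ∈ Icc 0 a, t / a ∈ Icc (0 : ℝ) 1 := fun t ht =>
    ⟨div_nonneg ht.1 ha.le, div_le_one_of_le₀ ht.2 ha.le⟩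
  refine h.prepend ha.le hκ (σ := fun t => ψ (AffineMap.lineMap u v (t / a))) ?_ (by simp)
    (by simp [ha.ne']) fun t ht => ?_
  · intro s hs t ht
    refine (hψ.dist_le _ _).trans ?_
    rw [dist_lineMap_lineMap, Real.dist_eq, ← sub_div, abs_div, abs_of_pos ha, abs_sub_comm,
      abs_of_nonneg (sub_nonneg.2 ht.1)]
    calc L * ((t - s) / a * dist u v) = (t - s) / a * (L * dist u v) := by ring
      _ ≤ (t - s) / a * a := by
        have := sub_nonneg.2 ht.1
        gcongr
      _ = t - s := by field_simp
  · have hτ := hmem t ht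
    have hseg : AffineMap.lineMap u v (t / a) ∈ B :=
      hB.segment_subset hu hv (by rw [segment_eq_image_lineMap]; exact mem_image_of_mem _ hτ)
    refine ⟨hBM (mem_image_of_mem _ hseg), ?_⟩
    have h1 := hψ.le_infDist (hBI _ hseg) (M := M) (r := (1 - t / a) * ρ₀ + t / a * ρ)
      (by nlinarith [hτ.1, hτ.2]) hM
      ((image_mono (ball_lineMap_subset hB hu hv hρ₀ hρ hu₀ hvρ hτ)).trans hBM)
    calc κ + t = (1 - t / a) * κ + t / a * (κ + a) := by field_simp; ring
      _ ≤ (1 - t / a) * (C * (c * ρ₀)) + t / a * (C * (c * ρ)) := by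
        have := sub_nonneg.2 hτ.2
        have := hτ.1
        gcongr
      _ = C * (c * ((1 - t / a) * ρ₀ + t / a * ρ)) := by ring
      _ ≤ _ := by gcongr

variable [NeZero n] {k : ℕ} {i : Fin m} {Z : Fin n → ℤ} {x y : Fin n → ℝ}

theorem abs_cellOf_sub_le (hx : x ∈ box k i Z) (q : Fin n) :
    |cellOf m k x q - Z q| ≤ 1 := by
  have h := up_of_mem_chain (cellOf_mem_chain hx)
  rw [up_cellOf] at h
  rcases h with h | h <;> rw [h]
  · simp
  · by_cases hq : q = dirn i Z
    · rw [hq, par_dirn, add_sub_cancel_left]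
      rcases sgn_cases k i Z with h | h | h <;> simp [h]
    · simp [par_of_ne hq]

theorem mem_Icc_of_mem_box (hZ : Z ∈ gap m k) (hx : x ∈ box k i Z) (q : Fin n) :
    x q ∈ Icc (-1 : ℝ) 2 := by
  have hsc := scale_pos m k
  have hsc1 : 1 ≤ scale m k := by
    have := base_pos (m := m)
    exact one_le_pow₀ (by exact_mod_cast this)
  obtain ⟨h1, h2⟩ := gap_bounds hZ q
  have h3 := abs_le.1 (abs_cellOf_sub_le hx q)
  have h4 := Int.floor_le (scale m k * x q)
  have h5 := Int.lt_floor_add_one (scale m k * x q)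
  have h6 : (-1 : ℝ) ≤ ⌊scale m k * x q⌋ := by
    have : -1 ≤ ⌊scale m k * x q⌋ := by
      have := h3.1
      unfold cellOf at this
      omega
    exact_mod_cast this
  have h7 : (⌊scale m k * x q⌋ : ℝ) ≤ scale m k := by
    have : ⌊scale m k * x q⌋ ≤ base m ^ k := by
      have := h3.2
      unfold cellOf at this
      omega
    calc (⌊scale m k * x q⌋ : ℝ) ≤ ((base m ^ k : ℤ) : ℝ) := Int.cast_le.2 this
      _ = scale m k := by simp [scale]
  constructor <;> nlinarith

theorem dist_le_of_mem_box [NeZero m] (hx : x ∈ box k i Z) (hy : y ∈ box k i Z) :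
    dist x y ≤ 2 / scale m k := by
  have hsc := scale_pos m k
  have hb : (1 : ℝ) < base m := one_lt_base
  rw [dist_pi_le_iff (by positivity)]
  intro q
  have h1 : (hi k i Z q : ℝ) ≤ lo k i Z q + base m := by
    have : hi k i Z q ≤ lo k i Z q + base m := by
      have hb := base_pos (m := m)
      simp only [Wada.hi, lo, vtx, Pi.sup_apply, Pi.inf_apply]
      by_cases hq : q = dirn i Z
      · rw [hq, par_dirn]
        rcases sgn_cases k i Z with h | h | h <;> rw [h] <;> simp only [mul_add] <;> omega
      · simp only [par_of_ne hq]
        omega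
    exact_mod_cast this
  rw [mem_box] at hx hy
  obtain ⟨h2, h3⟩ := hx q
  obtain ⟨h4, h5⟩ := hy q
  rw [scale_succ, mul_assoc] at *
  rw [Real.dist_eq, abs_sub_le_iff, le_div_iff₀ hsc, le_div_iff₀ hsc]
  constructor <;> by_contra! h <;> nlinarith

variable (k i Z) in
/-- The centre of the vertex cell at the end of the box joining `Z` to `par k i Z`. -/
noncomputable def target : Fin n → ℝ := center m (k + 1) (vtx i (par k i Z))

theorem ball_target_subset : ball (target k i Z) (1 / 2 / scale m (k + 1)) ⊆ box k i Z := by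
  rw [target, ← openCell_eq_ball]
  exact openCell_subset_box (vtx_par_mem_chain k i Z)

theorem target_mem_box : target k i Z ∈ box k i Z :=
  openCell_subset_box (vtx_par_mem_chain k i Z) (center_mem_openCell _ _)

end LakeCarrot

section LakeCarrot

open Topology

variable {n m : ℕ} {E : Type*} [MetricSpace E] {L c C κ κ' : ℝ}
  {ψ : (Fin n → ℝ) → E} {o : E} {k : ℕ} {i : Fin m} {Z : Fin n → ℤ} {u v : Fin n → ℝ}

theorem ball_center_subset {r : ℝ} (h : r ≤ 1 / 2 / scale m k) (z : Fin n → ℤ) :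
    ball (center m k z) r ⊆ openCell m k z := by
  rw [openCell_eq_ball]
  exact ball_subset_ball h

/-- The starting length used for cells of level `k` and depth `d`. -/
noncomputable def startLength (n m : ℕ) (L : ℝ) (k d : ℕ) : ℝ :=
  2 * L / scale m k * (2 * (n * (2 * m + 1) + 1) - d)

/-- A John constant that suffices for the steps along the boxes. -/
noncomputable def stepConst (n m : ℕ) (L c : ℝ) : ℝ :=
  2 * (2 * L) * (2 * (n * (2 * m + 1) + 1) + 1) * base m ^ 2 / c

theorem IsChart.stepConst_nonneg (hψ : IsChart L c ψ) : 0 ≤ stepConst n m L c := by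
  have hc := hψ.open_pos
  have hL := hψ.lipschitz_pos
  unfold stepConst
  positivity

variable [NeZero m]

theorem IsChart.step_le (hψ : IsChart L c ψ) (hC : stepConst n m L c ≤ C) {j : ℕ}
    (hj : j ≤ k + 2) (hκ : κ ≤ startLength n m L k 0) :
    κ + 2 * L / scale m k ≤ C * (c * (1 / 2 / scale m j)) := by
  have hc := hψ.open_pos
  have hL := hψ.lipschitz_pos
  have hsc := scale_pos m k
  have hscj := scale_pos m j
  have hb : (1 : ℝ) < base m := one_lt_base
  have h1 : scale m j ≤ base m ^ 2 * scale m k := by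
    rw [scale, scale, ← pow_add]
    exact pow_le_pow_right₀ hb.le (by omega)
  have h2 : stepConst n m L c * (c * (1 / 2 / (base m ^ 2 * scale m k))) =
      startLength n m L k 0 + 2 * L / scale m k := by
    unfold stepConst startLength
    field_simp
    push_cast
    ring
  have h3 := hψ.stepConst_nonneg (m := m)
  have h4 := h3.trans hC
  calc κ + 2 * L / scale m k ≤ startLength n m L k 0 + 2 * L / scale m k := by gcongr
    _ = stepConst n m L c * (c * (1 / 2 / (base m ^ 2 * scale m k))) := h2.symm
    _ ≤ _ := by gcongr

theorem half_div_scale_le : 1 / 2 / scale m k ≤ 1 := by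
  have hb : (1 : ℝ) < base m := one_lt_base
  have : 1 ≤ scale m k := one_le_pow₀ hb.le
  rw [div_le_one₀ (scale_pos m k)]
  linarith

variable [NeZero n]

theorem IsChart.carrot_step (hψ : IsChart L c ψ) (hC : stepConst n m L c ≤ C)
    (hne : wadaLake ψ i ≠ univ) (hZ : Z ∈ gap m k) {j j' : ℕ}
    (hj : j ≤ k + 2) (hj' : j' ≤ k + 2)
    (hu : ball u (1 / 2 / scale m j) ⊆ box k i Z) (hv : ball v (1 / 2 / scale m j') ⊆ box k i Z)
    (hκ0 : κ ≤ startLength n m L k 0) (hκ : κ + 2 * L / scale m k ≤ κ')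
    (h : Carrot C κ' (wadaLake ψ i) o (ψ v)) : Carrot C κ (wadaLake ψ i) o (ψ u) := by
  have hL := hψ.lipschitz_pos
  have hsc := scale_pos m k
  have hp : ∀ j, 0 < 1 / 2 / scale m j := fun j => by
    have := scale_pos m j
    positivity
  have hub := hu (mem_ball_self (hp j))
  have hvb := hv (mem_ball_self (hp j'))
  have ha : 0 < 2 * L / scale m k := by positivity
  refine hψ.carrot_of_convex (convex_box k i Z) (fun x hx => mem_Icc_of_mem_box hZ hx)
    ((image_box_subset_lake hZ).trans (subset_iUnion (lake ψ i) (k + 1))) hne hub hvb hu hv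
    (hp j).le half_div_scale_le (hp j').le half_div_scale_le ha ?_
    (hψ.stepConst_nonneg.trans hC) ?_ (hψ.step_le hC hj' hκ0) hκ h
  · calc L * dist u v ≤ L * (2 / scale m k) := by
          gcongr
          exact dist_le_of_mem_box hub hvb
      _ = 2 * L / scale m k := by ring
  · linarith [hψ.step_le (m := m) (n := n) hC hj hκ0]

theorem IsChart.carrot_start (hψ : IsChart L c ψ) (hC : stepConst n m L c ≤ C)
    (hne : wadaLake ψ i ≠ univ) (hZ : Z ∈ gap m k) (hu : u ∈ box k i Z)
    (hκ : 2 * L / scale m k ≤ κ')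
    (h : Carrot C κ' (wadaLake ψ i) o (ψ (target k i Z))) :
    Carrot C 0 (wadaLake ψ i) o (ψ u) := by
  have hL := hψ.lipschitz_pos
  have hsc := scale_pos m k
  have hp : 0 < 1 / 2 / scale m (k + 1) := by
    have := scale_pos m (k + 1)
    positivity
  have ha : 0 < 2 * L / scale m k := by positivity
  refine hψ.carrot_of_convex (ρ₀ := 0) (convex_box k i Z) (fun x hx => mem_Icc_of_mem_box hZ hx)
    ((image_box_subset_lake hZ).trans (subset_iUnion (lake ψ i) (k + 1))) hne hu target_mem_box
    (by simp) ball_target_subset le_rfl zero_le_one hp.le half_div_scale_le ha ?_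
    (hψ.stepConst_nonneg.trans hC) (by simp) (hψ.step_le hC (by omega) ?_) (by simpa using hκ) h
  · calc L * dist u (target k i Z) ≤ L * (2 / scale m k) := by
          gcongr
          exact dist_le_of_mem_box hu target_mem_box
      _ = 2 * L / scale m k := by ring
  · unfold startLength
    have : 0 ≤ 2 * L / scale m k := ha.le
    push_cast
    rw [sub_zero]
    positivity

theorem IsChart.carrot_target (hψ : IsChart L c ψ) (hC : stepConst n m L c ≤ C)
    (hn : 3 ≤ n) (hne : wadaLake ψ i ≠ univ)
    (h₀ : Carrot C (startLength n m L 0 0) (wadaLake ψ i) o (ψ (target 0 i 0)))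
    (hZ : Z ∈ gap m k) :
    Carrot C (startLength n m L k (dep i Z)) (wadaLake ψ i) o (ψ (target k i Z)) := by
  have hL := hψ.lipschitz_pos
  have hb : (2 : ℝ) ≤ base m := by
    have : 0 < m := Nat.pos_of_ne_zero (NeZero.ne m)
    have : (2 : ℤ) ≤ base m := by unfold base; omega
    exact_mod_cast this
  have hanti : ∀ k d, startLength n m L k d ≤ startLength n m L k 0 := by
    intro k d
    have := scale_pos m k
    unfold startLength
    gcongr
    exact d.zero_le
  induction k generalizing Z with
  | zero =>
    obtain rfl : Z = 0 := hZ
    exact h₀.mono le_rfl (hanti _ _)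
  | succ k ih =>
    induction hd : dep i Z using Nat.strong_induction_on generalizing Z with
    | _ d ihd =>
    have hdp := dep_par hZ i
    have hsc := scale_pos m k
    have hsc' := scale_pos m (k + 1)
    rcases par_mem_gap_or_col hn hZ i with hP | hP
    · have h := ihd _ (by omega) hP rfl
      refine hψ.carrot_step hC hne hP (j := k + 2) (j' := k + 2) (by omega) (by omega) ?_
        ball_target_subset (hanti _ _) ?_ h
      · exact (ball_center_subset le_rfl _).trans (openCell_subset_box (vtx_mem_chain _ _ _))
      · rw [← hd, ← hdp]
        unfold startLength
        push_cast
        apply le_of_eq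
        ring
    · rcases hP with hP | ⟨Y, hY, hP⟩
      · rw [up_par hZ i] at hP
        exact absurd hP (not_mem_col_of_mem_gap hZ.1 i)
      · have hE : startLength n m L (k + 1) d + 2 * L / scale m k ≤
            startLength n m L k (dep i Y) := by
          have h1 : (dep i Y : ℝ) ≤ n * (2 * m + 1) := by exact_mod_cast dep_le i Y
          have h2 : startLength n m L (k + 1) d ≤ 2 * L / scale m k * (n * (2 * m + 1) + 1) := by
            refine (hanti _ _).trans ?_
            unfold startLength
            rw [scale_succ, div_mul_eq_mul_div, div_mul_eq_mul_div, div_le_div_iff₀ (by positivity)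
              hsc]
            push_cast
            have : 0 ≤ 2 * L * ((n : ℝ) * (2 * m + 1) + 1) * scale m k := by positivity
            nlinarith
          calc _ ≤ 2 * L / scale m k * (n * (2 * m + 1) + 1) + 2 * L / scale m k := by gcongr
            _ = 2 * L / scale m k * (2 * (n * (2 * m + 1) + 1) - (n * (2 * m + 1))) := by ring
            _ ≤ _ := by
              unfold startLength
              gcongr
        have hstep : 0 ≤ 2 * L / scale m k := by positivity
        refine hψ.carrot_step hC hne hY (j := k + 2) (j' := k + 1) (by omega) (by omega) ?_
          ball_target_subset ?_ hE (ih hY)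
        · refine (ball_center_subset le_rfl _).trans ((openCell_subset_up _ _).trans ?_)
          rw [up_vtx]
          exact openCell_subset_box hP
        · linarith [hanti k (dep i Y)]

theorem IsChart.carrot_wadaLake (hψ : IsChart L c ψ) (hC : stepConst n m L c ≤ C)
    (hn : 3 ≤ n) (hne : wadaLake ψ i ≠ univ)
    (h₀ : Carrot C (startLength n m L 0 0) (wadaLake ψ i) o (ψ (target 0 i 0)))
    (hout : ∀ p ∈ lake ψ i 0, Carrot C 0 (wadaLake ψ i) o p) {p : E} (hp : p ∈ wadaLake ψ i) :
    Carrot C 0 (wadaLake ψ i) o p := by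
  obtain ⟨k, hk⟩ := mem_iUnion.1 hp
  induction k with
  | zero => exact hout p hk
  | succ k ih =>
    rcases hk with hk | hk
    · exact ih hk
    · simp only [mem_iUnion] at hk
      obtain ⟨Z, hZ, u, hu, rfl⟩ := hk
      refine hψ.carrot_start hC hne hZ hu ?_ (hψ.carrot_target hC hn hne h₀ hZ)
      have hL := hψ.lipschitz_pos
      have hsc := scale_pos m k
      have h1 : (dep i Z : ℝ) ≤ n * (2 * m + 1) := by exact_mod_cast dep_le i Z
      have h2 : (0 : ℝ) ≤ n * (2 * m + 1) := by positivity
      unfold startLength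
      apply le_mul_of_one_le_right (by positivity)
      linarith

end LakeCarrot

section Assembly

open Topology

variable {n m : ℕ} [NeZero n] {E : Type*} {L c C : ℝ} {ψ : (Fin n → ℝ) → E}
  {o : E} {i : Fin m}

theorem lake_zero_eq (hi : (i : ℕ) = 0) : lake ψ i 0 = (ψ '' Icc 0 1)ᶜ := by
  ext p
  simp [lake, hi, closedCell_zero_eq_Icc]

theorem target_mem_lake_zero (hψ : Function.Injective ψ) (hi : (i : ℕ) = 0) :
    ψ (target 0 i 0) ∈ lake ψ i 0 := by
  refine image_openCell_subset_lake (k := 0) (z := par 0 i (0 : Fin n → ℤ)) hψ ⟨hi, fun h => ?_⟩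
    (mem_image_of_mem _ ?_)
  · have := congr_fun h (dirn i 0)
    simp [par_dirn, sgn, hi] at this
  · have := openCell_subset_up 0 _
      (center_mem_openCell (m := m) 1 (vtx i (par 0 i (0 : Fin n → ℤ))))
    rwa [up_vtx] at this

theorem target_mem_wadaLake : ψ (target 0 i 0) ∈ wadaLake ψ i :=
  mem_iUnion.2 ⟨1, image_box_subset_lake (k := 0) (Z := 0) rfl (mem_image_of_mem _ target_mem_box)⟩

variable [MetricSpace E]

theorem carrot_self (M : Set E) (ho : o ∈ M) : Carrot 0 0 M o o :=
  ⟨0, le_rfl, fun _ => o, by simp +contextual, rfl, rfl, fun t ht => ⟨ho, by linarith [ht.2]⟩⟩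

theorem IsChart.exists_carrot [NeZero m] (hψ : IsChart L c ψ) (hn : 3 ≤ n)
    (hne : wadaLake ψ i ≠ univ)
    (hout : ∀ p ∈ (ψ '' Icc 0 1)ᶜ, Carrot C 0 (ψ '' Icc 0 1)ᶜ o p) :
    ∃ C' : ℝ, ∃ o', ∀ p ∈ wadaLake ψ i, Carrot C' 0 (wadaLake ψ i) o' p := by
  have hopen := isOpen_wadaLake hψ.isOpenEmbedding i
  obtain ⟨C₁, o', h₁, h₂⟩ : ∃ C₁ : ℝ, ∃ o', Carrot C₁ 0 (wadaLake ψ i) o' (ψ (target 0 i 0)) ∧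
      ∀ p ∈ lake ψ i 0, Carrot C₁ 0 (wadaLake ψ i) o' p := by
    by_cases hi : (i : ℕ) = 0
    · have key : ∀ p ∈ lake ψ i 0, Carrot (max C 0) 0 (wadaLake ψ i) o p := fun p hp => by
        rw [lake_zero_eq hi] at hp
        refine ((hout p hp).mono (le_max_left C 0) le_rfl).mono_set (le_max_right _ _) ?_ hne
        rw [← lake_zero_eq hi]
        exact subset_iUnion (lake ψ i) 0
      exact ⟨_, o, key _ (target_mem_lake_zero hψ.isOpenEmbedding.injective hi), key⟩
    · exact ⟨0, _, carrot_self _ target_mem_wadaLake, fun p hp => absurd hp.1 hi⟩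
  obtain ⟨C₂, h₃⟩ := h₁.exists_of_isOpen hopen hne (startLength n m L 0 0)
  refine ⟨max (stepConst n m L c) (max C₁ C₂), o', fun p hp =>
    hψ.carrot_wadaLake (le_max_left _ _) hn hne (h₃.mono ?_ le_rfl)
      (fun p hp => (h₂ p hp).mono ?_ le_rfl) hp⟩
  · exact (le_max_right _ _).trans (le_max_right _ _)
  · exact (le_max_left _ _).trans (le_max_right _ _)

theorem IsChart.exists_lakes_of_wada [CompactSpace E] [ConnectedSpace E] (hψ : IsChart L c ψ)
    (hn : 3 ≤ n) (hm : 3 ≤ m) (hout : ∀ p ∈ (ψ '' Icc 0 1)ᶜ, Carrot C 0 (ψ '' Icc 0 1)ᶜ o p)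
    (hhom : Nonempty (((ψ '' Icc 0 1)ᶜ : Set E) ≃ₜ (Fin n → ℝ))) :
    ∃ C : ℝ, 1 ≤ C ∧ ∃ (X : Set E) (M : Fin m → Set E),
        X.Nonempty ∧ IsCompact X ∧ IsConnected X ∧
        (Pairwise fun i j => Disjoint (M i) (M j)) ∧
        (∀ i, (M i).Nonempty) ∧ (∀ i, IsOpen (M i)) ∧ (∀ i, IsConnected (M i)) ∧
        Xᶜ = ⋃ i, M i ∧
        (∀ i, frontier (M i) = X) ∧
        (∀ i, Nonempty (↥(M i) ≃ₜ ↥(ball (0 : EuclideanSpace ℝ (Fin n)) 1))) ∧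
        (∀ i, IsJohnDomain C (M i)) := by
  have : NeZero m := ⟨by omega⟩
  have hemb := hψ.isOpenEmbedding
  have hXne := compl_wadaLakes_nonempty hn (by omega : 1 < m) hemb
  have hne : ∀ i : Fin m, wadaLake ψ i ≠ univ := fun i h => by
    obtain ⟨p, hp⟩ := hXne
    exact hp (mem_iUnion.2 ⟨i, h ▸ mem_univ p⟩)
  have hhom' : ∀ i : Fin m, Nonempty (wadaLake ψ i ≃ₜ (Fin n → ℝ)) := by
    intro i
    by_cases hi : (i : ℕ) = 0
    · obtain ⟨e⟩ := wadaLake_zero_homeomorph hn hemb hi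
      obtain ⟨f⟩ := hhom
      rw [closedCell_zero_eq_Icc] at e
      exact ⟨e.trans f⟩
    · exact wadaLake_homeomorph_ball hn hemb hi
  have hconn : ∀ i : Fin m, IsConnected (wadaLake ψ i) := fun i => by
    obtain ⟨e⟩ := hhom' i
    have := e.symm.surjective.connectedSpace e.symm.continuous
    exact isConnected_iff_connectedSpace.2 this
  choose C' o' hC' using fun i : Fin m => hψ.exists_carrot hn (hne i) hout
  obtain ⟨K, hK⟩ := (Set.finite_range C').bddAbove
  refine ⟨max 1 K, le_max_left _ _, (⋃ i : Fin m, wadaLake ψ i)ᶜ, wadaLake ψ, hXne, ?_,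
    ⟨hXne, isPreconnected_compl_wadaLakes hn (by omega) hemb⟩,
    fun i j hij => disjoint_wadaLake hn hemb.injective hij, wadaLake_nonempty,
    isOpen_wadaLake hemb, hconn, compl_compl _, frontier_wadaLake hn hemb, fun i => ?_, fun i => ?_⟩
  · exact (isOpen_iUnion fun i => isOpen_wadaLake hemb i).isClosed_compl.isCompact
  · obtain ⟨e⟩ := hhom' i
    exact ⟨e.trans ((EuclideanSpace.equiv (Fin n) ℝ).symm.toHomeomorph.trans
      Homeomorph.unitBall)⟩
  · exact isJohnDomain_of_carrot (isOpen_wadaLake hemb i) (hconn i) (hne i) fun p hp =>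
      (hC' i p hp).mono ((hK (mem_range_self i)).trans (le_max_right _ _)) le_rfl

end Assembly

section SphereChart

open Topology

variable {n : ℕ}

/-- The vector with first coordinate `a` and remaining coordinates `y`. -/
noncomputable def vec (a : ℝ) (y : Fin n → ℝ) : EuclideanSpace ℝ (Fin (n + 1)) :=
  WithLp.toLp 2 (Fin.cons a y : Fin (n + 1) → ℝ)

/-- The coordinates of a vector except the first one. -/
def tail (v : EuclideanSpace ℝ (Fin (n + 1))) : Fin n → ℝ := fun q => v q.succ

@[simp] theorem vec_zero (a : ℝ) (y : Fin n → ℝ) : vec a y 0 = a := rfl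

@[simp] theorem vec_succ (a : ℝ) (y : Fin n → ℝ) (q : Fin n) : vec a y q.succ = y q := rfl

@[simp] theorem tail_vec (a : ℝ) (y : Fin n → ℝ) : tail (vec a y) = y := rfl

@[simp] theorem tail_smul (c : ℝ) (v : EuclideanSpace ℝ (Fin (n + 1))) :
    tail (c • v) = c • tail v := rfl

@[simp] theorem tail_add (v w : EuclideanSpace ℝ (Fin (n + 1))) :
    tail (v + w) = tail v + tail w := rfl

@[simp] theorem tail_sub (v w : EuclideanSpace ℝ (Fin (n + 1))) :
    tail (v - w) = tail v - tail w := rfl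

theorem ext_vec {v w : EuclideanSpace ℝ (Fin (n + 1))} (h₀ : v 0 = w 0) (h : tail v = tail w) :
    v = w := by
  ext q
  refine Fin.cases h₀ (fun q => congr_fun h q) q

theorem norm_tail_le (v : EuclideanSpace ℝ (Fin (n + 1))) : ‖tail v‖ ≤ ‖v‖ :=
  (pi_norm_le_iff_of_nonneg (norm_nonneg _)).2 fun q => PiLp.norm_apply_le v q.succ

theorem continuous_tail : Continuous (tail : EuclideanSpace ℝ (Fin (n + 1)) → Fin n → ℝ) := by
  unfold tail
  fun_prop

theorem continuous_vec {X : Type*} [TopologicalSpace X] {f : X → ℝ} {g : X → Fin n → ℝ}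
    (hf : Continuous f) (hg : Continuous g) : Continuous fun x => vec (f x) (g x) := by
  unfold vec
  refine (PiLp.continuous_toLp 2 _).comp (continuous_pi fun q => ?_)
  refine Fin.cases ?_ (fun q => ?_) q
  · simpa using hf
  · exact (continuous_apply q).comp hg

theorem norm_vec_le (a : ℝ) (y : Fin n → ℝ) : ‖vec a y‖ ≤ |a| + n * ‖y‖ := by
  rw [EuclideanSpace.norm_eq]
  apply Real.sqrt_le_iff.2
  refine ⟨by positivity, ?_⟩
  rw [Fin.sum_univ_succ]
  have h1 : ∑ q : Fin n, ‖vec a y q.succ‖ ^ 2 ≤ n * ‖y‖ ^ 2 := by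
    calc _ ≤ ∑ q : Fin n, ‖y‖ ^ 2 := by
          gcongr with q
          rw [vec_succ]
          exact norm_le_pi_norm y q
      _ = _ := by simp
  have h2 : (n : ℝ) ≤ n ^ 2 := by
    have : n ≤ n ^ 2 := Nat.le_self_pow two_ne_zero n
    exact_mod_cast this
  have h3 : n * ‖y‖ ^ 2 ≤ n ^ 2 * ‖y‖ ^ 2 := by gcongr
  have h4 : 0 ≤ |a| * (n * ‖y‖) := by positivity
  rw [vec_zero, Real.norm_eq_abs]
  nlinarith

open Classical in
/-- Radial projection to the unit sphere. -/
noncomputable def proj (v : EuclideanSpace ℝ (Fin (n + 1))) :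
    sphere (0 : EuclideanSpace ℝ (Fin (n + 1))) 1 :=
  if h : v = 0 then ⟨EuclideanSpace.single 0 1, by simp⟩
  else ⟨‖v‖⁻¹ • v, by simp [norm_smul, h]⟩

variable {v w : EuclideanSpace ℝ (Fin (n + 1))}

theorem coe_proj (hv : v ≠ 0) : (proj v : EuclideanSpace ℝ (Fin (n + 1))) = ‖v‖⁻¹ • v := by
  simp [proj, hv]

theorem ne_zero_of_mem (z : sphere (0 : EuclideanSpace ℝ (Fin (n + 1))) 1) :
    (z : EuclideanSpace ℝ (Fin (n + 1))) ≠ 0 := ne_zero_of_mem_unit_sphere z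

theorem proj_smul (z : sphere (0 : EuclideanSpace ℝ (Fin (n + 1))) 1) {c : ℝ} (hc : 0 < c) :
    proj (c • (z : EuclideanSpace ℝ (Fin (n + 1)))) = z := by
  ext1
  rw [coe_proj (smul_ne_zero hc.ne' (ne_zero_of_mem z)), norm_smul, norm_eq_of_mem_sphere,
    Real.norm_of_nonneg hc.le, smul_smul]
  simp [hc.ne']

theorem dist_proj_le (hv : v ≠ 0) (hw : w ≠ 0) : dist (proj v) (proj w) ≤ 2 * ‖v - w‖ / ‖v‖ := by
  have hv' := norm_pos_iff.2 hv
  have hw' := norm_pos_iff.2 hw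
  rw [Subtype.dist_eq, coe_proj hv, coe_proj hw, dist_eq_norm]
  have e : ‖v‖⁻¹ • v - ‖w‖⁻¹ • w = ‖v‖⁻¹ • (v - w) + (‖v‖⁻¹ - ‖w‖⁻¹) • w := by module
  have e2 : ‖v‖⁻¹ - ‖w‖⁻¹ = ‖v‖⁻¹ * (‖w‖ - ‖v‖) * ‖w‖⁻¹ := by field_simp
  have h1 : ‖(‖v‖⁻¹ - ‖w‖⁻¹) • w‖ ≤ ‖v‖⁻¹ * ‖v - w‖ := by
    rw [e2, norm_smul, norm_mul, norm_mul, norm_inv, norm_inv, norm_norm, norm_norm, mul_assoc,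
      inv_mul_cancel₀ hw'.ne', mul_one, Real.norm_eq_abs, abs_sub_comm]
    gcongr
    exact abs_norm_sub_norm_le v w
  rw [e]
  refine (norm_add_le _ _).trans ?_
  rw [norm_smul, norm_inv, norm_norm, div_eq_inv_mul]
  linarith

theorem continuous_proj {X : Type*} [TopologicalSpace X]
    {f : X → EuclideanSpace ℝ (Fin (n + 1))} (hf : Continuous f) (h : ∀ x, f x ≠ 0) :
    Continuous fun x => proj (f x) := by
  rw [Topology.IsInducing.subtypeVal.continuous_iff]
  have : (Subtype.val ∘ fun x => proj (f x)) = fun x => ‖f x‖⁻¹ • f x := by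
    ext1 x
    exact coe_proj (h x)
  rw [this]
  exact (hf.norm.inv₀ fun x => norm_ne_zero_iff.2 (h x)).smul hf

/-- The chart of the open upper hemisphere obtained by central projection. -/
noncomputable def chart (u : Fin n → ℝ) : sphere (0 : EuclideanSpace ℝ (Fin (n + 1))) 1 :=
  proj (vec 1 ((2 : ℝ) • u - 1))

theorem vec_ne_zero {a : ℝ} (ha : a ≠ 0) (y : Fin n → ℝ) : vec a y ≠ 0 := fun h =>
  ha (by simpa using congr_arg (fun v : EuclideanSpace ℝ (Fin (n + 1)) => v 0) h)

theorem one_le_norm_vec (y : Fin n → ℝ) : 1 ≤ ‖vec 1 y‖ := by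
  simpa using PiLp.norm_apply_le (vec 1 y) 0

theorem chart_zero (u : Fin n → ℝ) :
    (chart u : EuclideanSpace ℝ (Fin (n + 1))) 0 = ‖vec 1 ((2 : ℝ) • u - 1)‖⁻¹ := by
  rw [chart, coe_proj (vec_ne_zero one_ne_zero _)]
  simp

theorem chart_zero_pos (u : Fin n → ℝ) :
    0 < (chart u : EuclideanSpace ℝ (Fin (n + 1))) 0 := by
  rw [chart_zero]
  have := one_le_norm_vec ((2 : ℝ) • u - 1)
  positivity

theorem tail_chart (u : Fin n → ℝ) : tail (chart u : EuclideanSpace ℝ (Fin (n + 1))) =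
    (chart u : EuclideanSpace ℝ (Fin (n + 1))) 0 • ((2 : ℝ) • u - 1) := by
  rw [chart_zero, chart, coe_proj (vec_ne_zero one_ne_zero _), tail_smul, tail_vec]

/-- The inverse of `chart`. -/
noncomputable def chartInv (v : EuclideanSpace ℝ (Fin (n + 1))) : Fin n → ℝ :=
  (1 / 2 : ℝ) • ((v 0)⁻¹ • tail v + 1)

theorem chartInv_chart (u : Fin n → ℝ) :
    chartInv (chart u : EuclideanSpace ℝ (Fin (n + 1))) = u := by
  rw [chartInv, tail_chart, smul_smul, inv_mul_cancel₀ (chart_zero_pos u).ne']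
  ext q
  simp

theorem chart_chartInv {z : sphere (0 : EuclideanSpace ℝ (Fin (n + 1))) 1}
    (hz : 0 < (z : EuclideanSpace ℝ (Fin (n + 1))) 0) : chart (chartInv z.1) = z := by
  rw [chart]
  convert proj_smul z (inv_pos.2 hz) using 2
  apply ext_vec
  · simp [hz.ne']
  · rw [tail_vec, tail_smul, chartInv]
    ext q
    simp

theorem isOpenEmbedding_chart : IsOpenEmbedding (chart (n := n)) := by
  have h0 : Continuous fun z : sphere (0 : EuclideanSpace ℝ (Fin (n + 1))) 1 => z.1 0 := by
    fun_prop
  let e : OpenPartialHomeomorph (Fin n → ℝ) (sphere (0 : EuclideanSpace ℝ (Fin (n + 1))) 1) :=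
    { toFun := chart
      invFun := fun z => chartInv z.1
      source := univ
      target := {z | 0 < z.1 0}
      map_source' := fun u _ => chart_zero_pos u
      map_target' := fun _ _ => mem_univ _
      left_inv' := fun u _ => chartInv_chart u
      right_inv' := fun z hz => chart_chartInv hz
      open_source := isOpen_univ
      open_target := isOpen_lt continuous_const h0
      continuousOn_toFun := (continuous_proj (continuous_vec continuous_const (by fun_prop))
        fun u => vec_ne_zero one_ne_zero _).continuousOn
      continuousOn_invFun := by
        have h1 := continuous_tail.comp
          (continuous_subtype_val (p := (· ∈ sphere (0 : EuclideanSpace ℝ (Fin (n + 1))) 1)))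
        have h2 : ContinuousOn (fun z : sphere (0 : EuclideanSpace ℝ (Fin (n + 1))) 1 =>
            (z.1 0)⁻¹ • tail z.1 + 1) {z | 0 < z.1 0} :=
          ((h0.continuousOn.inv₀ fun z hz => ne_of_gt hz).smul h1.continuousOn).add
            continuousOn_const
        exact h2.const_smul (1 / 2 : ℝ) }
  exact e.isOpenEmbedding rfl

theorem dist_chart_le (u v : Fin n → ℝ) : dist (chart u) (chart v) ≤ (4 * n + 1) * dist u v := by
  refine (dist_proj_le (vec_ne_zero one_ne_zero _) (vec_ne_zero one_ne_zero _)).trans ?_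
  have h1 : vec 1 ((2 : ℝ) • u - 1) - vec 1 ((2 : ℝ) • v - 1) = vec 0 ((2 : ℝ) • (u - v)) := by
    apply ext_vec
    · simp
    · simp [smul_sub]
  have h2 := norm_vec_le 0 ((2 : ℝ) • (u - v))
  rw [abs_zero, zero_add, norm_smul, Real.norm_of_nonneg zero_le_two, ← dist_eq_norm] at h2
  rw [h1]
  calc _ ≤ 2 * ‖vec 0 ((2 : ℝ) • (u - v))‖ / 1 := by
        gcongr
        exact one_le_norm_vec _
    _ ≤ (4 * n + 1) * dist u v := by
        have := dist_nonneg (x := u) (y := v)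
        linarith

theorem ball_chart_subset {u : Fin n → ℝ} (hu : ∀ q, u q ∈ Icc (-1 : ℝ) 2) {r : ℝ} (hr : 0 < r)
    (hr1 : r ≤ 1) :
    ball (chart u) ((1 / (2 * (1 + 3 * n))) ^ 2 * r) ⊆ chart '' ball u r := by
  intro z hz
  obtain ⟨δ, hδ⟩ : ∃ δ : ℝ, δ = 1 / (2 * (1 + 3 * n)) := ⟨_, rfl⟩
  rw [← hδ] at hz
  have hn : (0 : ℝ) ≤ n := n.cast_nonneg
  have hδ0 : 0 < δ := by rw [hδ]; positivity
  have hδ1 : δ ≤ 1 / 2 := by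
    rw [hδ]
    apply one_div_le_one_div_of_le <;> linarith
  have hy : ∀ q, |2 * u q - 1| ≤ 3 := fun q => by
    rw [abs_le]
    constructor <;> linarith [(hu q).1, (hu q).2]
  have hw0 : 2 * δ ≤ (chart u).1 0 := by
    have h1 : ‖(2 : ℝ) • u - 1‖ ≤ 3 := (pi_norm_le_iff_of_nonneg (by norm_num)).2 fun q => by
      simpa using hy q
    have h2 := norm_vec_le 1 ((2 : ℝ) • u - 1)
    have h3 := one_le_norm_vec ((2 : ℝ) • u - 1)
    rw [chart_zero, hδ, ← one_div]
    calc 2 * (1 / (2 * (1 + 3 * (n : ℝ)))) = 1 / (1 + 3 * n) := by field_simp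
      _ ≤ _ := by
        apply one_div_le_one_div_of_le (by linarith)
        rw [abs_one] at h2
        nlinarith
  have hcoord : ∀ q, |z.1 q - (chart u).1 q| ≤ dist z (chart u) := fun q => by
    rw [Subtype.dist_eq, dist_eq_norm]
    exact PiLp.norm_apply_le (z.1 - (chart u).1) q
  rw [mem_ball] at hz
  have hz0 : δ ≤ z.1 0 := by
    have := (abs_le.1 (hcoord 0)).1
    nlinarith
  have hzpos := hδ0.trans_le hz0
  refine ⟨chartInv z.1, ?_, chart_chartInv hzpos⟩
  rw [mem_ball, dist_pi_lt_iff hr]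
  intro q
  have h1 := hcoord 0
  have h2 := hcoord q.succ
  have h3 : (chart u).1 q.succ = (chart u).1 0 * (2 * u q - 1) := congr_fun (tail_chart u) q
  have h4 : chartInv z.1 q - u q = 1 / 2 * ((z.1 0)⁻¹ *
      ((z.1 q.succ - (chart u).1 q.succ) - (2 * u q - 1) * (z.1 0 - (chart u).1 0))) := by
    have : chartInv z.1 q = 1 / 2 * ((z.1 0)⁻¹ * z.1 q.succ + 1) := rfl
    rw [this, h3]
    field_simp
    ring
  have h5 : |(z.1 q.succ - (chart u).1 q.succ) - (2 * u q - 1) * (z.1 0 - (chart u).1 0)| ≤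
      4 * dist z (chart u) := by
    refine (abs_sub _ _).trans ?_
    rw [abs_mul]
    have := mul_le_mul (hy q) h1 (abs_nonneg _) (by norm_num)
    linarith
  rw [Real.dist_eq, h4, abs_mul, abs_mul, abs_inv, abs_of_pos hzpos]
  calc _ ≤ |(1 / 2 : ℝ)| * (δ⁻¹ * (4 * dist z (chart u))) := by gcongr
    _ < |(1 / 2 : ℝ)| * (δ⁻¹ * (4 * (δ ^ 2 * r))) := by gcongr
    _ = 2 * δ * r := by
      rw [abs_of_pos (by norm_num)]
      field_simp
      norm_num
    _ ≤ r := by nlinarith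

theorem isChart_chart : IsChart (4 * n + 1) ((1 / (2 * (1 + 3 * n))) ^ 2) (chart (n := n)) where
  isOpenEmbedding := isOpenEmbedding_chart
  lipschitz_pos := by positivity
  open_pos := by positivity
  dist_le := dist_chart_le
  ball_subset _ hu _ hr hr1 := ball_chart_subset hu hr hr1

end SphereChart

section OuterDomain

variable {n : ℕ}

/-- A positively homogeneous function on `ℝ ^ (n + 1)` that is nonpositive exactly on the cone
over the image of the unit cube under `chart`. -/
noncomputable def height (v : EuclideanSpace ℝ (Fin (n + 1))) : ℝ := ‖tail v‖ - v 0

theorem height_smul {c : ℝ} (hc : 0 ≤ c) (v : EuclideanSpace ℝ (Fin (n + 1))) :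
    height (c • v) = c * height v := by
  rw [height, height, tail_smul, norm_smul, Real.norm_of_nonneg hc, PiLp.smul_apply, smul_eq_mul]
  ring

theorem height_vec (a : ℝ) (y : Fin n → ℝ) : height (vec a y) = ‖y‖ - a := by
  rw [height, tail_vec, vec_zero]

theorem continuous_height : Continuous (height (n := n)) :=
  continuous_tail.norm.sub (by fun_prop)

theorem height_sub_height_le (v w : EuclideanSpace ℝ (Fin (n + 1))) :
    height v - height w ≤ 2 * ‖v - w‖ := by
  have h1 := norm_tail_le (v - w)
  have h2 := (abs_norm_sub_norm_le (tail v) (tail w))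
  have h3 := PiLp.norm_apply_le (v - w) 0
  rw [PiLp.sub_apply, Real.norm_eq_abs] at h3
  rw [tail_sub] at h1
  have := (abs_le.1 h2).2
  have := (abs_le.1 h3).1
  unfold height
  linarith

theorem height_le (v : EuclideanSpace ℝ (Fin (n + 1))) : height v ≤ 2 * ‖v‖ := by
  have h : height (0 : EuclideanSpace ℝ (Fin (n + 1))) = 0 := by
    simpa using height_smul le_rfl (0 : EuclideanSpace ℝ (Fin (n + 1)))
  simpa [h] using height_sub_height_le v 0

theorem ne_zero_of_height_pos {v : EuclideanSpace ℝ (Fin (n + 1))} (hv : 0 < height v) :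
    v ≠ 0 := norm_pos_iff.1 (by linarith [height_le v])

theorem height_proj {v : EuclideanSpace ℝ (Fin (n + 1))} (hv : v ≠ 0) :
    height (proj v).1 = ‖v‖⁻¹ * height v := by
  rw [coe_proj hv, height_smul (by positivity)]

theorem mem_unitCube_iff_norm_le (u : Fin n → ℝ) : u ∈ Icc (0 : Fin n → ℝ) 1 ↔
    ‖(2 : ℝ) • u - 1‖ ≤ 1 := by
  rw [pi_norm_le_iff_of_nonneg zero_le_one, mem_Icc, Pi.le_def, Pi.le_def, ← forall_and]
  refine forall_congr' fun q => ?_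
  rw [Real.norm_eq_abs, abs_le]
  simp only [Pi.zero_apply, Pi.one_apply, Pi.sub_apply, Pi.smul_apply, smul_eq_mul]
  constructor <;> rintro ⟨h1, h2⟩ <;> constructor <;> linarith

theorem compl_chart_image_unitCube : (chart '' Icc (0 : Fin n → ℝ) 1)ᶜ =
    {z | 0 < height z.1} := by
  have key : ∀ u : Fin n → ℝ, height (chart u).1 =
      (chart u).1 0 * (‖(2 : ℝ) • u - 1‖ - 1) := fun u => by
    rw [height, tail_chart, norm_smul, Real.norm_of_nonneg (chart_zero_pos u).le]
    ring
  rw [compl_eq_comm]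
  ext z
  rw [mem_compl_iff, mem_ofPred_eq, not_lt]
  constructor
  · intro hz
    have hz0 : 0 < z.1 0 := by
      by_contra hneg
      have h1 : ‖tail z.1‖ ≤ z.1 0 := sub_nonpos.1 hz
      have h2 : z.1 0 = 0 := le_antisymm (not_lt.1 hneg) ((norm_nonneg _).trans h1)
      refine ne_zero_of_mem z (ext_vec h2 ?_)
      rw [norm_le_zero_iff.1 (h1.trans h2.le)]
      rfl
    refine ⟨chartInv z.1, ?_, chart_chartInv hz0⟩
    rw [← chart_chartInv hz0, key, chart_chartInv hz0] at hz
    rw [mem_unitCube_iff_norm_le]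
    nlinarith
  · rintro ⟨u, hu, rfl⟩
    rw [key]
    exact mul_nonpos_of_nonneg_of_nonpos (chart_zero_pos u).le
      (sub_nonpos.2 ((mem_unitCube_iff_norm_le u).1 hu))

/-- The complement of the image of the unit cube is homeomorphic to `ℝⁿ`. -/
noncomputable def heightPosHomeomorph :
    {z : sphere (0 : EuclideanSpace ℝ (Fin (n + 1))) 1 | 0 < height z.1} ≃ₜ (Fin n → ℝ) where
  toFun z := (height z.1.1)⁻¹ • tail z.1.1
  invFun u := ⟨proj (vec (‖u‖ - 1) u), by
    have h : 0 < height (vec (‖u‖ - 1) u) := by simp [height_vec]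
    have h0 := ne_zero_of_height_pos h
    rw [mem_ofPred_eq, height_proj h0]
    positivity⟩
  left_inv z := by
    have hz : 0 < height z.1.1 := z.2
    ext1
    refine Eq.trans ?_ (proj_smul z.1 (inv_pos.2 hz))
    refine congr_arg proj (ext_vec ?_ ?_)
    · rw [vec_zero, norm_smul, PiLp.smul_apply, Real.norm_of_nonneg (inv_pos.2 hz).le, smul_eq_mul,
        sub_eq_iff_eq_add, ← sub_eq_iff_eq_add', ← mul_sub]
      exact inv_mul_cancel₀ hz.ne'
    · rw [tail_vec, tail_smul]
  right_inv u := by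
    have h : height (vec (‖u‖ - 1) u) = 1 := by simp [height_vec]
    have h0 := ne_zero_of_height_pos (h.symm ▸ one_pos)
    have h1 := norm_ne_zero_iff.2 h0
    change (height (proj (vec (‖u‖ - 1) u)).1)⁻¹ • tail (proj (vec (‖u‖ - 1) u)).1 = u
    rw [height_proj h0, h, coe_proj h0, tail_smul, tail_vec, smul_smul, mul_one, inv_inv,
      mul_inv_cancel₀ h1, one_smul]
  continuous_toFun := by
    have h : Continuous fun z : {z : sphere (0 : EuclideanSpace ℝ (Fin (n + 1))) 1 |
        0 < height z.1} => z.1.1 := continuous_subtype_val.comp continuous_subtype_val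
    exact ((continuous_height.comp h).inv₀ fun z => ne_of_gt z.2).smul (continuous_tail.comp h)
  continuous_invFun := by
    refine Continuous.subtype_mk (continuous_proj (continuous_vec (by fun_prop) continuous_id)
      fun u => ne_zero_of_height_pos ?_) _
    simp [height_vec]

theorem height_le_infDist (z : sphere (0 : EuclideanSpace ℝ (Fin (n + 1))) 1) :
    height z.1 ≤ 2 * infDist z {z | 0 < height z.1}ᶜ := by
  have hne : ({z : sphere (0 : EuclideanSpace ℝ (Fin (n + 1))) 1 | 0 < height z.1}ᶜ).Nonempty := by
    rw [← compl_chart_image_unitCube, compl_compl]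
    exact ⟨_, mem_image_of_mem _ ⟨le_rfl, zero_le_one⟩⟩
  suffices height z.1 / 2 ≤ infDist z {z | 0 < height z.1}ᶜ by linarith
  refine (le_infDist hne).2 fun y hy => ?_
  have h1 : height y.1 ≤ 0 := not_lt.1 hy
  have h2 := height_sub_height_le z.1 y.1
  rw [← dist_eq_norm, ← Subtype.dist_eq] at h2
  linarith

theorem carrot_height_pos {z : sphere (0 : EuclideanSpace ℝ (Fin (n + 1))) 1}
    (hz : 0 < height z.1) : Carrot 40 0 {z | 0 < height z.1} (proj (vec (-1) 0)) z := by
  obtain ⟨p, hp⟩ : ∃ p : EuclideanSpace ℝ (Fin (n + 1)), p = vec (-1) 0 := ⟨_, rfl⟩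
  have hpn : ‖p‖ ≤ 1 := by simpa [hp] using norm_vec_le (-1) (0 : Fin n → ℝ)
  have hph : height p = 1 := by simp [hp, height_vec]
  have hzn : ‖z.1‖ = 1 := norm_eq_of_mem_sphere z
  obtain ⟨w, hw⟩ : ∃ w : ℝ → EuclideanSpace ℝ (Fin (n + 1)),
      ∀ s, w s = (1 - s) • z.1 + s • p := ⟨_, fun _ => rfl⟩
  have hw_sub : ∀ s t, ‖w s - w t‖ ≤ 2 * |s - t| := fun s t => by
    have e : w s - w t = (s - t) • (p - z.1) := by rw [hw, hw]; module
    rw [e, norm_smul, mul_comm, Real.norm_eq_abs]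
    gcongr
    exact (norm_sub_le _ _).trans (by linarith)
  have hw0 : w 0 = z.1 := by simp [hw]
  have hw_height : ∀ s ∈ Icc (0 : ℝ) 1, s ≤ height (w s) ∧ 0 < height (w s) := fun s hs => by
    have h1 : ‖tail (w s)‖ = ‖(1 - s) • tail z.1‖ := by simp [hw, hp]
    have h2 : height (w s) = (1 - s) * height z.1 + s := by
      rw [height, h1, norm_smul, Real.norm_of_nonneg (by linarith [hs.2]), hw, height]
      simp [hp]
      ring
    rw [h2]
    have h3 : 0 ≤ 1 - s := by linarith [hs.2]
    refine ⟨by nlinarith, ?_⟩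
    rcases hs.1.eq_or_lt with rfl | h
    · simpa using hz
    · positivity
  have hw_le : ∀ s ∈ Icc (0 : ℝ) 1, ‖w s‖ ≤ 1 := fun s hs => by
    rw [hw]
    refine (norm_add_le _ _).trans ?_
    rw [norm_smul, norm_smul, hzn, Real.norm_of_nonneg hs.1,
      Real.norm_of_nonneg (sub_nonneg.2 hs.2)]
    nlinarith [hs.1]
  have hw_ge : ∀ s ∈ Icc (0 : ℝ) 1, 1 / 5 ≤ ‖w s‖ := fun s hs => by
    have h1 := (hw_height s hs).1.trans (height_le _)
    have h2 := hw_sub 0 s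
    have h3 := norm_sub_norm_le (w 0) (w s)
    rw [zero_sub, abs_neg, abs_of_nonneg hs.1] at h2
    rw [hw0, hzn] at h3
    rw [hw0] at h2
    linarith
  have hne : ∀ s ∈ Icc (0 : ℝ) 1, w s ≠ 0 := fun s hs =>
    ne_zero_of_height_pos (hw_height s hs).2
  have hmem : ∀ t ∈ Icc (0 : ℝ) 20, t / 20 ∈ Icc (0 : ℝ) 1 := fun t ht =>
    ⟨by linarith [ht.1], by linarith [ht.2]⟩
  refine ⟨20, by norm_num, fun t => proj (w (t / 20)), fun s hs t ht => ?_, ?_, ?_, fun t ht => ?_⟩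
  · have hs' := hmem s hs
    have ht' := hmem t ⟨hs.1.trans ht.1, ht.2⟩
    refine (dist_proj_le (hne _ hs') (hne _ ht')).trans ?_
    calc _ ≤ 2 * (2 * |s / 20 - t / 20|) / (1 / 5) := by
          gcongr
          · exact hw_sub _ _
          · exact hw_ge _ hs'
      _ = t - s := by
          rw [abs_sub_comm, abs_of_nonneg (by linarith [ht.1])]
          ring
  · simpa [hw0] using proj_smul z one_pos
  · simp [hw, hp]
  · have ht' := hmem t ht
    have hn := norm_pos_iff.2 (hne _ ht')
    have h1 := height_proj (hne _ ht')
    have h2 : height (w (t / 20)) ≤ height (proj (w (t / 20))).1 := by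
      rw [h1]
      exact le_mul_of_one_le_left (hw_height _ ht').2.le ((one_le_inv₀ hn).2 (hw_le _ ht'))
    refine ⟨(hw_height _ ht').2.trans_le h2, ?_⟩
    have h3 := height_le_infDist (proj (w (t / 20)))
    have h4 := (hw_height _ ht').1
    linarith

end OuterDomain

end Wada

/-- Lakes of Wada on the sphere `Sⁿ`, `n ≥ 3`: for every `m ≥ 3` there exist a Wada
continuum `X ⊆ Sⁿ` with exactly `m` complementary components, each of which is
homeomorphic to the open unit ball of `ℝⁿ` and is a `C`-John domain in `Sⁿ`. -/
theorem lakes_of_wada_on_sphere (n m : ℕ) (hn : 3 ≤ n) (hm : 3 ≤ m) :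
    ∃ C : ℝ, 1 ≤ C ∧
      ∃ (X : Set ↥(sphere (0 : EuclideanSpace ℝ (Fin (n + 1))) 1))
        (M : Fin m → Set ↥(sphere (0 : EuclideanSpace ℝ (Fin (n + 1))) 1)),
        X.Nonempty ∧ IsCompact X ∧ IsConnected X ∧
        (Pairwise fun i j => Disjoint (M i) (M j)) ∧
        (∀ i, (M i).Nonempty) ∧ (∀ i, IsOpen (M i)) ∧ (∀ i, IsConnected (M i)) ∧
        Xᶜ = ⋃ i, M i ∧
        (∀ i, frontier (M i) = X) ∧
        (∀ i, Nonempty (↥(M i) ≃ₜ ↥(ball (0 : EuclideanSpace ℝ (Fin n)) 1))) ∧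
        (∀ i, IsJohnDomain C (M i)) := by
  have : NeZero n := ⟨by omega⟩
  have : ConnectedSpace (sphere (0 : EuclideanSpace ℝ (Fin (n + 1))) 1) := by
    refine isConnected_iff_connectedSpace.1 (isConnected_sphere ?_ 0 zero_le_one)
    rw [← Module.finrank_eq_rank, finrank_euclideanSpace_fin]
    exact_mod_cast (by omega : 1 < n + 1)
  refine Wada.isChart_chart.exists_lakes_of_wada (C := 40) (o := Wada.proj (Wada.vec (-1) 0))
    hn hm ?_ ?_
  · rw [Wada.compl_chart_image_unitCube]
    exact fun z hz => Wada.carrot_height_pos hz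
  · rw [Wada.compl_chart_image_unitCube]
    exact ⟨Wada.heightPosHomeomorph⟩
end

section
/- Let m ≥ 3 and let M_1, …, M_m be pairwise disjoint nonempty open connected subsets of ℝ² whose topological frontiers all coincide: frontier M_1 = frontier M_2 = ⋯ = frontier M_m. If M_i is bounded, then M_i is not a C-John domain in ℝ² for any constant C ≥ 1. In particular, given three pairwise disjoint nonempty open connected sets U, V, W ⊆ ℝ² with frontier U = frontier V = frontier W and U bounded, U is not a C-John domain in ℝ² for any C ≥ 1. -/
open Set Metric

/-- `(z - a) / (z - b)` has a continuous logarithm on `Z`. -/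
def HasLogQuot (Z : Set ℂ) (a b : ℂ) : Prop :=
  ∃ l : ℂ → ℂ, ContinuousOn l Z ∧ ∀ z ∈ Z, Complex.exp (l z) = (z - a) / (z - b)

theorem HasLogQuot.symm {Z : Set ℂ} {a b : ℂ} (h : HasLogQuot Z a b) : HasLogQuot Z b a := by
  obtain ⟨l, hl, he⟩ := h
  exact ⟨fun z => -l z, hl.neg, fun z hz => by rw [Complex.exp_neg, he z hz, inv_div]⟩

theorem HasLogQuot.trans {Z : Set ℂ} {a b c : ℂ} (hb : b ∉ Z) (h : HasLogQuot Z a b)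
    (h' : HasLogQuot Z b c) : HasLogQuot Z a c := by
  obtain ⟨l, hl, he⟩ := h
  obtain ⟨l', hl', he'⟩ := h'
  refine ⟨fun z => l z + l' z, hl.add hl', fun z hz => ?_⟩
  have : z - b ≠ 0 := sub_ne_zero.2 fun h => hb (h ▸ hz)
  rw [Complex.exp_add, he z hz, he' z hz, div_mul_div_cancel₀ this]

theorem HasLogQuot.eventually {Z : Set ℂ} (hZ : IsClosed Z) {a : ℂ} (ha : a ∉ Z) :
    ∀ᶠ b in nhds a, HasLogQuot Z a b := by
  obtain ⟨d, hd, hball⟩ := Metric.isOpen_iff.1 hZ.isOpen_compl a ha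
  filter_upwards [ball_mem_nhds a (half_pos hd)] with b hb
  rw [mem_ball, dist_eq_norm] at hb
  have hz1 : ∀ z ∈ Z, ‖b - a‖ < ‖z - b‖ := fun z hz => by
    have h1 : d ≤ ‖z - a‖ := by
      by_contra! h
      exact hball (by rwa [mem_ball, dist_eq_norm]) hz
    have h2 : ‖z - a‖ ≤ ‖z - b‖ + ‖b - a‖ := by
      simpa using norm_add_le (z - b) (b - a)
    linarith
  have hz0 : ∀ z ∈ Z, z - b ≠ 0 := fun z hz =>
    norm_pos_iff.1 ((norm_nonneg _).trans_lt (hz1 z hz))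
  have hslit : ∀ z ∈ Z, (z - a) / (z - b) ∈ Complex.slitPlane := fun z hz => by
    have h : (z - a) / (z - b) = 1 + (b - a) / (z - b) := by
      field_simp [hz0 z hz]
      ring
    rw [h]
    apply Complex.mem_slitPlane_of_norm_lt_one
    rw [norm_div, div_lt_one (norm_pos_iff.2 (hz0 z hz))]
    exact hz1 z hz
  refine ⟨fun z => Complex.log ((z - a) / (z - b)), ?_, fun z hz =>
    Complex.exp_log (Complex.slitPlane_ne_zero (hslit z hz))⟩
  exact ContinuousOn.clog (by fun_prop (disch := exact hz0)) hslit

theorem HasLogQuot.of_isPreconnected {Z T : Set ℂ} (hZ : IsClosed Z) (hT : IsPreconnected T)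
    (hTZ : Disjoint T Z) {a b : ℂ} (ha : a ∈ T) (hb : b ∈ T) : HasLogQuot Z a b :=
  hT.induction₂ (HasLogQuot Z)
    (fun _ hx => nhdsWithin_le_nhds (HasLogQuot.eventually hZ (disjoint_left.1 hTZ hx)))
    (fun _ _ _ _ hy _ h h' => h.trans (disjoint_left.1 hTZ hy) h')
    (fun _ _ _ _ h => h.symm) ha hb

theorem countable_setOf_exp_eq_one : {w : ℂ | Complex.exp w = 1}.Countable := by
  refine (countable_range fun n : ℤ => (n : ℂ) * (2 * Real.pi * Complex.I)).mono fun w hw => ?_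
  obtain ⟨n, hn⟩ := Complex.exp_eq_one_iff.1 hw
  exact ⟨n, hn.symm⟩

theorem IsPreconnected.eq_of_exp_eq_one {X : Type*} [TopologicalSpace X] {Q : Set X}
    (hQ : IsPreconnected Q) {g : X → ℂ} (hg : ContinuousOn g Q)
    (h : ∀ z ∈ Q, Complex.exp (g z) = 1) {x y : X} (hx : x ∈ Q) (hy : y ∈ Q) : g x = g y :=
  countable_setOf_exp_eq_one.isTotallyDisconnected (g '' Q) (image_subset_iff.2 h)
    (hQ.image g hg) (mem_image_of_mem g hx) (mem_image_of_mem g hy)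

/-- Logarithms on two closed sets glue if the overlap lies in a connected set. -/
theorem HasLogQuot.union {F₁ F₂ Q : Set ℂ} {a b : ℂ} (hF₁ : IsClosed F₁) (hF₂ : IsClosed F₂)
    (hQ : IsPreconnected Q) (hFQ : F₁ ∩ F₂ ⊆ Q) (ha : a ∉ Q) (hb : b ∉ Q)
    (h₁ : HasLogQuot (F₁ ∪ Q) a b) (h₂ : HasLogQuot (F₂ ∪ Q) a b) :
    HasLogQuot (F₁ ∪ F₂) a b := by
  classical
  obtain ⟨l₁, hl₁, he₁⟩ := h₁
  obtain ⟨l₂, hl₂, he₂⟩ := h₂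
  have hconst : ∃ c, Complex.exp c = 1 ∧ ∀ z ∈ Q, l₁ z = l₂ z + c := by
    have hexp : ∀ z ∈ Q, Complex.exp (l₁ z - l₂ z) = 1 := fun z hz => by
      have h1 : z - a ≠ 0 := sub_ne_zero.2 fun h => ha (h ▸ hz)
      have h2 : z - b ≠ 0 := sub_ne_zero.2 fun h => hb (h ▸ hz)
      rw [Complex.exp_sub, he₁ z (.inr hz), he₂ z (.inr hz), div_self (div_ne_zero h1 h2)]
    rcases Q.eq_empty_or_nonempty with rfl | ⟨q, hq⟩
    · exact ⟨0, by simp⟩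
    · refine ⟨l₁ q - l₂ q, hexp q hq, fun z hz => ?_⟩
      have := hQ.eq_of_exp_eq_one (g := fun z => l₁ z - l₂ z)
        ((hl₁.mono subset_union_right).sub (hl₂.mono subset_union_right)) hexp hz hq
      linear_combination this
  obtain ⟨c, hc, hcQ⟩ := hconst
  set l : ℂ → ℂ := fun z => if z ∈ F₁ then l₁ z else l₂ z + c with hl
  have heq₁ : EqOn l l₁ F₁ := fun z hz => by simp [hl, hz]
  have heq₂ : EqOn l (fun z => l₂ z + c) F₂ := fun z hz => by
    by_cases h : z ∈ F₁
    · simp [hl, h, hcQ z (hFQ ⟨h, hz⟩)]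
    · simp [hl, h]
  refine ⟨l, ContinuousOn.union_of_isClosed ((hl₁.mono subset_union_left).congr heq₁)
    (((hl₂.mono subset_union_left).add continuousOn_const).congr heq₂) hF₁ hF₂, ?_⟩
  rintro z (hz | hz)
  · rw [heq₁ hz, he₁ z (.inl hz)]
  · rw [heq₂ hz, Complex.exp_add, hc, mul_one, he₂ z (.inl hz)]

theorem not_hasLogQuot_sphere {p q : ℂ} {r : ℝ} (hr : 0 < r) (hrq : r < dist p q) :
    ¬ HasLogQuot (sphere p r) p q := by
  rintro ⟨l, hl, he⟩
  have hpq : p - q ≠ 0 := sub_ne_zero.2 (dist_pos.1 (hr.trans hrq))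
  set c : ℝ → ℂ := fun t => p + r * Complex.exp (t * Complex.I) with hc
  have hcont : Continuous c := by fun_prop
  have hcS : ∀ t, c t ∈ sphere p r := fun t => by
    simp [hc, Complex.norm_exp_ofReal_mul_I, abs_of_pos hr]
  have hslit : ∀ t, (c t - q) / (p - q) ∈ Complex.slitPlane := fun t => by
    have h : (c t - q) / (p - q) = 1 + (c t - p) / (p - q) := by
      field_simp
      ring
    rw [h]
    apply Complex.mem_slitPlane_of_norm_lt_one
    rw [norm_div, div_lt_one (norm_pos_iff.2 hpq), ← dist_eq_norm, ← dist_eq_norm,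
      mem_sphere.1 (hcS t)]
    exact hrq
  set g : ℝ → ℂ := fun t => l (c t) + Complex.log ((c t - q) / (p - q)) - t * Complex.I with hg
  have hgc : Continuous g := by
    have h1 : Continuous fun t => l (c t) := hl.comp_continuous hcont hcS
    have h2 : Continuous fun t => Complex.log ((c t - q) / (p - q)) :=
      Continuous.clog (by fun_prop) hslit
    exact (h1.add h2).sub (by fun_prop)
  have hge : ∀ t, Complex.exp (g t) = r / (p - q) := fun t => by
    have h0 : c t - q ≠ 0 := fun h => by
      have := Complex.slitPlane_ne_zero (hslit t)
      simp [h] at this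
    have h1 : c t - p = r * Complex.exp (t * Complex.I) := by simp [hc]
    rw [hg, Complex.exp_sub, Complex.exp_add, he _ (hcS t),
      Complex.exp_log (Complex.slitPlane_ne_zero (hslit t)), h1]
    have h2 := Complex.exp_ne_zero (t * Complex.I)
    field_simp
  have hr0 : (r : ℂ) / (p - q) ≠ 0 := div_ne_zero (by exact_mod_cast hr.ne') hpq
  have hper := isPreconnected_univ.eq_of_exp_eq_one (g := fun t => g t - g 0)
    (by fun_prop) (fun t _ => by rw [Complex.exp_sub, hge, hge, div_self hr0])
    (mem_univ (2 * Real.pi)) (mem_univ 0)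
  have hcc : c (2 * Real.pi) = c 0 := by simp [hc]
  simp [hg, hcc, Real.pi_ne_zero] at hper

theorem IsCompact.exists_isPreconnected_superset {E : Type*} [NormedAddCommGroup E]
    [NormedSpace ℝ E] [ProperSpace E] {F O : Set E} (hF : IsCompact F) (hO : IsOpen O)
    (hOc : IsConnected O) (hFO : F ⊆ O) :
    ∃ Q, IsCompact Q ∧ IsPreconnected Q ∧ F ⊆ Q ∧ Q ⊆ O := by
  obtain ⟨b, hb⟩ := hOc.nonempty
  suffices h : ∃ Q, IsCompact Q ∧ IsPreconnected Q ∧ b ∈ Q ∧ F ⊆ Q ∧ Q ⊆ O by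
    obtain ⟨Q, h1, h2, -, h3, h4⟩ := h
    exact ⟨Q, h1, h2, h3, h4⟩
  refine hF.induction_on (p := fun F => ∃ Q, IsCompact Q ∧ IsPreconnected Q ∧ b ∈ Q ∧ F ⊆ Q ∧ Q ⊆ O)
    ⟨{b}, isCompact_singleton, isPreconnected_singleton, rfl, empty_subset _,
      singleton_subset_iff.2 hb⟩ ?_ ?_ ?_
  · rintro s t hst ⟨Q, h1, h2, h3, h4, h5⟩
    exact ⟨Q, h1, h2, h3, hst.trans h4, h5⟩
  · rintro s t ⟨Q, h1, h2, h3, h4, h5⟩ ⟨Q', h1', h2', h3', h4', h5'⟩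
    exact ⟨Q ∪ Q', h1.union h1', h2.union b h3 h3' h2', .inl h3, union_subset_union h4 h4',
      union_subset h5 h5'⟩
  · intro x hx
    obtain ⟨r, hr, hball⟩ := nhds_basis_closedBall.mem_iff.1 (hO.mem_nhds (hFO hx))
    obtain ⟨γ, hγ⟩ := (hO.isConnected_iff_isPathConnected.1 hOc).joinedIn b hb x (hFO hx)
    refine ⟨closedBall x r, nhdsWithin_le_nhds (closedBall_mem_nhds x hr),
      range γ ∪ closedBall x r, (isCompact_range γ.continuous).union (isCompact_closedBall x r),
      (isPreconnected_range γ.continuous).union x ⟨1, γ.target⟩ (mem_closedBall_self hr.le)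
        (convex_closedBall x r).isPreconnected, .inl ⟨0, γ.source⟩, subset_union_right,
      union_subset (range_subset_iff.2 hγ) hball⟩

/-- A Janiszewski-type separation theorem: if every compact set that avoids
`closure U \ Ω` (respectively `Uᶜ \ Ω`) leaves `p` and `q` in one component of its complement,
then the connected open set `Ω` cannot contain all of the frontier of `U` except `p` and `q`. -/
theorem not_frontier_subset_union_pair {U Ω : Set ℂ} (hU : IsOpen U) (hΩ : IsOpen Ω)
    (hΩc : IsConnected Ω) {p q : ℂ} (hpq : p ≠ q)
    (h₁ : ∀ Z, IsCompact Z → Z ⊆ Ω ∪ (closure U)ᶜ →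
      ∃ T, IsPreconnected T ∧ p ∈ T ∧ q ∈ T ∧ Disjoint T Z)
    (h₂ : ∀ Z, IsCompact Z → Z ⊆ Ω ∪ U →
      ∃ T, IsPreconnected T ∧ p ∈ T ∧ q ∈ T ∧ Disjoint T Z) :
    ¬ frontier U ⊆ Ω ∪ {p, q} := by
  intro hfr
  have hd : 0 < dist p q := dist_pos.2 hpq
  have hcover : sphere p (dist p q / 2) ⊆ (Ω ∪ (closure U)ᶜ) ∪ (Ω ∪ U) := fun z hz => by
    by_cases hzU : z ∈ U
    · exact .inr (.inr hzU)
    by_cases hzc : z ∈ closure U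
    · rcases hfr ⟨hzc, fun h => hzU (interior_subset h)⟩ with h | h | h
      · exact .inl (.inl h)
      · rw [h, mem_sphere, dist_self] at hz
        linarith
      · rw [mem_singleton_iff.1 h, mem_sphere, dist_comm] at hz
        linarith
    · exact .inl (.inr hzc)
  obtain ⟨F₁, F₂, hF₁, hF₂, hs₁, hs₂, hS⟩ := (isCompact_sphere p _).binary_compact_cover
    (hΩ.union isClosed_closure.isOpen_compl) (hΩ.union hU) hcover
  have hF : F₁ ∩ F₂ ⊆ Ω := fun z hz => by
    rcases hs₁ hz.1 with h | h
    · exact h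
    · exact (hs₂ hz.2).resolve_right fun h' => h (subset_closure h')
  obtain ⟨Q, hQ, hQc, hFQ, hQΩ⟩ :=
    (hF₁.inter hF₂).exists_isPreconnected_superset hΩ hΩc hF
  obtain ⟨T₁, hT₁, hp₁, hq₁, hd₁⟩ := h₁ _ (hF₁.union hQ)
    (union_subset hs₁ (hQΩ.trans subset_union_left))
  obtain ⟨T₂, hT₂, hp₂, hq₂, hd₂⟩ := h₂ _ (hF₂.union hQ)
    (union_subset hs₂ (hQΩ.trans subset_union_left))
  refine not_hasLogQuot_sphere (half_pos hd) (half_lt_self hd) (hS ▸ ?_)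
  exact HasLogQuot.union hF₁.isClosed hF₂.isClosed hQc hFQ
    (fun h => disjoint_left.1 hd₁ hp₁ (.inr h)) (fun h => disjoint_left.1 hd₁ hq₁ (.inr h))
    (.of_isPreconnected (hF₁.union hQ).isClosed hT₁ hd₁ hp₁ hq₁)
    (.of_isPreconnected (hF₂.union hQ).isClosed hT₂ hd₂ hp₂ hq₂)

theorem not_frontier_subset_union_pair_of_homeomorph {E : Type*} [TopologicalSpace E]
    (h : E ≃ₜ ℂ) {U Ω : Set E} (hU : IsOpen U) (hΩ : IsOpen Ω)
    (hΩc : IsConnected Ω) {p q : E} (hpq : p ≠ q)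
    (h₁ : ∀ Z, IsCompact Z → Z ⊆ Ω ∪ (closure U)ᶜ →
      ∃ T, IsPreconnected T ∧ p ∈ T ∧ q ∈ T ∧ Disjoint T Z)
    (h₂ : ∀ Z, IsCompact Z → Z ⊆ Ω ∪ U →
      ∃ T, IsPreconnected T ∧ p ∈ T ∧ q ∈ T ∧ Disjoint T Z) :
    ¬ frontier U ⊆ Ω ∪ {p, q} := by
  intro hfr
  have key : ∀ S : Set E, (∀ Z, IsCompact Z → Z ⊆ S →
      ∃ T, IsPreconnected T ∧ p ∈ T ∧ q ∈ T ∧ Disjoint T Z) →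
      ∀ Z, IsCompact Z → Z ⊆ h '' S →
        ∃ T, IsPreconnected T ∧ h p ∈ T ∧ h q ∈ T ∧ Disjoint T Z := by
    intro S hS Z hZ hZS
    obtain ⟨T, hT, hp, hq, hd⟩ := hS (h ⁻¹' Z) (h.isCompact_preimage.2 hZ) fun z hz => by
      obtain ⟨y, hy, hyz⟩ := hZS hz
      rwa [← h.injective hyz]
    refine ⟨h '' T, hT.image h h.continuous.continuousOn, mem_image_of_mem h hp,
      mem_image_of_mem h hq, ?_⟩
    rw [disjoint_left]
    rintro _ ⟨t, ht, rfl⟩ hz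
    exact disjoint_left.1 hd ht hz
  refine not_frontier_subset_union_pair (h.isOpenMap U hU) (h.isOpenMap Ω hΩ)
    (hΩc.image h h.continuous.continuousOn) (h.injective.ne hpq) ?_ ?_ ?_
  · rw [← h.image_closure, ← image_compl_eq h.bijective, ← image_union]
    exact key _ h₁
  · rw [← image_union]
    exact key _ h₂
  · rw [← h.image_frontier, ← image_pair, ← image_union]
    exact image_mono hfr

/-- Points at which the John condition between boundary points `p` and `q` fails strictly
can be avoided by a connected set joining `p` to `q`. -/
theorem IsJohnDomain.exists_isPreconnected_disjoint {E : Type*} [NormedAddCommGroup E]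
    [NormedSpace ℝ E] {C : ℝ} (hC : 0 ≤ C) {U : Set E} (hU : IsJohnDomain C U) {p q : E}
    (hp : p ∈ closure U) (hq : q ∈ closure U) {Z : Set E} (hZ : IsCompact Z)
    (hlt : ∀ z ∈ Z, C * infDist z Uᶜ < min (dist z p) (dist z q)) :
    ∃ T, IsPreconnected T ∧ p ∈ T ∧ q ∈ T ∧ Disjoint T Z := by
  obtain ⟨ε, hε, hεZ⟩ : ∃ ε > 0, ∀ z ∈ Z, C * infDist z Uᶜ + ε < min (dist z p) (dist z q) := by
    rcases Z.eq_empty_or_nonempty with rfl | hne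
    · exact ⟨1, one_pos, by simp⟩
    have hcont : Continuous fun z => min (dist z p) (dist z q) - C * infDist z Uᶜ :=
      (by fun_prop : Continuous fun z => min (dist z p) (dist z q)).sub
        (continuous_const.mul (continuous_infDist_pt _))
    obtain ⟨z₀, hz₀, hmin⟩ := hZ.exists_isMinOn hne hcont.continuousOn
    refine ⟨(min (dist z₀ p) (dist z₀ q) - C * infDist z₀ Uᶜ) / 2,
      half_pos (sub_pos.2 (hlt z₀ hz₀)), fun z hz => ?_⟩
    have h1 := isMinOn_iff.1 hmin z hz
    have h2 := hlt z₀ hz₀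
    linarith
  obtain ⟨a, haU, hap⟩ := Metric.mem_closure_iff.1 hp ε hε
  obtain ⟨b, hbU, hbq⟩ := Metric.mem_closure_iff.1 hq ε hε
  obtain ⟨γ, hγc, hγ0, hγ1, -, -, hγJ⟩ := hU.2.2.2 a haU b hbU
  have hγZ : ∀ t ∈ Icc (0 : ℝ) 1, γ t ∉ Z := fun t ht hz => by
    have hnn : 0 ≤ C * infDist (γ t) Uᶜ := mul_nonneg hC infDist_nonneg
    have h := hεZ _ hz
    rcases min_le_iff.1 (hγJ t ht) with hl | hl
    · have h1 := (eVariationOn.edist_le γ (right_mem_Icc.2 ht.1) (left_mem_Icc.2 ht.1)).trans hl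
      rw [edist_dist, ENNReal.ofReal_le_ofReal_iff hnn, hγ0] at h1
      have h2 := dist_triangle (γ t) a p
      rw [dist_comm a p] at h2
      have h3 := min_le_left (dist (γ t) p) (dist (γ t) q)
      linarith
    · have h1 := (eVariationOn.edist_le γ (left_mem_Icc.2 ht.2) (right_mem_Icc.2 ht.2)).trans hl
      rw [edist_dist, ENNReal.ofReal_le_ofReal_iff hnn, hγ1] at h1
      have h2 := dist_triangle (γ t) b q
      rw [dist_comm b q] at h2
      have h3 := min_le_right (dist (γ t) p) (dist (γ t) q)
      linarith
  have hball : ∀ z ∈ Z, ε < dist z p ∧ ε < dist z q := fun z hz => by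
    have hnn : 0 ≤ C * infDist z Uᶜ := mul_nonneg hC infDist_nonneg
    exact lt_min_iff.1 ((le_add_of_nonneg_left hnn).trans_lt (hεZ z hz))
  have h0 : (0 : ℝ) ∈ Icc (0 : ℝ) 1 := ⟨le_rfl, zero_le_one⟩
  have h1 : (1 : ℝ) ∈ Icc (0 : ℝ) 1 := ⟨zero_le_one, le_rfl⟩
  refine ⟨ball p ε ∪ γ '' Icc 0 1 ∪ ball q ε, ?_, .inl (.inl (mem_ball_self hε)),
    .inr (mem_ball_self hε), ?_⟩
  · refine IsPreconnected.union b (.inr ⟨1, h1, hγ1⟩) (by rwa [mem_ball, dist_comm]) ?_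
      (convex_ball q ε).isPreconnected
    exact IsPreconnected.union a (by rwa [mem_ball, dist_comm]) ⟨0, h0, hγ0⟩
      (convex_ball p ε).isPreconnected (isPreconnected_Icc.image γ hγc)
  · rw [disjoint_left]
    rintro z ((hz | ⟨t, ht, rfl⟩) | hz) hzZ
    · exact (hball z hzZ).1.not_gt hz
    · exact hγZ t ht hzZ
    · exact (hball z hzZ).2.not_gt hz

/-- Frontier points accessible from an open set by a segment are dense in its frontier. -/
theorem IsOpen.exists_accessible_dist_lt {E : Type*} [NormedAddCommGroup E] [NormedSpace ℝ E]
    [ProperSpace E] {V : Set E} (hV : IsOpen V) {x : E} (hx : x ∈ frontier V) {ε : ℝ}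
    (hε : 0 < ε) :
    ∃ p ∈ frontier V, dist p x < ε ∧ ∃ v ∈ V, segment ℝ v p ⊆ V ∪ {p} := by
  obtain ⟨v, hvV, hv⟩ := Metric.mem_closure_iff.1 hx.1 (ε / 2) (half_pos hε)
  have hxV : x ∈ Vᶜ := fun h => hx.2 (hV.interior_eq.symm ▸ h)
  obtain ⟨p, hp, hvp⟩ := hV.isClosed_compl.exists_infDist_eq_dist ⟨x, hxV⟩ v
  have hball : ball v (dist v p) ⊆ V := fun z hz => by
    by_contra h
    have := infDist_le_dist_of_mem (x := v) (show z ∈ Vᶜ from h)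
    rw [mem_ball, dist_comm] at hz
    linarith
  have hne : dist v p ≠ 0 := fun h => hp (dist_eq_zero.1 h ▸ hvV)
  refine ⟨p, ⟨closure_mono hball ?_, fun h => hp (interior_subset h)⟩, ?_, v, hvV, fun z hz => ?_⟩
  · rw [closure_ball v hne, mem_closedBall, dist_comm]
  · have h1 := infDist_le_dist_of_mem (x := v) hxV
    have h2 := dist_triangle p v x
    rw [dist_comm p v] at h2
    rw [dist_comm x v] at hv
    linarith
  · by_cases h : z = p
    · exact .inr h
    · have h1 := dist_add_dist_of_mem_segment hz
      have h2 := dist_pos.2 h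
      exact .inl (hball (by rw [mem_ball, dist_comm]; linarith))

/-- A connected open set contains, up to its two endpoints, a continuum joining two distinct
frontier points. -/
theorem IsOpen.exists_continuum_joining_frontier {E : Type*} [NormedAddCommGroup E]
    [NormedSpace ℝ E] [ProperSpace E] {V : Set E} (hV : IsOpen V) (hVc : IsConnected V)
    (hfr : (frontier V).Nontrivial) :
    ∃ p ∈ frontier V, ∃ q ∈ frontier V, p ≠ q ∧ ∃ B, IsCompact B ∧ IsPreconnected B ∧
      p ∈ B ∧ q ∈ B ∧ B ⊆ V ∪ {p, q} := by
  obtain ⟨x, hx, y, hy, hxy⟩ := hfr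
  have hd : 0 < dist x y / 2 := half_pos (dist_pos.2 hxy)
  obtain ⟨p, hp, hpx, v, hv, hvp⟩ := hV.exists_accessible_dist_lt hx hd
  obtain ⟨q, hq, hqy, w, hw, hwq⟩ := hV.exists_accessible_dist_lt hy hd
  obtain ⟨γ, hγ⟩ := (hV.isConnected_iff_isPathConnected.1 hVc).joinedIn v hv w hw
  have hcpt : ∀ a b : E, IsCompact (segment ℝ a b) := fun a b => by
    rw [segment_eq_image_lineMap]
    exact isCompact_Icc.image AffineMap.lineMap_continuous
  refine ⟨p, hp, q, hq, ?_, segment ℝ v p ∪ range γ ∪ segment ℝ w q,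
    ((hcpt v p).union (isCompact_range γ.continuous)).union (hcpt w q), ?_,
    .inl (.inl (right_mem_segment ℝ v p)), .inr (right_mem_segment ℝ w q), ?_⟩
  · rintro rfl
    have := dist_triangle_left x y p
    linarith
  · refine IsPreconnected.union w (.inr ⟨1, γ.target⟩) (left_mem_segment ℝ w q) ?_
      (convex_segment w q).isPreconnected
    exact IsPreconnected.union v (left_mem_segment ℝ v p) ⟨0, γ.source⟩
      (convex_segment v p).isPreconnected (isPreconnected_range γ.continuous)
  · rintro z ((hz | ⟨t, rfl⟩) | hz)
    · exact (hvp hz).imp id fun h => .inl h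
    · exact .inl (hγ t)
    · exact (hwq hz).imp id fun h => .inr h

theorem not_countable_frontier {E : Type*} [AddCommGroup E] [Module ℝ E] [TopologicalSpace E]
    [ContinuousAdd E] [ContinuousSMul ℝ E] (hE : 1 < Module.rank ℝ E) {U V : Set E}
    (hU : IsOpen U) (hV : IsOpen V) (hUne : U.Nonempty) (hVne : V.Nonempty)
    (hUV : Disjoint U V) (hfr : frontier U = frontier V) : ¬ (frontier U).Countable := by
  intro hc
  obtain ⟨u, hu⟩ := hUne
  obtain ⟨v, hv⟩ := hVne
  have hconn := (hc.isPathConnected_compl_of_one_lt_rank hE).isConnected.isPreconnected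
  have huK : u ∉ frontier U := disjoint_right.1 (disjoint_frontier_iff_isOpen.2 hU) hu
  have hvK : v ∉ frontier U := hfr ▸ disjoint_right.1 (disjoint_frontier_iff_isOpen.2 hV) hv
  obtain ⟨z, hz, hzU, hzc⟩ := hconn U (closure U)ᶜ hU isClosed_closure.isOpen_compl
    (fun z hz => by
      by_cases h : z ∈ closure U
      · exact .inl (by_contra fun h' => hz ⟨h, fun h'' => h' (interior_subset h'')⟩)
      · exact .inr h)
    ⟨u, huK, hu⟩ ⟨v, hvK, disjoint_right.1 (hUV.closure_left hV) hv⟩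
  exact hzc (subset_closure hzU)

/-- A planar John domain is not one of three disjoint domains with a common frontier. -/
theorem not_isJohnDomain_of_common_frontier {U V W : Set (EuclideanSpace ℝ (Fin 2))} {C : ℝ}
    (hC : 0 ≤ C) (hUo : IsOpen U) (hVo : IsOpen V) (hWo : IsOpen W) (hUne : U.Nonempty)
    (hVc : IsConnected V) (hWc : IsConnected W) (hUV : Disjoint U V) (hUW : Disjoint U W)
    (hVW : Disjoint V W) (hfV : frontier U = frontier V) (hfW : frontier U = frontier W) :
    ¬ IsJohnDomain C U := by
  intro hJ
  have hrank : 1 < Module.rank ℝ (EuclideanSpace ℝ (Fin 2)) := by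
    rw [rank_eq_card_basis (EuclideanSpace.basisFun (Fin 2) ℝ).toBasis]
    simp
  have hnt : (frontier V).Nontrivial := by
    rw [← hfV]
    by_contra h
    exact not_countable_frontier hrank hUo hVo hUne hVc.nonempty hUV hfV
      (not_nontrivial_iff.1 h).countable
  obtain ⟨p, hp, q, hq, hpq, B, hB, hBc, hpB, hqB, hBV⟩ :=
    hVo.exists_continuum_joining_frontier hVc hnt
  rw [← hfV] at hp hq
  set A := {z | min (dist z p) (dist z q) ≤ C * infDist z Uᶜ} with hA
  have hAcl : IsClosed A := isClosed_le (by fun_prop)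
    (continuous_const.mul (continuous_infDist_pt _))
  have hAU : A ⊆ U ∪ {p, q} := fun z hz => by
    by_cases hzU : z ∈ U
    · exact .inl hzU
    · rw [hA, mem_ofPred_eq, infDist_zero_of_mem (show z ∈ Uᶜ from hzU), mul_zero] at hz
      exact .inr ((min_le_iff.1 hz).imp dist_le_zero.1 dist_le_zero.1)
  have hK : ∀ {S : Set (EuclideanSpace ℝ (Fin 2))}, IsOpen S → frontier U = frontier S →
      ∀ z ∈ frontier U, z ∉ S := fun hS h z hz =>
    disjoint_left.1 (disjoint_frontier_iff_isOpen.2 hS) (h ▸ hz)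
  have hpqK : ∀ z ∈ ({p, q} : Set _), z ∈ frontier U := by
    rintro z (rfl | rfl) <;> assumption
  have hWX : W ⊆ (A ∪ B)ᶜ := by
    rintro z hz (h | h)
    · exact (hAU h).elim (fun h => disjoint_left.1 hUW h hz) fun h => hK hWo hfW z (hpqK z h) hz
    · exact (hBV h).elim (fun h => disjoint_left.1 hVW h hz) fun h => hK hWo hfW z (hpqK z h) hz
  obtain ⟨w, hw⟩ := hWc.nonempty
  set Ω := connectedComponentIn (A ∪ B)ᶜ w with hΩ
  have hXo : IsOpen (A ∪ B)ᶜ := (hAcl.union hB.isClosed).isOpen_compl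
  have hΩX : Ω ⊆ (A ∪ B)ᶜ := connectedComponentIn_subset _ _
  have hWΩ : W ⊆ Ω := hWc.isPreconnected.subset_connectedComponentIn hw hWX
  refine not_frontier_subset_union_pair_of_homeomorph
    Complex.orthonormalBasisOneI.repr.symm.toHomeomorph hUo hXo.connectedComponentIn
    (isConnected_connectedComponentIn_iff.2 (hWX hw)) hpq ?_ ?_ ?_
  · intro Z hZ hZs
    refine hJ.exists_isPreconnected_disjoint hC hp.1 hq.1 hZ fun z hz => ?_
    by_contra! hzA
    rcases hZs hz with h | h
    · exact hΩX h (.inl hzA)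
    · exact h ((hAU hzA).elim (fun h => subset_closure h) fun h => (hpqK z h).1)
  · intro Z _ hZs
    refine ⟨B, hBc, hpB, hqB, disjoint_left.2 fun z hzB hzZ => ?_⟩
    rcases hZs hzZ with h | h
    · exact hΩX h (.inr hzB)
    · exact (hBV hzB).elim (fun h' => disjoint_left.1 hUV h h') fun h' =>
        hK hUo rfl z (hpqK z h') h
  · intro z hz
    by_cases hzX : z ∈ A ∪ B
    · refine .inr ?_
      rcases hzX with h | h
      · exact (hAU h).resolve_left (hK hUo rfl z hz)
      · exact (hBV h).resolve_left (hK hVo hfV z hz)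
    · obtain ⟨r, hr, hball⟩ := Metric.isOpen_iff.1 hXo z hzX
      obtain ⟨y, hyW, hy⟩ := Metric.mem_closure_iff.1 (hfW ▸ hz).1 r hr
      have hconn : IsPreconnected (ball z r ∪ W) :=
        (convex_ball z r).isPreconnected.union y (by rwa [mem_ball, dist_comm]) hyW
          hWc.isPreconnected
      exact .inl (hconn.subset_connectedComponentIn (.inr hw) (union_subset hball hWX)
        (.inl (mem_ball_self hr)))

/-- Two-dimensional Lakes of Wada are never John domains: if `m ≥ 3` pairwise disjoint
nonempty open connected subsets of `ℝ²` share the same topological frontier, then no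
bounded one among them is a `C`-John domain in `ℝ²` for any `C ≥ 1`. -/
theorem planar_lakes_of_wada_not_john (m : ℕ) (hm : 3 ≤ m)
    (M : Fin m → Set (EuclideanSpace ℝ (Fin 2)))
    (hdisj : Pairwise fun i j => Disjoint (M i) (M j))
    (hne : ∀ i, (M i).Nonempty) (hopen : ∀ i, IsOpen (M i))
    (hconn : ∀ i, IsConnected (M i))
    (hfr : ∀ i j, frontier (M i) = frontier (M j))
    (i : Fin m) (hbd : Bornology.IsBounded (M i)) :
    ∀ C : ℝ, 1 ≤ C → ¬ IsJohnDomain C (M i) := by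
  intro C hC
  obtain ⟨j, hj⟩ : ∃ j, j ∉ ({i} : Finset (Fin m)) :=
    Finset.exists_mem_notMem_of_card_lt_card (t := Finset.univ)
      (by rw [Finset.card_singleton, Finset.card_fin]; omega) |>.imp fun _ h => h.2
  obtain ⟨k, hk⟩ : ∃ k, k ∉ ({i, j} : Finset (Fin m)) :=
    Finset.exists_mem_notMem_of_card_lt_card (t := Finset.univ)
      (by
        rw [Finset.card_fin]
        exact Finset.card_le_two.trans_lt hm) |>.imp fun _ h => h.2
  simp only [Finset.mem_insert, Finset.mem_singleton, not_or] at hj hk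
  exact not_isJohnDomain_of_common_frontier (zero_le_one.trans hC) (hopen i) (hopen j) (hopen k)
    (hne i) (hconn j) (hconn k) (hdisj (Ne.symm hj)) (hdisj (Ne.symm hk.1))
    (hdisj (Ne.symm hk.2)) (hfr i j) (hfr i k)
end
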